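/- arXiv:1101.3773 — 4 statements merged into one kernel-verified Lean document; each statement's English description precedes it below -/
import Mathlib

section
/- Let W = {(x,y,z) ∈ ℝ³ : x ≤ 0, y ≤ 0, z ≤ 0} be the octant with apex at the origin. For every subset S of ℝ³, every finite index set I, and every family (t_i + W)_{i ∈ I} of translates of W that forms a 12-fold covering of S (i.e., every point of S lies in at least 12 of the sets t_i + W, counted with multiplicity of the index), there is a partition of I into two sets I₁ and I₂ such that every point of S lies in t_i + W for some i ∈ I₁ and also lies in t_j + W for some j ∈ I₂. -/
namespace OctantCover

variable {ι α : Type*} [LinearOrder α] {X Y : ι → α}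

/-- `e` dominates `b` in both coordinates. -/
def Dom (X Y : ι → α) (b e : ι) : Prop := X b ≤ X e ∧ Y b ≤ Y e

/-- `m` lies in the smallest quadrant containing two given points. -/
def Span (X Y : ι → α) (e e' m : ι) : Prop :=
  (X e ≤ X m ∨ X e' ≤ X m) ∧ (Y e ≤ Y m ∨ Y e' ≤ Y m)

/-- The class of regions which includes all quadrants. -/
def SpanClosed (X Y : ι → α) (R : ι → Prop) : Prop :=
  ∀ ⦃e e' m⦄, R e → R e' → Span X Y e e' m → R m

/-- `e` is a maximal element of `P`. -/
def IsStair (X Y : ι → α) (P : Finset ι) (e : ι) : Prop :=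
  e ∈ P ∧ ∀ j ∈ P, Dom X Y e j → j = e

/-- The relation between consecutive maximal elements of `P`. -/
def Adj (X Y : ι → α) (P : Finset ι) (e e' : ι) : Prop :=
  e ≠ e' ∧ IsStair X Y P e ∧ IsStair X Y P e' ∧
    ∀ m, IsStair X Y P m → Span X Y e e' m → m = e ∨ m = e'

theorem Dom.refl (b : ι) : Dom X Y b b := ⟨le_rfl, le_rfl⟩

theorem Dom.trans {a b c : ι} (h : Dom X Y a b) (h' : Dom X Y b c) : Dom X Y a c :=
  ⟨h.1.trans h'.1, h.2.trans h'.2⟩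

theorem Span.symm {e e' m : ι} (h : Span X Y e e' m) : Span X Y e' e m :=
  ⟨h.1.symm, h.2.symm⟩

theorem Span.left (e e' : ι) : Span X Y e e' e := ⟨.inl le_rfl, .inl le_rfl⟩

theorem Span.right (e e' : ι) : Span X Y e e' e' := ⟨.inr le_rfl, .inr le_rfl⟩

theorem Span.dom {e e' m n : ι} (h : Span X Y e e' m) (h' : Dom X Y m n) : Span X Y e e' n := by
  unfold Span Dom at *; grind

theorem spanClosed_span (e e' : ι) : SpanClosed X Y (Span X Y e e') := by
  unfold SpanClosed Span; grind

theorem SpanClosed.dom {R : ι → Prop} (hR : SpanClosed X Y R) {e p : ι} (he : R e)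
    (h : Dom X Y e p) : R p :=
  hR he he ⟨.inl h.1, .inl h.2⟩

theorem dom_of_span {b e e' m : ι} (h : Dom X Y b e) (h' : Dom X Y b e')
    (hm : Span X Y e e' m) : Dom X Y b m := by
  unfold Span Dom at *; grind

theorem Adj.symm {P : Finset ι} {e e' : ι} (h : Adj X Y P e e') : Adj X Y P e' e :=
  ⟨h.1.symm, h.2.2.1, h.2.1, fun m hm hs => (h.2.2.2 m hm hs.symm).symm⟩

theorem exists_stair_dom (hX : X.Injective) {P : Finset ι} {b : ι} (hb : b ∈ P) :
    ∃ e, IsStair X Y P e ∧ Dom X Y b e := by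
  classical
  obtain ⟨e, he, hmax⟩ := (P.filter (Dom X Y b)).exists_max_image X
    ⟨b, Finset.mem_filter.2 ⟨hb, Dom.refl b⟩⟩
  rw [Finset.mem_filter] at he
  exact ⟨e, ⟨he.1, fun j hj hd => hX (le_antisymm
    (hmax j (Finset.mem_filter.2 ⟨hj, he.2.trans hd⟩)) hd.1)⟩, he.2⟩

section Stair

variable {P : Finset ι}

theorem IsStair.lt_of_lt {e e' : ι} (h : IsStair X Y P e) (h' : IsStair X Y P e')
    (hlt : X e < X e') : Y e' < Y e := by
  by_contra! hle
  have := h.2 e' h'.1 ⟨hlt.le, hle⟩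
  exact hlt.ne' (congrArg X this)

theorem IsStair.eq_or {e e' : ι} (h : IsStair X Y P e) (h' : IsStair X Y P e') :
    e = e' ∨ (X e < X e' ∧ Y e' < Y e) ∨ (X e' < X e ∧ Y e < Y e') := by
  rcases lt_trichotomy (X e) (X e') with hlt | heq | hlt
  · exact .inr (.inl ⟨hlt, h.lt_of_lt h' hlt⟩)
  · rcases le_total (Y e) (Y e') with hy | hy
    · exact .inl (h.2 e' h'.1 ⟨heq.le, hy⟩).symm
    · exact .inl (h'.2 e h.1 ⟨heq.ge, hy⟩)
  · exact .inr (.inr ⟨hlt, h'.lt_of_lt h hlt⟩)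

theorem Span.antisymm {e y m : ι} (he : IsStair X Y P e) (hy : IsStair X Y P y)
    (hm : IsStair X Y P m) (h : Span X Y e y m) (h' : Span X Y m y e) : m = e := by
  have h1 := he.eq_or hy
  have h2 := he.eq_or hm
  have h3 := hy.eq_or hm
  unfold Span at h h'
  grind

theorem Span.dom_of_dom {e e' m p : ι} (he : IsStair X Y P e) (he' : IsStair X Y P e')
    (hm : IsStair X Y P m) (h : Span X Y e e' m) (hp : Dom X Y e p) (hp' : Dom X Y e' p) :
    Dom X Y m p := by
  have h1 := he.eq_or he'
  have h2 := he.eq_or hm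
  have h3 := he'.eq_or hm
  unfold Span Dom at *
  grind

theorem Span.of_covered {x e m p : ι} (hx : IsStair X Y P x) (he : IsStair X Y P e)
    (hm : IsStair X Y P m) (hmp : ¬ Dom X Y m p) (hep : Dom X Y e p)
    (h : Span X Y x e m) : Span X Y x p m := by
  have h1 := hx.eq_or he
  have h2 := hx.eq_or hm
  have h3 := he.eq_or hm
  unfold Span Dom at *
  grind

theorem exists_nearest {Q : ι → Prop} {d y : ι} (hd : IsStair X Y P d) (hQ : Q d)
    (hy : IsStair X Y P y) : ∃ e, IsStair X Y P e ∧ Q e ∧ Span X Y d y e ∧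
      ∀ m, IsStair X Y P m → Q m → Span X Y e y m → m = e := by
  classical
  obtain ⟨e, he, hmin⟩ := (P.filter fun e => IsStair X Y P e ∧ Q e ∧ Span X Y d y e).exists_min_image
    (fun e => (P.filter fun n => Span X Y e y n).card)
    ⟨d, Finset.mem_filter.2 ⟨hd.1, hd, hQ, Span.left d y⟩⟩
  rw [Finset.mem_filter] at he
  refine ⟨e, he.2.1, he.2.2.1, he.2.2.2, fun m hm hQm hs => ?_⟩
  by_contra hne
  have hdm : Span X Y d y m := spanClosed_span d y he.2.2.2 (Span.right d y) hs
  refine absurd (hmin m (Finset.mem_filter.2 ⟨hm.1, hm, hQm, hdm⟩)) (not_le.2 ?_)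
  apply Finset.card_lt_card
  rw [Finset.ssubset_iff_of_subset]
  · exact ⟨e, Finset.mem_filter.2 ⟨he.1, Span.left e y⟩,
      fun h => hne (Span.antisymm he.2.1 hy hm hs (Finset.mem_filter.1 h).2)⟩
  · exact fun n hn => Finset.mem_filter.2 ⟨(Finset.mem_filter.1 hn).1,
      spanClosed_span e y hs (Span.right e y) (Finset.mem_filter.1 hn).2⟩

theorem exists_adj {d y : ι} (hd : IsStair X Y P d) (hy : IsStair X Y P y) (hne : d ≠ y) :
    ∃ e, Adj X Y P e y ∧ Span X Y d y e := by
  obtain ⟨e, he, hey, hs, h⟩ := exists_nearest (Q := (· ≠ y)) hd hne hy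
  exact ⟨e, ⟨hey, he, hy, fun m hm hms => or_iff_not_imp_right.2 fun hmy => h m hm hmy hms⟩, hs⟩

theorem span_of_dominators (hX : X.Injective) {u v s b : ι} (hu : IsStair X Y P u)
    (hv : IsStair X Y P v) (hs : IsStair X Y P s) (hsuv : Span X Y u v s) (hsu : s ≠ u)
    (hsv : s ≠ v) (hb : b ∈ P) (hbu : ¬ Dom X Y b u) (hbv : ¬ Dom X Y b v)
    (h : ∀ e, IsStair X Y P e → Dom X Y b e → e = s ∨ Adj X Y P s e) : Span X Y u v b := by
  obtain ⟨d, hd, hbd⟩ := exists_stair_dom (Y := Y) hX hb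
  have hsd := h d hd hbd
  have hduv : Span X Y u v d := by
    rcases hsd with rfl | hsd
    · exact hsuv
    · have h1 := hsd.2.2.2 u hu
      have h2 := hsd.2.2.2 v hv
      have h3 := hu.eq_or hv
      have h4 := hu.eq_or hs
      have h5 := hv.eq_or hs
      have h6 := hu.eq_or hd
      have h7 := hv.eq_or hd
      unfold Span at *
      grind
  have h3 := hu.eq_or hv
  have h6 := hu.eq_or hd
  have h7 := hv.eq_or hd
  clear h
  unfold Span Dom at *
  grind

end Stair

/-- `i` and `j` get different colors in every coloring of `F`. -/
def Opp (F : Set (ι → Bool)) (i j : ι) : Prop := ∀ f ∈ F, f i ≠ f j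

/-- `i` has color `c` in every coloring of `F`. -/
def Com (F : Set (ι → Bool)) (i : ι) (c : Bool) : Prop := ∀ f ∈ F, f i = c

/-- Every quadrant which contains `b` contains two points of `P` of different colors. -/
def Good (X Y : ι → α) (P : Finset ι) (F : Set (ι → Bool)) (b : ι) : Prop :=
  ∃ i ∈ P, ∃ j ∈ P, Dom X Y b i ∧ Dom X Y b j ∧ Opp F i j

/-- No two points of `P` in the region `R` are known to have different colors. -/
def Mono (P : Finset ι) (F : Set (ι → Bool)) (R : ι → Prop) : Prop :=
  ∀ i ∈ P, ∀ j ∈ P, R i → R j → ¬ Opp F i j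

/-- `x` is the only maximal element dominating some further point of `P` in the region `R`. -/
def Locked (X Y : ι → α) (P : Finset ι) (R : ι → Prop) (x : ι) : Prop :=
  ∃ b ∈ P, b ≠ x ∧ R b ∧ ∀ e, IsStair X Y P e → Dom X Y b e → e = x

/-- The invariant of the coloring algorithm: `S` is the set of maximal elements whose color can
still be chosen freely, `F` is the set of colorings which are still possible. -/
structure Inv (X Y : ι → α) (P : Finset ι) (S : Set ι) (F : Set (ι → Bool)) : Prop where
  isStair : ∀ s ∈ S, IsStair X Y P s
  free : ∀ g : ι → Bool, ∃ f ∈ F, ∀ i, (i ∈ S ∨ i ∉ P) → f i = g i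
  com_of_notMem : ∀ e, IsStair X Y P e → e ∉ S → ∃ c, Com F e c
  good_or_com : ∀ b ∈ P, ¬ IsStair X Y P b →
    Good X Y P F b ∨ ((∃ c, Com F b c) ∧ ∃ s ∈ S, Dom X Y b s)
  not_com_of_adj : ∀ e e' c, Adj X Y P e e' → Com F e c → ¬ Com F e' c
  mem_of_locked : ∀ R, SpanClosed X Y R → Mono P F R → ∀ x y, R x → R y → Adj X Y P x y →
    Locked X Y P R x → y ∈ S

/-- `b` prevents `s` from being committed to the color other than `c`. -/
def Obstructs (X Y : ι → α) (P : Finset ι) (F : Set (ι → Bool)) (s : ι) (c : Bool) (b : ι) :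
    Prop :=
  b ∈ P ∧ Com F b c ∧ ¬ Good X Y P F b ∧
    ∀ e, IsStair X Y P e → Dom X Y b e → e = s ∨ Adj X Y P s e

/-- No free element can be committed without harm. -/
def Saturated (X Y : ι → α) (P : Finset ι) (S : Set ι) (F : Set (ι → Bool)) : Prop :=
  ∀ s ∈ S, ∀ c, ∃ b, Obstructs X Y P F s c b

section Coloring

variable {P : Finset ι} {S : Set ι} {F F' : Set (ι → Bool)} {R : ι → Prop}

theorem Opp.mono {i j : ι} (h : Opp F i j) (hF : F' ⊆ F) : Opp F' i j := fun f hf => h f (hF hf)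

theorem Com.mono {i : ι} {c : Bool} (h : Com F i c) (hF : F' ⊆ F) : Com F' i c :=
  fun f hf => h f (hF hf)

theorem Good.mono {b : ι} (h : Good X Y P F b) (hF : F' ⊆ F) : Good X Y P F' b := by
  obtain ⟨i, hi, j, hj, hbi, hbj, ho⟩ := h
  exact ⟨i, hi, j, hj, hbi, hbj, ho.mono hF⟩

theorem Mono.anti (h : Mono P F' R) (hF : F' ⊆ F) : Mono P F R :=
  fun i hi j hj hRi hRj ho => h i hi j hj hRi hRj (ho.mono hF)

theorem Mono.subset {P' : Finset ι} (h : Mono P' F R) (hP : P ⊆ P') : Mono P F R :=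
  fun i hi j hj => h i (hP hi) j (hP hj)

theorem Com.opp {i j : ι} {c d : Bool} (hi : Com F i c) (hj : Com F j d) (h : c ≠ d) :
    Opp F i j := fun f hf => by rw [hi f hf, hj f hf]; exact h

theorem Com.eq_of_mono {i j : ι} {c d : Bool} (hi : Com F i c) (hj : Com F j d)
    (h : Mono P F R) (hiP : i ∈ P) (hjP : j ∈ P) (hRi : R i) (hRj : R j) : c = d := by
  by_contra hne
  exact h i hiP j hjP hRi hRj (hi.opp hj hne)

theorem Mono.not_good (h : Mono P F R) (hR : SpanClosed X Y R) {b : ι} (hb : R b) :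
    ¬ Good X Y P F b := by
  rintro ⟨i, hi, j, hj, hbi, hbj, ho⟩
  exact h i hi j hj (hR.dom hb hbi) (hR.dom hb hbj) ho

namespace Inv

theorem nonempty (h : Inv X Y P S F) : F.Nonempty := by
  obtain ⟨f, hf, -⟩ := h.free fun _ => true
  exact ⟨f, hf⟩

theorem not_opp_self (h : Inv X Y P S F) (i : ι) : ¬ Opp F i i := by
  obtain ⟨f, hf⟩ := h.nonempty
  exact fun ho => ho f hf rfl

theorem notMem_of_com (h : Inv X Y P S F) {i : ι} {c : Bool} (hc : Com F i c) :
    ¬ (i ∈ S ∨ i ∉ P) := by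
  intro hi
  obtain ⟨f, hf, hfg⟩ := h.free fun _ => !c
  have := (hc f hf).symm.trans (hfg i hi)
  simp at this

theorem not_good_of_isStair (h : Inv X Y P S F) {e : ι} (he : IsStair X Y P e) :
    ¬ Good X Y P F e := by
  rintro ⟨i, hi, j, hj, hbi, hbj, ho⟩
  obtain rfl := he.2 i hi hbi
  obtain rfl := he.2 j hj hbj
  exact h.not_opp_self _ ho

theorem com_and_mem_of_locked (h : Inv X Y P S F) (hR : SpanClosed X Y R)
    (hm : Mono P F R) {x b : ι} (hb : b ∈ P) (hbx : b ≠ x) (hRb : R b)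
    (hd : ∀ e, IsStair X Y P e → Dom X Y b e → e = x) : (∃ c, Com F b c) ∧ x ∈ S := by
  have hnb : ¬ IsStair X Y P b := fun hs => hbx (hd b hs (Dom.refl b))
  obtain hg | ⟨hc, s, hs, hbs⟩ := h.good_or_com b hb hnb
  · exact absurd hg (hm.not_good hR hRb)
  · exact ⟨hc, hd s (h.isStair s hs) hbs ▸ hs⟩

theorem commit (h : Inv X Y P S F) {s : ι} {c : Bool} (hs : s ∈ S)
    (hsat : ∀ b, ¬ Obstructs X Y P F s c b) : Inv X Y P (S \ {s}) {f ∈ F | f s = c} := by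
  have hsub : {f ∈ F | f s = c} ⊆ F := Set.sep_subset _ _
  have hsc : Com {f ∈ F | f s = c} s c := fun f hf => hf.2
  have hfree : ∀ g : ι → Bool, ∃ f ∈ {f ∈ F | f s = c}, ∀ i, (i ∈ S \ {s} ∨ i ∉ P) → f i = g i := by
    classical
    intro g
    obtain ⟨f, hf, hfg⟩ := h.free (Function.update g s c)
    refine ⟨f, ⟨hf, by simpa using hfg s (.inl hs)⟩, fun i hi => ?_⟩
    have his : i ≠ s := by
      rintro rfl
      rcases hi with hi | hi
      · exact hi.2 rfl
      · exact hi (h.isStair i hs).1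
    simpa [his] using hfg i (hi.imp_left fun hi => hi.1)
  have hobs : ∀ e' d, Adj X Y P s e' → Com {f ∈ F | f s = c} s d →
      ¬ Com {f ∈ F | f s = c} e' d := by
    intro e' d hadj hcs hce
    obtain ⟨f, hf, -⟩ := hfree fun _ => true
    obtain rfl : d = c := (hcs f hf).symm.trans hf.2
    have he' : e' ∉ S := by
      intro he'
      obtain ⟨f, hf, hfg⟩ := hfree fun _ => !d
      have := (hce f hf).symm.trans (hfg e' (.inl ⟨he', hadj.1.symm⟩))
      simp at this
    obtain ⟨d', hd'⟩ := h.com_of_notMem e' hadj.2.2.1 he'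
    obtain rfl : d' = d := (hd' f hf.1).symm.trans (hce f hf)
    refine hsat e' ⟨hadj.2.2.1.1, hd', h.not_good_of_isStair hadj.2.2.1, fun e he hd => .inr ?_⟩
    rwa [hadj.2.2.1.2 e he.1 hd]
  refine ⟨fun e he => h.isStair e he.1, hfree, fun e he heS => ?_, fun b hb hnb => ?_,
    fun e e' d hadj hce hce' => ?_, fun R hR hm x y hRx hRy hadj hl => ?_⟩
  · by_cases hes : e = s
    · exact ⟨c, hes ▸ hsc⟩
    · obtain ⟨d, hd⟩ := h.com_of_notMem e he fun h => heS ⟨h, hes⟩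
      exact ⟨d, hd.mono hsub⟩
  · obtain hg | ⟨⟨d, hd⟩, s', hs', hbs'⟩ := h.good_or_com b hb hnb
    · exact .inl (hg.mono hsub)
    by_cases hex : ∃ s' ∈ S, s' ≠ s ∧ Dom X Y b s'
    · obtain ⟨s', hs', hne, hbs'⟩ := hex
      exact .inr ⟨⟨d, hd.mono hsub⟩, s', ⟨hs', hne⟩, hbs'⟩
    have honly : ∀ s' ∈ S, Dom X Y b s' → s' = s := fun s' hs' hbs' => by
      by_contra hne
      exact hex ⟨s', hs', hne, hbs'⟩
    obtain rfl := honly s' hs' hbs'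
    left
    by_cases hdc : d = c
    · by_contra hng
      have hng' : ¬ Good X Y P F b := fun hg => hng (hg.mono hsub)
      subst hdc
      refine hsat b ⟨hb, hd, hng', fun e he hbe => ?_⟩
      by_contra! hcon
      obtain ⟨m, hmadj, hms⟩ := exists_adj (h.isStair s' hs') he hcon.1.symm
      have hbm := dom_of_span hbs' hbe hms
      have hm : m ∉ S := fun hm => hcon.2 (honly m hm hbm ▸ hmadj)
      have heS : e ∉ S := fun he => hcon.1 (honly e he hbe)
      obtain ⟨c1, hc1⟩ := h.com_of_notMem m hmadj.2.1 hm
      obtain ⟨c2, hc2⟩ := h.com_of_notMem e he heS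
      by_cases hcc : c1 = c2
      · exact h.not_com_of_adj m e c1 hmadj hc1 (hcc ▸ hc2)
      · exact hng' ⟨m, hmadj.2.1.1, e, he.1, hbm, hbe, hc1.opp hc2 hcc⟩
    · exact ⟨b, hb, s', (h.isStair s' hs').1, Dom.refl b, hbs', (hd.mono hsub).opp hsc hdc⟩
  · by_cases hes : e = s
    · subst hes
      exact hobs e' d hadj hce hce'
    by_cases hes' : e' = s
    · subst hes'
      exact hobs e d hadj.symm hce' hce
    have key : ∀ a, IsStair X Y P a → a ≠ s → Com {f ∈ F | f s = c} a d → Com F a d := by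
      intro a ha has hca
      have haS : a ∉ S := by
        intro haS
        obtain ⟨f, hf, hfg⟩ := hfree fun _ => !d
        have := (hca f hf).symm.trans (hfg a (.inl ⟨haS, has⟩))
        simp at this
      obtain ⟨d', hd'⟩ := h.com_of_notMem a ha haS
      obtain ⟨f, hf, -⟩ := hfree fun _ => true
      obtain rfl : d' = d := (hd' f hf.1).symm.trans (hca f hf)
      exact hd'
    exact h.not_com_of_adj e e' d hadj (key e hadj.2.1 hes hce) (key e' hadj.2.2.1 hes' hce')
  · refine ⟨h.mem_of_locked R hR (hm.anti hsub) x y hRx hRy hadj hl, ?_⟩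
    rintro rfl
    obtain ⟨b, hb, hbx, hRb, hdom⟩ := hl
    have hnb : ¬ IsStair X Y P b := fun hs => hbx (hdom b hs (Dom.refl b))
    obtain hg | ⟨⟨d, hd⟩, -⟩ := h.good_or_com b hb hnb
    · exact (hm.anti hsub).not_good hR hRb hg
    by_cases hdc : d = c
    · subst hdc
      exact hsat b ⟨hb, hd, (hm.anti hsub).not_good hR hRb,
        fun e he hbe => .inr (hdom e he hbe ▸ hadj.symm)⟩
    · exact hm b hb y (h.isStair y hs).1 hRb hRy ((hd.mono hsub).opp hsc hdc)

theorem exists_saturated (h : Inv X Y P S F) :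
    ∃ S' F', F' ⊆ F ∧ Inv X Y P S' F' ∧ Saturated X Y P S' F' := by
  induction hn : S.ncard using Nat.strong_induction_on generalizing S F with
  | _ n ih =>
    by_cases hsat : Saturated X Y P S F
    · exact ⟨S, F, subset_rfl, h, hsat⟩
    · unfold Saturated at hsat
      push Not at hsat
      obtain ⟨s, hs, c, hc⟩ := hsat
      have hfin : S.Finite := P.finite_toSet.subset fun s hs => (h.isStair s hs).1
      obtain ⟨S', F', hF, hI, hS⟩ :=
        ih _ (hn ▸ Set.ncard_sdiff_singleton_lt_of_mem hs hfin) (h.commit hs hc) rfl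
      exact ⟨S', F', hF.trans (Set.sep_subset _ _), hI, hS⟩

end Inv
end Coloring

section Insert

variable {P : Finset ι} {S : Set ι} {F F' : Set (ι → Bool)} {R : ι → Prop} {p : ι}

theorem Inv.com_of_com (h : Inv X Y P S F) (hF : F' ⊆ F) (hne : F'.Nonempty) {e : ι} {c : Bool}
    (he : IsStair X Y P e) (heS : e ∉ S) (hc : Com F' e c) : Com F e c := by
  obtain ⟨d, hd⟩ := h.com_of_notMem e he heS
  obtain ⟨f, hf⟩ := hne
  obtain rfl : d = c := (hd f (hF hf)).symm.trans (hc f hf)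
  exact hd

variable [DecidableEq ι]

theorem isStair_insert_of_dom (hX : X.Injective) (hp : p ∉ P) {s : ι} (hs : IsStair X Y P s)
    (hps : Dom X Y p s) {e : ι} : IsStair X Y (insert p P) e ↔ IsStair X Y P e := by
  constructor
  · rintro ⟨he, hmax⟩
    rcases Finset.mem_insert.1 he with rfl | he
    · exact absurd (hmax s (Finset.mem_insert_of_mem hs.1) hps ▸ hs.1) hp
    · exact ⟨he, fun j hj => hmax j (Finset.mem_insert_of_mem hj)⟩
  · rintro ⟨he, hmax⟩
    refine ⟨Finset.mem_insert_of_mem he, fun j hj hd => ?_⟩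
    rcases Finset.mem_insert.1 hj with rfl | hj
    · obtain rfl := hmax s hs.1 (hd.trans hps)
      exact hX (le_antisymm hps.1 hd.1)
    · exact hmax j hj hd

theorem isStair_insert_of_not_dom (hX : X.Injective) (hp : p ∉ P)
    (hn : ∀ s, IsStair X Y P s → ¬ Dom X Y p s) {e : ι} :
    IsStair X Y (insert p P) e ↔ e = p ∨ (IsStair X Y P e ∧ ¬ Dom X Y e p) := by
  constructor
  · rintro ⟨he, hmax⟩
    rcases Finset.mem_insert.1 he with rfl | he
    · exact .inl rfl
    · refine .inr ⟨⟨he, fun j hj => hmax j (Finset.mem_insert_of_mem hj)⟩, fun hd => hp ?_⟩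
      rwa [hmax p (Finset.mem_insert_self p P) hd]
  · rintro (rfl | ⟨⟨he, hmax⟩, hd⟩)
    · refine ⟨Finset.mem_insert_self e P, fun j hj hd => ?_⟩
      rcases Finset.mem_insert.1 hj with rfl | hj
      · rfl
      · obtain ⟨s, hs, hjs⟩ := exists_stair_dom (Y := Y) hX hj
        exact absurd (hd.trans hjs) (hn s hs)
    · refine ⟨Finset.mem_insert_of_mem he, fun j hj hdj => ?_⟩
      rcases Finset.mem_insert.1 hj with rfl | hj
      · exact absurd hdj hd
      · exact hmax j hj hdj

theorem isStair_insert_iff_of_notMem (hX : X.Injective) (hR : SpanClosed X Y R) (hp : p ∉ P)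
    (hRp : ¬ R p) {e : ι} (hRe : R e) : IsStair X Y (insert p P) e ↔ IsStair X Y P e := by
  by_cases hs : ∃ s, IsStair X Y P s ∧ Dom X Y p s
  · obtain ⟨s, hs, hps⟩ := hs
    exact isStair_insert_of_dom hX hp hs hps
  · push Not at hs
    rw [isStair_insert_of_not_dom hX hp hs]
    constructor
    · rintro (rfl | h)
      · exact absurd hRe hRp
      · exact h.1
    · exact fun h => .inr ⟨h, fun hd => hRp (hR.dom hRe hd)⟩

theorem locked_insert_iff_of_notMem (hX : X.Injective) (hR : SpanClosed X Y R) (hp : p ∉ P)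
    (hRp : ¬ R p) {x : ι} : Locked X Y (insert p P) R x ↔ Locked X Y P R x := by
  constructor
  · rintro ⟨b, hb, hbx, hRb, hd⟩
    rcases Finset.mem_insert.1 hb with rfl | hb
    · exact absurd hRb hRp
    · exact ⟨b, hb, hbx, hRb, fun e he hbe =>
        hd e ((isStair_insert_iff_of_notMem hX hR hp hRp (hR.dom hRb hbe)).2 he) hbe⟩
  · rintro ⟨b, hb, hbx, hRb, hd⟩
    exact ⟨b, Finset.mem_insert_of_mem hb, hbx, hRb, fun e he hbe =>
      hd e ((isStair_insert_iff_of_notMem hX hR hp hRp (hR.dom hRb hbe)).1 he) hbe⟩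

theorem Good.insert {b : ι} (h : Good X Y P F b) : Good X Y (insert p P) F b := by
  obtain ⟨i, hi, j, hj, hh⟩ := h
  exact ⟨i, Finset.mem_insert_of_mem hi, j, Finset.mem_insert_of_mem hj, hh⟩

theorem Adj.of_insert (hX : X.Injective) (hp : p ∉ P)
    (hn : ∀ s, IsStair X Y P s → ¬ Dom X Y p s) {e e' : ι} (hep : e ≠ p) (hep' : e' ≠ p)
    (h : Adj X Y (insert p P) e e') : Adj X Y P e e' := by
  have hst := fun e => isStair_insert_of_not_dom hX hp hn (e := e)
  have he := ((hst e).1 h.2.1).resolve_left hep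
  have he' := ((hst e').1 h.2.2.1).resolve_left hep'
  refine ⟨h.1, he.1, he'.1, fun m hm hs => ?_⟩
  by_cases hd : Dom X Y m p
  · exact ((h.2.2.2 p ((hst p).2 (.inl rfl)) (hs.dom hd)).elim (absurd · hep.symm)
      (absurd · hep'.symm))
  · exact h.2.2.2 m ((hst m).2 (.inr ⟨hm, hd⟩)) hs

theorem Locked.of_insert (hX : X.Injective) (hp : p ∉ P)
    (hn : ∀ s, IsStair X Y P s → ¬ Dom X Y p s) {x : ι} (hxp : x ≠ p)
    (h : Locked X Y (insert p P) R x) : Locked X Y P R x := by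
  have hst := fun e => isStair_insert_of_not_dom hX hp hn (e := e)
  obtain ⟨b, hb, hbx, hRb, hd⟩ := h
  have hbp : ¬ Dom X Y b p := fun h => hxp (hd p ((hst p).2 (.inl rfl)) h).symm
  rcases Finset.mem_insert.1 hb with rfl | hb
  · exact absurd (Dom.refl b) hbp
  · exact ⟨b, hb, hbx, hRb, fun e he hbe =>
      hd e ((hst e).2 (.inr ⟨he, fun h => hbp (hbe.trans h)⟩)) hbe⟩

namespace Inv

theorem insert_of_dom (h : Inv X Y P S F) (hX : X.Injective) (hp : p ∉ P) {s : ι}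
    (hs : IsStair X Y P s) (hps : Dom X Y p s) :
    Inv X Y (insert p P) S {f ∈ F | f p ≠ f s} := by
  have hsub : {f ∈ F | f p ≠ f s} ⊆ F := Set.sep_subset _ _
  have hst := fun e => isStair_insert_of_dom hX hp hs hps (e := e)
  have hopp : Opp {f ∈ F | f p ≠ f s} p s := fun f hf => hf.2
  have hfree : ∀ g : ι → Bool, ∃ f ∈ {f ∈ F | f p ≠ f s}, ∀ i, (i ∈ S ∨ i ∉ insert p P) →
      f i = g i := by
    intro g
    have hsp : s ≠ p := fun h => hp (h ▸ hs.1)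
    have main : ∃ f ∈ F, f p ≠ f s ∧ ∀ i, i ≠ p → (i ∈ S ∨ i ∉ P) → f i = g i := by
      by_cases hsS : s ∈ S
      · obtain ⟨f, hf, hfg⟩ := h.free (Function.update g p !(g s))
        refine ⟨f, hf, ?_, fun i hip hi => ?_⟩
        · rw [hfg p (.inr hp), hfg s (.inl hsS)]
          simp [hsp]
        · rw [hfg i hi, Function.update_of_ne hip]
      · obtain ⟨c, hc⟩ := h.com_of_notMem s hs hsS
        obtain ⟨f, hf, hfg⟩ := h.free (Function.update g p !c)
        refine ⟨f, hf, ?_, fun i hip hi => ?_⟩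
        · rw [hfg p (.inr hp), hc f hf]
          simp
        · rw [hfg i hi, Function.update_of_ne hip]
    obtain ⟨f, hf, hne, hfg⟩ := main
    refine ⟨f, ⟨hf, hne⟩, fun i hi => ?_⟩
    rcases hi with hi | hi
    · exact hfg i (fun hip => hp (hip ▸ (h.isStair i hi).1)) (.inl hi)
    · rw [Finset.mem_insert, not_or] at hi
      exact hfg i hi.1 (.inr hi.2)
  have hne : {f ∈ F | f p ≠ f s}.Nonempty := by
    obtain ⟨f, hf, -⟩ := hfree fun _ => true
    exact ⟨f, hf⟩
  have hadj : ∀ {e e'}, Adj X Y (insert p P) e e' → Adj X Y P e e' := by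
    intro e e' hadj
    simpa only [Adj, hst] using hadj
  have hnS : ∀ e c, Com {f ∈ F | f p ≠ f s} e c → e ∉ S := by
    intro e c hc he
    obtain ⟨f, hf, hfg⟩ := hfree fun _ => !c
    have := (hc f hf).symm.trans (hfg e (.inl he))
    simp at this
  refine ⟨fun e he => (hst e).2 (h.isStair e he), hfree, fun e he heS => ?_,
    fun b hb hnb => ?_, fun e e' d ha hce hce' => ?_, fun R hR hm x y hRx hRy ha hl => ?_⟩
  · obtain ⟨c, hc⟩ := h.com_of_notMem e ((hst e).1 he) heS
    exact ⟨c, hc.mono hsub⟩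
  · rcases Finset.mem_insert.1 hb with rfl | hb
    · exact .inl ⟨b, Finset.mem_insert_self _ _, s, Finset.mem_insert_of_mem hs.1,
        Dom.refl b, hps, hopp⟩
    · obtain hg | ⟨⟨d, hd⟩, hs'⟩ := h.good_or_com b hb fun hb => hnb ((hst b).2 hb)
      · exact .inl (hg.mono hsub).insert
      · exact .inr ⟨⟨d, hd.mono hsub⟩, hs'⟩
  · have ha' := hadj ha
    exact h.not_com_of_adj e e' d ha' (h.com_of_com hsub hne ha'.2.1 (hnS e d hce) hce)
      (h.com_of_com hsub hne ha'.2.2.1 (hnS e' d hce') hce')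
  · have hRp : ¬ R p := fun hRp => hm p (Finset.mem_insert_self _ _) s
      (Finset.mem_insert_of_mem hs.1) hRp (hR.dom hRp hps) hopp
    exact h.mem_of_locked R hR ((hm.anti hsub).subset (Finset.subset_insert _ _)) x y hRx hRy
      (hadj ha) ((locked_insert_iff_of_notMem hX hR hp hRp).1 hl)

/-- A new maximal element gets the color opposite to the free elements it dominates. -/
theorem insert_of_not_dom (h : Inv X Y P S F) (hX : X.Injective) (hp : p ∉ P)
    (hn : ∀ s, IsStair X Y P s → ¬ Dom X Y p s) :
    Inv X Y (insert p P) (insert p {q ∈ S | ¬ Dom X Y q p})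
      {f ∈ F | ∀ q ∈ S, Dom X Y q p → f q ≠ f p} := by
  set F' := {f ∈ F | ∀ q ∈ S, Dom X Y q p → f q ≠ f p}
  set S' := insert p {q ∈ S | ¬ Dom X Y q p}
  have hsub : F' ⊆ F := Set.sep_subset _ _
  have hst := fun e => isStair_insert_of_not_dom hX hp hn (e := e)
  have hopp : ∀ q ∈ S, Dom X Y q p → Opp F' q p := fun q hq hd f hf => hf.2 q hq hd
  have hpS : p ∉ S := fun hpS => hp (h.isStair p hpS).1
  have hpS' : p ∈ S' := .inl rfl
  have hfree : ∀ g : ι → Bool, ∃ f ∈ F', ∀ i, (i ∈ S' ∨ i ∉ insert p P) → f i = g i := by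
    classical
    intro g
    obtain ⟨f, hf, hfg⟩ := h.free fun i => if i ∈ S ∧ Dom X Y i p then !(g p) else g i
    have hfp : f p = g p := by
      rw [hfg p (.inr hp)]
      simp [hpS]
    refine ⟨f, ⟨hf, fun q hq hd => ?_⟩, fun i hi => ?_⟩
    · rw [hfg q (.inl hq), hfp]
      simp [hq, hd]
    · rcases hi with (rfl | hi) | hi
      · exact hfp
      · rw [hfg i (.inl hi.1)]
        simp [hi.2]
      · rw [Finset.mem_insert, not_or] at hi
        rw [hfg i (.inr hi.2), if_neg fun hiS => hi.2 (h.isStair i hiS.1).1]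
  have hne : F'.Nonempty := by
    obtain ⟨f, hf, -⟩ := hfree fun _ => true
    exact ⟨f, hf⟩
  have hnS : ∀ e c, Com F' e c → e ∉ S' := by
    intro e c hc he
    obtain ⟨f, hf, hfg⟩ := hfree fun _ => !c
    have := (hc f hf).symm.trans (hfg e (.inl he))
    simp at this
  refine ⟨?_, hfree, fun e he heS => ?_,
    fun b hb hnb => ?_, fun e e' d ha hce hce' => ?_, fun R hR hm x y hRx hRy ha hl => ?_⟩
  · rintro e (rfl | he)
    · exact (hst e).2 (.inl rfl)
    · exact (hst e).2 (.inr ⟨h.isStair e he.1, he.2⟩)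
  · rcases (hst e).1 he with rfl | he
    · exact absurd hpS' heS
    · obtain ⟨c, hc⟩ := h.com_of_notMem e he.1 fun heS' => heS (.inr ⟨heS', he.2⟩)
      exact ⟨c, hc.mono hsub⟩
  · rcases Finset.mem_insert.1 hb with rfl | hb
    · exact absurd ((hst b).2 (.inl rfl)) hnb
    by_cases hbs : IsStair X Y P b
    · have hbp : Dom X Y b p := by
        by_contra hbp
        exact hnb ((hst b).2 (.inr ⟨hbs, hbp⟩))
      by_cases hbS : b ∈ S
      · exact .inl ⟨b, Finset.mem_insert_of_mem hb, p, Finset.mem_insert_self _ _,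
          Dom.refl b, hbp, hopp b hbS hbp⟩
      · obtain ⟨c, hc⟩ := h.com_of_notMem b hbs hbS
        exact .inr ⟨⟨c, hc.mono hsub⟩, p, hpS', hbp⟩
    · obtain hg | ⟨⟨d, hd⟩, s, hs, hbs⟩ := h.good_or_com b hb hbs
      · exact .inl (hg.mono hsub).insert
      · refine .inr ⟨⟨d, hd.mono hsub⟩, ?_⟩
        by_cases hsp : Dom X Y s p
        · exact ⟨p, hpS', hbs.trans hsp⟩
        · exact ⟨s, .inr ⟨hs, hsp⟩, hbs⟩
  · have hep : e ≠ p := fun hep => hnS e d hce (hep ▸ hpS')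
    have hep' : e' ≠ p := fun hep => hnS e' d hce' (hep ▸ hpS')
    have hc : ∀ a, a ≠ p → IsStair X Y (insert p P) a → Com F' a d → Com F a d := by
      intro a hap ha hca
      have ha' := ((hst a).1 ha).resolve_left hap
      exact h.com_of_com hsub hne ha'.1 (fun haS => hnS a d hca (.inr ⟨haS, ha'.2⟩)) hca
    exact h.not_com_of_adj e e' d (ha.of_insert hX hp hn hep hep') (hc e hep ha.2.1 hce)
      (hc e' hep' ha.2.2.1 hce')
  · have hmF : Mono P F R := (hm.anti hsub).subset (Finset.subset_insert _ _)
    by_cases hyp : y = p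
    · exact hyp ▸ hpS'
    have hy := ((hst y).1 ha.2.2.1).resolve_left hyp
    by_cases hxp : x = p
    · subst hxp
      obtain ⟨b, hb, hbx, hRb, hd⟩ := hl
      have hb := (Finset.mem_insert.1 hb).resolve_left hbx
      obtain ⟨d, hds, hbd⟩ := exists_stair_dom (Y := Y) hX hb
      have hdx : Dom X Y d x := by
        by_contra hdx
        obtain rfl := hd d ((hst d).2 (.inr ⟨hds, hdx⟩)) hbd
        exact hp hds.1
      by_contra hyS
      obtain ⟨c, hc⟩ := h.com_of_notMem y hy.1 fun hyS' => hyS (.inr ⟨hyS', hy.2⟩)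
      obtain ⟨e, he, hex, hes, hmin⟩ := exists_nearest (Q := (Dom X Y · x)) hds hdx hy.1
      have hRe : R e := hR (hR.dom hRb hbd) hRy hes
      have heS : e ∉ S := fun heS => hm e (Finset.mem_insert_of_mem he.1) x
        (Finset.mem_insert_self _ _) hRe hRx (hopp e heS hex)
      obtain ⟨c', hc'⟩ := h.com_of_notMem e he heS
      obtain rfl := hc'.eq_of_mono hc hmF he.1 hy.1.1 hRe hRy
      refine h.not_com_of_adj e y c' ⟨?_, he, hy.1, fun m hms hmsp => ?_⟩ hc' hc
      · rintro rfl
        exact hy.2 hex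
      · by_cases hmx : Dom X Y m x
        · exact .inl (hmin m hms hmx hmsp)
        · have := hmsp.symm.of_covered hy.1 he hms hmx hex
          exact .inr ((ha.2.2.2 m ((hst m).2 (.inr ⟨hms, hmx⟩)) this.symm).resolve_left
            fun hmx => hp (hmx ▸ hms.1))
    · exact .inr ⟨h.mem_of_locked R hR hmF x y hRx hRy (ha.of_insert hX hp hn hxp hyp)
        (hl.of_insert hX hp hn hxp), hy.2⟩

theorem exists_insert (h : Inv X Y P S F) (hX : X.Injective) (hp : p ∉ P) :
    ∃ S' F', F' ⊆ F ∧ Inv X Y (insert p P) S' F' ∧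
      (∀ s, IsStair X Y P s → Dom X Y p s → ∃ i, IsStair X Y P i ∧ Dom X Y p i ∧ Opp F' p i) ∧
      ((∀ s, IsStair X Y P s → ¬ Dom X Y p s) → ∀ q ∈ S, Dom X Y q p → Opp F' q p) := by
  by_cases hs : ∃ s, IsStair X Y P s ∧ Dom X Y p s
  · obtain ⟨s, hs, hps⟩ := hs
    exact ⟨_, _, Set.sep_subset _ _, h.insert_of_dom hX hp hs hps,
      fun _ _ _ => ⟨s, hs, hps, fun f hf => hf.2⟩, fun hn => absurd hps (hn s hs)⟩
  · push Not at hs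
    exact ⟨_, _, Set.sep_subset _ _, h.insert_of_not_dom hX hp hs,
      fun s hs' hps => absurd hps (hs s hs'), fun _ q hq hd f hf => hf.2 q hq hd⟩

end Inv
end Insert

section Counting

variable {P : Finset ι} {S : Set ι} {F F' : Set (ι → Bool)} {R : ι → Prop} {p : ι}

theorem IsStair.span_of_le {a b m : ι} (hb : IsStair X Y P b) (hm : IsStair X Y P m)
    (ham : X a ≤ X m) (hmb : X m ≤ X b) : Span X Y a b m := by
  have := hb.eq_or hm
  unfold Span
  grind

theorem Saturated.notMem_of_span (hsat : Saturated X Y P S F) (hX : X.Injective)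
    (hR : SpanClosed X Y R) (hm : Mono P F R) {s u u' v v' : ι} (hs : IsStair X Y P s)
    (hu : IsStair X Y P u) (hu' : IsStair X Y P u') (hv : IsStair X Y P v)
    (hv' : IsStair X Y P v') (hRu : R u) (hRv : R v) (hsuv : Span X Y u v s)
    (hsu' : Span X Y s u u') (hsv' : Span X Y s v v') (hsu : s ≠ u) (hsv : s ≠ v) (hu's : u' ≠ s)
    (hu'u : u' ≠ u) (hv's : v' ≠ s) (hv'v : v' ≠ v) : s ∉ S := by
  intro hsS
  have key : ∀ c, ∃ b ∈ P, R b ∧ Com F b c := by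
    intro c
    obtain ⟨b, hb, hbc, -, hd⟩ := hsat s hsS c
    have hbu : ¬ Dom X Y b u := fun hbu => (hd u hu hbu).elim (hsu ·.symm) fun ha =>
      (ha.2.2.2 u' hu' hsu').elim hu's hu'u
    have hbv : ¬ Dom X Y b v := fun hbv => (hd v hv hbv).elim (hsv ·.symm) fun ha =>
      (ha.2.2.2 v' hv' hsv').elim hv's hv'v
    exact ⟨b, hb, hR hRu hRv (span_of_dominators hX hu hv hs hsuv hsu hsv hb hbu hbv hd), hbc⟩
  obtain ⟨b, hb, hRb, hbc⟩ := key true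
  obtain ⟨b', hb', hRb', hbc'⟩ := key false
  simpa using hbc.eq_of_mono hbc' hm hb hb' hRb hRb'

namespace Inv

theorem not_com_of_span (h : Inv X Y P S F) (hsat : Saturated X Y P S F) (hX : X.Injective)
    (hR : SpanClosed X Y R) (hm : Mono P F R) {s u v v' : ι} {c : Bool}
    (ha : Adj X Y P u s) (hv : IsStair X Y P v) (hv' : IsStair X Y P v') (hRu : R u) (hRs : R s)
    (hRv : R v) (hsuv : Span X Y u v s) (hsv' : Span X Y s v v') (hsv : s ≠ v) (hv's : v' ≠ s)
    (hv'v : v' ≠ v) : ¬ Com F u c := by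
  intro hu
  have hsS : s ∈ S := by
    by_contra hsS
    obtain ⟨d, hd⟩ := h.com_of_notMem s ha.2.2.1 hsS
    obtain rfl := hu.eq_of_mono hd hm ha.2.1.1 ha.2.2.1.1 hRu hRs
    exact h.not_com_of_adj u s c ha hu hd
  obtain ⟨b, hb, hbc, hg, hd⟩ := hsat s hsS !c
  have hopp : Opp F b u := hbc.opp hu (by simp)
  have hbu : ¬ Dom X Y b u := fun hbu =>
    hg ⟨b, hb, u, ha.2.1.1, Dom.refl b, hbu, hopp⟩
  have hbv : ¬ Dom X Y b v := fun hbv => (hd v hv hbv).elim (hsv ·.symm) fun ha =>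
    (ha.2.2.2 v' hv' hsv').elim hv's hv'v
  exact hm b hb u ha.2.1.1 (hR hRu hRv (span_of_dominators hX ha.2.1 hv ha.2.2.1 hsuv
    ha.1.symm hsv hb hbu hbv hd)) hRu hopp

end Inv

/-- `x 0, …, x (k - 1)` are the elements of `A`, ordered by `X`. -/
def Enum (X : ι → α) (A : Finset ι) (k : ℕ) (x : ℕ → ι) : Prop :=
  (∀ a, a ∈ A ↔ ∃ i < k, x i = a) ∧ ∀ i j, i < j → j < k → X (x i) < X (x j)

theorem exists_enum [Nonempty ι] (hX : X.Injective) (A : Finset ι) :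
    ∃ x, Enum X A A.card x := by
  classical
  induction A using Finset.induction_on_max_value X with
  | empty => exact ⟨fun _ => Classical.arbitrary ι, by simp, by simp⟩
  | insert a A ha hmax ih =>
    obtain ⟨x, hx, hlt⟩ := ih
    rw [Finset.card_insert_of_notMem ha]
    have hval : ∀ i < A.card, Function.update x A.card a i = x i := fun i hi =>
      Function.update_of_ne hi.ne _ _
    refine ⟨Function.update x A.card a, fun b => ?_, fun i j hij hj => ?_⟩
    · rw [Finset.mem_insert, hx b]
      constructor
      · rintro (rfl | ⟨i, hi, rfl⟩)
        · exact ⟨A.card, by omega, by simp⟩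
        · exact ⟨i, by omega, hval i hi⟩
      · rintro ⟨i, hi, rfl⟩
        rcases Nat.lt_succ_iff_lt_or_eq.1 hi with hi | rfl
        · exact .inr ⟨i, hi, (hval i hi).symm⟩
        · simp
    · rcases Nat.lt_succ_iff_lt_or_eq.1 hj with hj | rfl
      · rw [hval i (by omega), hval j hj]
        exact hlt i j hij hj
      · rw [hval i hij, Function.update_self]
        have hi : x i ∈ A := (hx _).2 ⟨i, hij, rfl⟩
        exact lt_of_le_of_ne (hmax _ hi) fun he => ha (hX he ▸ hi)

open Classical in
/-- The points of `P` in the region `R`. -/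
noncomputable def ptsIn (P : Finset ι) (R : ι → Prop) : Finset ι := P.filter R

open Classical in
/-- The maximal elements of `P` in the region `R`. -/
noncomputable def maxIn (X Y : ι → α) (P : Finset ι) (R : ι → Prop) : Finset ι :=
  P.filter fun e => IsStair X Y P e ∧ R e

open Classical in
/-- The locked maximal elements of `P` in the region `R`. -/
noncomputable def lockedIn (X Y : ι → α) (P : Finset ι) (R : ι → Prop) : Finset ι :=
  (maxIn X Y P R).filter (Locked X Y P R)

theorem mem_ptsIn {b : ι} : b ∈ ptsIn P R ↔ b ∈ P ∧ R b := by simp [ptsIn]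

theorem mem_maxIn {e : ι} : e ∈ maxIn X Y P R ↔ IsStair X Y P e ∧ R e := by
  simp only [maxIn, Finset.mem_filter, and_iff_right_iff_imp]
  exact fun h => h.1.1

theorem mem_lockedIn {e : ι} :
    e ∈ lockedIn X Y P R ↔ (IsStair X Y P e ∧ R e) ∧ Locked X Y P R e := by
  simp [lockedIn, mem_maxIn]

section Enum

variable {k : ℕ} {x : ℕ → ι}

theorem Enum.isStair (hx : Enum X (maxIn X Y P R) k x) {i : ℕ} (hi : i < k) :
    IsStair X Y P (x i) :=
  (mem_maxIn.1 ((hx.1 _).2 ⟨i, hi, rfl⟩)).1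

theorem Enum.mem (hx : Enum X (maxIn X Y P R) k x) {i : ℕ} (hi : i < k) : R (x i) :=
  (mem_maxIn.1 ((hx.1 _).2 ⟨i, hi, rfl⟩)).2

theorem Enum.ne {A : Finset ι} (hx : Enum X A k x) {i j : ℕ} (hi : i < k) (hj : j < k)
    (hij : i ≠ j) : x i ≠ x j := by
  intro h
  rcases hij.lt_or_gt with hlt | hlt
  · exact (hx.2 i j hlt hj).ne (congrArg X h)
  · exact (hx.2 j i hlt hi).ne' (congrArg X h)

theorem Enum.le {A : Finset ι} (hx : Enum X A k x) {i j : ℕ} (hij : i ≤ j) (hj : j < k) :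
    X (x i) ≤ X (x j) := by
  rcases hij.eq_or_lt with rfl | hlt
  · exact le_rfl
  · exact (hx.2 i j hlt hj).le

theorem Enum.span (hx : Enum X (maxIn X Y P R) k x) {i j l : ℕ} (hil : i ≤ l) (hlj : l ≤ j)
    (hj : j < k) : Span X Y (x i) (x j) (x l) :=
  (hx.isStair hj).span_of_le (hx.isStair (hlj.trans_lt hj)) (hx.le hil (hlj.trans_lt hj))
    (hx.le hlj hj)

theorem Enum.adj (hx : Enum X (maxIn X Y P R) k x) (hR : SpanClosed X Y R) {i : ℕ}
    (hi : i + 1 < k) : Adj X Y P (x i) (x (i + 1)) := by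
  have hi' : i < k := by omega
  refine ⟨hx.ne hi' hi (by omega), hx.isStair hi', hx.isStair hi, fun m hm hs => ?_⟩
  obtain ⟨j, hj, rfl⟩ := (hx.1 m).1 (mem_maxIn.2 ⟨hm, hR (hx.mem hi') (hx.mem hi) hs⟩)
  by_cases hji : j < i
  · have h1 := hx.2 j i hji hi'
    have h2 := hx.2 j (i + 1) (by omega) hi
    exact (hs.1.elim h1.not_ge h2.not_ge).elim
  by_cases hij : i + 1 < j
  · have h1 := (hx.isStair hi').lt_of_lt hm (hx.2 i j (by omega) hj)
    have h2 := (hx.isStair hi).lt_of_lt hm (hx.2 (i + 1) j hij hj)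
    exact (hs.2.elim h1.not_ge h2.not_ge).elim
  obtain rfl | rfl : j = i ∨ j = i + 1 := by omega
  · exact .inl rfl
  · exact .inr rfl

theorem Saturated.notMem_of_enum (hsat : Saturated X Y P S F) (hX : X.Injective)
    (hR : SpanClosed X Y R) (hm : Mono P F R) (hx : Enum X (maxIn X Y P R) k x) {i : ℕ}
    (hi : 2 ≤ i) (hik : i + 2 < k) : x i ∉ S := by
  obtain ⟨j, rfl⟩ := Nat.exists_eq_add_of_le' hi
  have hk : j + 4 < k := hik
  refine hsat.notMem_of_span hX hR hm (s := x (j + 2)) (u := x j) (u' := x (j + 1))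
    (v := x (j + 4)) (v' := x (j + 3)) (hx.isStair ?_) (hx.isStair ?_) (hx.isStair ?_)
    (hx.isStair ?_) (hx.isStair ?_) (hx.mem ?_) (hx.mem ?_) (hx.span ?_ ?_ ?_)
    (hx.span ?_ ?_ ?_).symm (hx.span ?_ ?_ ?_) (hx.ne ?_ ?_ ?_) (hx.ne ?_ ?_ ?_) (hx.ne ?_ ?_ ?_)
    (hx.ne ?_ ?_ ?_) (hx.ne ?_ ?_ ?_) (hx.ne ?_ ?_ ?_) <;> omega

namespace Inv

theorem not_com_of_enum (h : Inv X Y P S F) (hsat : Saturated X Y P S F) (hX : X.Injective)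
    (hR : SpanClosed X Y R) (hm : Mono P F R) (hx : Enum X (maxIn X Y P R) k x) {i : ℕ}
    (hi : i < k) (hi' : i + 3 < k ∨ 3 ≤ i) {c : Bool} : ¬ Com F (x i) c := by
  rcases hi' with hik | hi3
  · refine h.not_com_of_span hsat hX hR hm (hx.adj hR (i := i) ?_) (v := x (i + 3))
      (v' := x (i + 2)) (hx.isStair ?_) (hx.isStair ?_) (hx.mem ?_) (hx.mem ?_) (hx.mem ?_)
      (hx.span ?_ ?_ ?_) (hx.span ?_ ?_ ?_) (hx.ne ?_ ?_ ?_) (hx.ne ?_ ?_ ?_)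
      (hx.ne ?_ ?_ ?_) <;> omega
  · obtain ⟨j, rfl⟩ := Nat.exists_eq_add_of_le' hi3
    refine h.not_com_of_span hsat hX hR hm (hx.adj hR (i := j + 2) ?_).symm (v := x j)
      (v' := x (j + 1)) (hx.isStair ?_) (hx.isStair ?_) (hx.mem ?_) (hx.mem ?_) (hx.mem ?_)
      (hx.span ?_ ?_ ?_).symm (hx.span ?_ ?_ ?_).symm (hx.ne ?_ ?_ ?_) (hx.ne ?_ ?_ ?_)
      (hx.ne ?_ ?_ ?_) <;> omega

theorem card_maxIn_le (h : Inv X Y P S F) (hsat : Saturated X Y P S F) (hX : X.Injective)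
    (hR : SpanClosed X Y R) (hm : Mono P F R) : (maxIn X Y P R).card ≤ 5 := by
  by_contra! hk
  have : Nonempty ι := ⟨(Finset.card_pos.1 (by omega : 0 < (maxIn X Y P R).card)).choose⟩
  obtain ⟨x, hx⟩ := exists_enum hX (maxIn X Y P R)
  have h2 := hsat.notMem_of_enum hX hR hm hx (i := 2) (by omega) (by omega)
  obtain ⟨c, hc⟩ := h.com_of_notMem _ (hx.isStair (by omega)) h2
  exact h.not_com_of_enum hsat hX hR hm hx (by omega) (by omega) hc

/-- Locked elements are neither committed nor next to committed ones. -/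
theorem card_lockedIn_le (h : Inv X Y P S F) (hsat : Saturated X Y P S F) (hX : X.Injective)
    (hR : SpanClosed X Y R) (hm : Mono P F R) {e : ι} {c : Bool} (he : e ∈ maxIn X Y P R)
    (hc : Com F e c) : (lockedIn X Y P R).card + 1 ≤ (maxIn X Y P R).card ∧
      (2 ≤ (maxIn X Y P R).card → (lockedIn X Y P R).card + 2 ≤ (maxIn X Y P R).card) ∧
      (4 ≤ (maxIn X Y P R).card → (lockedIn X Y P R).card + 3 ≤ (maxIn X Y P R).card) := by
  classical
  have : Nonempty ι := ⟨e⟩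
  obtain ⟨x, hx⟩ := exists_enum hX (maxIn X Y P R)
  obtain ⟨i, hi, rfl⟩ := (hx.1 e).1 he
  have heS : x i ∉ S := fun heS => h.notMem_of_com hc (.inl heS)
  have he' : x i ∉ lockedIn X Y P R := by
    intro hl
    obtain ⟨b, hb, hbx, hRb, hd⟩ := (mem_lockedIn.1 hl).2
    exact heS (h.com_and_mem_of_locked hR hm hb hbx hRb hd).2
  have hadj : ∀ n, R n → Adj X Y P n (x i) → n ∉ lockedIn X Y P R := by
    intro n hRn ha hl
    exact heS (h.mem_of_locked R hR hm n (x i) hRn (hx.mem hi) ha (mem_lockedIn.1 hl).2)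
  have key : ∀ B : Finset ι, B ⊆ maxIn X Y P R → (∀ b ∈ B, b ∉ lockedIn X Y P R) →
      (lockedIn X Y P R).card + B.card ≤ (maxIn X Y P R).card := by
    intro B hB hBl
    rw [← Finset.card_union_of_disjoint (Finset.disjoint_right.2 hBl)]
    exact Finset.card_le_card (Finset.union_subset (Finset.filter_subset _ _) hB)
  have hmem : ∀ j < (maxIn X Y P R).card, x j ∈ maxIn X Y P R := fun j hj => (hx.1 _).2 ⟨j, hj, rfl⟩
  have hsucc : ∀ hj : i + 1 < (maxIn X Y P R).card, x (i + 1) ∉ lockedIn X Y P R := fun hj =>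
    hadj _ (hx.mem hj) (hx.adj hR hj).symm
  have hpred : 1 ≤ i → x (i - 1) ∉ lockedIn X Y P R := fun h1 => by
    refine hadj _ (hx.mem (by omega)) ?_
    have := hx.adj hR (i := i - 1) (by omega)
    rwa [Nat.sub_add_cancel h1] at this
  refine ⟨?_, fun hk => ?_, fun hk => ?_⟩
  · simpa using key {x i} (by simpa using he) (by simpa using he')
  · by_cases hik : i + 1 < (maxIn X Y P R).card
    · have := key {x i, x (i + 1)}
        (by simp [Finset.insert_subset_iff, he, hmem _ hik]) (by simp [he', hsucc hik])
      rwa [Finset.card_pair (hx.ne hi hik (by omega))] at this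
    · have hi1 : 1 ≤ i := by omega
      have := key {x i, x (i - 1)}
        (by simp [Finset.insert_subset_iff, he, hmem (i - 1) (by omega)]) (by simp [he', hpred hi1])
      rwa [Finset.card_pair (hx.ne hi (by omega) (by omega))] at this
  · have hend : ¬ (i + 3 < (maxIn X Y P R).card ∨ 3 ≤ i) := fun h3 =>
      h.not_com_of_enum hsat hX hR hm hx hi h3 hc
    have hik : i + 1 < (maxIn X Y P R).card := by omega
    have hi1 : 1 ≤ i := by omega
    have := key {x i, x (i + 1), x (i - 1)}
      (by simp [Finset.insert_subset_iff, he, hmem (i - 1) (by omega), hmem _ hik])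
      (by simp [he', hpred hi1, hsucc hik])
    rwa [Finset.card_eq_three.2 ⟨x i, x (i + 1), x (i - 1), hx.ne hi hik (by omega),
      hx.ne hi (by omega) (by omega), hx.ne hik (by omega) (by omega), rfl⟩] at this

end Inv
end Enum

/-- The number of points of a region without opposite pairs which has `k` maximal elements, none
of which is locked. -/
def baseCount : ℕ → ℕ
  | 0 => 0
  | 1 => 1
  | 2 => 3
  | 3 => 5
  | 4 => 8
  | _ => 11

/-- The number of locked maximal elements which count towards the number of points. -/
def slack : ℕ → ℕ
  | 0 => 0
  | 1 => 1
  | 2 => 1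
  | 3 => 2
  | 4 => 2
  | _ => 0

/-- The bound on the number of points in a region without opposite pairs. -/
def CountBound (X Y : ι → α) (P : Finset ι) (R : ι → Prop) : Prop :=
  (ptsIn P R).card ≤ baseCount (maxIn X Y P R).card +
    min (lockedIn X Y P R).card (slack (maxIn X Y P R).card)

theorem CountBound.le (h : CountBound X Y P R) (hk : (maxIn X Y P R).card ≤ 5) :
    (ptsIn P R).card ≤ 11 := by
  unfold CountBound at h
  generalize (maxIn X Y P R).card = k at h hk
  interval_cases k <;> simp only [baseCount, slack] at h <;> omega

theorem inv_empty (X Y : ι → α) : Inv X Y ∅ ∅ Set.univ := by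
  refine ⟨by simp, fun g => ⟨g, trivial, fun _ _ => rfl⟩, fun e he => ?_, by simp,
    fun e e' c ha => ?_, fun R _ _ x y _ _ ha => ?_⟩
  · simpa using he.1
  · simpa using ha.2.1.1
  · simpa using ha.2.1.1

variable [DecidableEq ι]

theorem CountBound.insert_of_notMem (h : CountBound X Y P R) (hX : X.Injective)
    (hR : SpanClosed X Y R) (hp : p ∉ P) (hRp : ¬ R p) : CountBound X Y (insert p P) R := by
  have h1 : ptsIn (insert p P) R = ptsIn P R := by
    ext b
    simp only [mem_ptsIn, Finset.mem_insert]
    grind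
  have h2 : maxIn X Y (insert p P) R = maxIn X Y P R := by
    ext e
    simp only [mem_maxIn]
    exact and_congr_left fun hRe => isStair_insert_iff_of_notMem hX hR hp hRp hRe
  have h3 : lockedIn X Y (insert p P) R = lockedIn X Y P R := by
    ext e
    rw [mem_lockedIn, mem_lockedIn, ← mem_maxIn, ← mem_maxIn, h2,
      locked_insert_iff_of_notMem hX hR hp hRp]
  unfold CountBound
  rwa [h1, h2, h3]

theorem card_ptsIn_insert (hp : p ∉ P) (hRp : R p) :
    (ptsIn (insert p P) R).card = (ptsIn P R).card + 1 := by
  have : ptsIn (insert p P) R = insert p (ptsIn P R) := by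
    ext b
    simp only [mem_ptsIn, Finset.mem_insert]
    grind
  rw [this, Finset.card_insert_of_notMem fun h => hp (mem_ptsIn.1 h).1]

theorem CountBound.insert_of_no_cover (h : CountBound X Y P R) (hX : X.Injective)
    (hp : p ∉ P) (hRp : R p) (hn : ∀ s, IsStair X Y P s → ¬ Dom X Y p s)
    (hcov : ∀ e ∈ maxIn X Y P R, ¬ Dom X Y e p) (hk : (maxIn X Y (insert p P) R).card ≤ 5) :
    CountBound X Y (insert p P) R := by
  have hmax : maxIn X Y (insert p P) R = insert p (maxIn X Y P R) := by
    ext e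
    simp only [Finset.mem_insert, mem_maxIn, isStair_insert_of_not_dom hX hp hn]
    have := hcov e
    rw [mem_maxIn] at this
    grind
  have hcard : (maxIn X Y (insert p P) R).card = (maxIn X Y P R).card + 1 := by
    rw [hmax, Finset.card_insert_of_notMem fun h => hp (mem_maxIn.1 h).1.1]
  unfold CountBound at *
  rw [card_ptsIn_insert hp hRp]
  rw [hcard] at hk ⊢
  generalize (maxIn X Y P R).card = k at *
  have hk' : k ≤ 4 := by omega
  interval_cases k <;> simp only [baseCount, slack] at h ⊢ <;> omega

theorem Inv.maxIn_insert_eq (h : Inv X Y P S F) (hX : X.Injective) (hR : SpanClosed X Y R)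
    (hm : Mono P F R) (hp : p ∉ P) (hRp : R p)
    (hn : ∀ s, IsStair X Y P s → ¬ Dom X Y p s)
    (hcom : ∀ q ∈ maxIn X Y P R, Dom X Y q p → ∃ c, Com F q c) {e : ι} (he : e ∈ maxIn X Y P R)
    (hep : Dom X Y e p) : (∀ q ∈ maxIn X Y P R, Dom X Y q p → q = e) ∧
      maxIn X Y (insert p P) R = insert p ((maxIn X Y P R).erase e) := by
  have huniq : ∀ q ∈ maxIn X Y P R, Dom X Y q p → q = e := by
    intro q hq hqp
    by_contra hqe
    have hq' := mem_maxIn.1 hq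
    have he' := mem_maxIn.1 he
    obtain ⟨m, ha, hs⟩ := exists_adj hq'.1 he'.1 hqe
    have hmR : R m := hR hq'.2 he'.2 hs
    obtain ⟨c, hc⟩ := hcom m (mem_maxIn.2 ⟨ha.2.1, hmR⟩)
      (hs.dom_of_dom hq'.1 he'.1 ha.2.1 hqp hep)
    obtain ⟨d, hd⟩ := hcom e he hep
    obtain rfl := hc.eq_of_mono hd hm ha.2.1.1 he'.1.1 hmR he'.2
    exact h.not_com_of_adj m e c ha hc hd
  refine ⟨huniq, ?_⟩
  ext q
  simp only [Finset.mem_insert, Finset.mem_erase, mem_maxIn, isStair_insert_of_not_dom hX hp hn]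
  have := huniq q
  rw [mem_maxIn] at this
  grind

theorem Inv.lockedIn_insert (h : Inv X Y P S F) (hX : X.Injective) (hR : SpanClosed X Y R)
    (hm : Mono P F R) (hp : p ∉ P) (hRp : R p) (hn : ∀ s, IsStair X Y P s → ¬ Dom X Y p s)
    {e : ι} (he : e ∈ maxIn X Y P R) (heS : e ∉ S) (hep : Dom X Y e p)
    (huniq : ∀ q ∈ maxIn X Y P R, Dom X Y q p → q = e) :
    insert p (lockedIn X Y P R) ⊆ lockedIn X Y (insert p P) R := by
  have hst := fun e => isStair_insert_of_not_dom hX hp hn (e := e)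
  have he' := mem_maxIn.1 he
  have hpst : IsStair X Y (insert p P) p := (hst p).2 (.inl rfl)
  intro x hx
  rw [mem_lockedIn]
  rcases Finset.mem_insert.1 hx with rfl | hx
  · refine ⟨⟨hpst, hRp⟩, e, Finset.mem_insert_of_mem he'.1.1, fun hex => hp (hex ▸ he'.1.1),
      he'.2, fun q hq heq => ?_⟩
    rcases (hst q).1 hq with rfl | hq
    · rfl
    · exact absurd (he'.1.2 q hq.1.1 heq ▸ hep) hq.2
  · obtain ⟨hxA, hl⟩ := mem_lockedIn.1 hx
    have hxe : x ≠ e := by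
      rintro rfl
      obtain ⟨b, hb, hbx, hRb, hd⟩ := hl
      exact heS (h.com_and_mem_of_locked hR hm hb hbx hRb hd).2
    have hxp : ¬ Dom X Y x p := fun hxp => hxe (huniq x (mem_maxIn.2 hxA) hxp)
    have hxst := (hst x).2 (.inr ⟨hxA.1, hxp⟩)
    refine ⟨⟨hxst, hxA.2⟩, ?_⟩
    have hnadj : ¬ Adj X Y P x e := fun ha =>
      heS (h.mem_of_locked R hR hm x e hxA.2 he'.2 ha hl)
    obtain ⟨b, hb, hbx, hRb, hd⟩ := hl
    have hbp : ¬ Dom X Y b p := by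
      refine fun hbp => hnadj ⟨hxe, hxA.1, he'.1, fun m hms hs => ?_⟩
      by_contra! hcon
      have hmR : R m := hR hxA.2 he'.2 hs
      have hmp : ¬ Dom X Y m p := fun hmp => hcon.2 (huniq m (mem_maxIn.2 ⟨hms, hmR⟩) hmp)
      obtain ⟨d, hds, hbd⟩ := exists_stair_dom (Y := Y) hX hb
      have hbx : Dom X Y b x := hd d hds hbd ▸ hbd
      exact hcon.1 (hd m hms (dom_of_span hbx hbp (hs.of_covered hxA.1 he'.1 hms hmp hep)))
    refine ⟨b, Finset.mem_insert_of_mem hb, hbx, hRb, fun q hq hbq => ?_⟩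
    rcases (hst q).1 hq with rfl | hq
    · exact absurd hbq hbp
    · exact hd q hq.1 hbq

theorem Inv.not_cover_of_five {S' : Set ι} (h : Inv X Y P S F) (hsat : Saturated X Y P S F)
    (h' : Inv X Y (insert p P) S' F') (hsat' : Saturated X Y (insert p P) S' F')
    (hX : X.Injective) (hR : SpanClosed X Y R) (hm : Mono P F R) (hm' : Mono (insert p P) F' R)
    (hp : p ∉ P) {e : ι} (he : e ∈ maxIn X Y P R) {c : Bool} (hec : Com F e c)
    (hep : Dom X Y e p) (hmax : maxIn X Y (insert p P) R = insert p ((maxIn X Y P R).erase e))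
    (huniq : ∀ q ∈ maxIn X Y P R, Dom X Y q p → q = e)
    (hl : p ∈ lockedIn X Y (insert p P) R) : (maxIn X Y P R).card ≠ 5 := by
  intro hk
  have : Nonempty ι := ⟨e⟩
  have hpS : p ∈ S' := by
    obtain ⟨b, hb, hbp, hRb, hd⟩ := (mem_lockedIn.1 hl).2
    exact (h'.com_and_mem_of_locked hR hm' hb hbp hRb hd).2
  obtain ⟨x, hx⟩ := exists_enum hX (maxIn X Y P R)
  rw [hk] at hx
  obtain ⟨i, hi, rfl⟩ := (hx.1 e).1 he
  have hend : ¬ (i + 3 < 5 ∨ 3 ≤ i) := fun h3 => h.not_com_of_enum hsat hX hR hm hx hi h3 hec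
  obtain rfl : i = 2 := by omega
  have hval : ∀ j, j ≠ 2 → Function.update x 2 p j = x j := fun j hj =>
    Function.update_of_ne hj _ _
  have hx' : Enum X (maxIn X Y (insert p P) R) 5 (Function.update x 2 p) := by
    refine ⟨fun a => ?_, fun i j hij hj => ?_⟩
    · rw [hmax, Finset.mem_insert, Finset.mem_erase, hx.1 a]
      constructor
      · rintro (rfl | ⟨ha, i, hi, rfl⟩)
        · exact ⟨2, by omega, by simp⟩
        · exact ⟨i, hi, hval i (by rintro rfl; exact ha rfl)⟩
      · rintro ⟨i, hi, rfl⟩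
        by_cases hi2 : i = 2
        · subst hi2
          simp
        · rw [hval i hi2]
          exact .inr ⟨hx.ne hi (by omega) hi2, i, hi, rfl⟩
    · by_cases hi2 : i = 2
      · subst hi2
        rw [Function.update_self, hval j (by omega)]
        have h1 := (hx.isStair (by omega)).lt_of_lt (hx.isStair hj) (hx.2 2 j hij hj)
        by_contra! hle
        exact hx.ne hj (by omega) (by omega)
          (huniq (x j) ((hx.1 _).2 ⟨j, hj, rfl⟩) ⟨hle, h1.le.trans hep.2⟩)
      · rw [hval i hi2]
        by_cases hj2 : j = 2
        · subst hj2
          rw [Function.update_self]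
          exact (hx.2 i 2 hij hj).trans_le hep.1
        · rw [hval j hj2]
          exact hx.2 i j hij hj
  have := hsat'.notMem_of_enum hX hR hm' hx' (i := 2) le_rfl (by omega)
  rw [Function.update_self] at this
  exact this hpS

/-- One step of the coloring algorithm: a point is inserted and free elements are committed until
this is no longer possible. -/
theorem Inv.exists_insert_saturated (h : Inv X Y P S F) (hsat : Saturated X Y P S F)
    (hX : X.Injective) (hp : p ∉ P)
    (hcount : ∀ R, SpanClosed X Y R → Mono P F R → CountBound X Y P R) :
    ∃ S' F', F' ⊆ F ∧ Inv X Y (insert p P) S' F' ∧ Saturated X Y (insert p P) S' F' ∧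
      ∀ R, SpanClosed X Y R → Mono (insert p P) F' R → CountBound X Y (insert p P) R := by
  obtain ⟨S₁, F₁, hF₁, h₁, hdom, hcov⟩ := h.exists_insert hX hp
  obtain ⟨S', F', hF', h', hsat'⟩ := h₁.exists_saturated
  refine ⟨S', F', hF'.trans hF₁, h', hsat', fun R hR hm' => ?_⟩
  have hm₁ := hm'.anti hF'
  have hm := (hm₁.anti hF₁).subset (Finset.subset_insert p P)
  have hc := hcount R hR hm
  by_cases hRp : R p
  swap
  · exact hc.insert_of_notMem hX hR hp hRp
  have hn : ∀ s, IsStair X Y P s → ¬ Dom X Y p s := by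
    intro s hs hps
    obtain ⟨i, hi, hpi, ho⟩ := hdom s hs hps
    exact hm₁ p (Finset.mem_insert_self _ _) i (Finset.mem_insert_of_mem hi.1) hRp
      (hR.dom hRp hpi) ho
  have hk := h'.card_maxIn_le hsat' hX hR hm'
  by_cases hex : ∃ e ∈ maxIn X Y P R, Dom X Y e p
  swap
  · push Not at hex
    exact hc.insert_of_no_cover hX hp hRp hn hex hk
  obtain ⟨e, he, hep⟩ := hex
  have hqS : ∀ q ∈ maxIn X Y P R, Dom X Y q p → q ∉ S := fun q hq hqp hqS =>
    hm₁ q (Finset.mem_insert_of_mem (mem_maxIn.1 hq).1.1) p (Finset.mem_insert_self _ _)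
      (mem_maxIn.1 hq).2 hRp (hcov hn q hqS hqp)
  have hcom : ∀ q ∈ maxIn X Y P R, Dom X Y q p → ∃ c, Com F q c := fun q hq hqp =>
    h.com_of_notMem q (mem_maxIn.1 hq).1 (hqS q hq hqp)
  obtain ⟨huniq, hmax⟩ := h.maxIn_insert_eq hX hR hm hp hRp hn hcom he hep
  obtain ⟨c, hec⟩ := hcom e he hep
  have hlock := h.lockedIn_insert hX hR hm hp hRp hn he (hqS e he hep) hep huniq
  have h5 := h.not_cover_of_five hsat h' hsat' hX hR hm hm' hp he hec hep hmax huniq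
    (hlock (Finset.mem_insert_self _ _))
  have hlcard := Finset.card_le_card hlock
  rw [Finset.card_insert_of_notMem fun hpl => hp (mem_lockedIn.1 hpl).1.1.1] at hlcard
  have hkeq : (maxIn X Y (insert p P) R).card = (maxIn X Y P R).card := by
    rw [hmax, Finset.card_insert_of_notMem fun hpe =>
      hp (mem_maxIn.1 (Finset.mem_of_mem_erase hpe)).1.1, Finset.card_erase_add_one he]
  obtain ⟨hL1, hL2, hL3⟩ := h.card_lockedIn_le hsat hX hR hm he hec
  unfold CountBound at *
  rw [card_ptsIn_insert hp hRp]
  rw [hkeq] at hk ⊢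
  generalize (maxIn X Y P R).card = k at *
  interval_cases k <;> simp only [baseCount, slack] at hc ⊢ <;> omega

/-- Points in three-dimensional space can be colored with two colors such that every octant with at
least twelve points contains points of both colors. -/
theorem exists_coloring (hX : X.Injective) {β : Type*} [LinearOrder β] (Z : ι → β)
    (T : Finset ι) : ∃ f : ι → Bool, ∀ (h : β) (R : ι → Prop), SpanClosed X Y R →
      12 ≤ (ptsIn T fun i => h ≤ Z i ∧ R i).card →
      ∃ i ∈ T, ∃ j ∈ T, (h ≤ Z i ∧ R i) ∧ (h ≤ Z j ∧ R j) ∧ f i ≠ f j := by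
  suffices ∃ S F, Inv X Y T S F ∧ Saturated X Y T S F ∧
      (∀ R, SpanClosed X Y R → Mono T F R → CountBound X Y T R) ∧
      ∀ (h : β) (R : ι → Prop), SpanClosed X Y R →
        12 ≤ (ptsIn T fun i => h ≤ Z i ∧ R i).card →
        ∃ i ∈ T, ∃ j ∈ T, (h ≤ Z i ∧ R i) ∧ (h ≤ Z j ∧ R j) ∧ Opp F i j by
    obtain ⟨S, F, hI, -, -, hF⟩ := this
    obtain ⟨f, hf⟩ := hI.nonempty
    refine ⟨f, fun h R hR hc => ?_⟩
    obtain ⟨i, hi, j, hj, hRi, hRj, ho⟩ := hF h R hR hc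
    exact ⟨i, hi, j, hj, hRi, hRj, ho f hf⟩
  induction T using Finset.induction_on_min_value Z with
  | empty =>
    refine ⟨∅, Set.univ, inv_empty X Y, by simp [Saturated], fun R _ _ => ?_, fun h R _ hc => ?_⟩
    · simp [CountBound, ptsIn]
    · simp [ptsIn] at hc
  | insert p T hp hmin ih =>
    obtain ⟨S, F, hI, hsat, hcount, hF⟩ := ih
    obtain ⟨S', F', hsub, hI', hsat', hcount'⟩ := hI.exists_insert_saturated hsat hX hp hcount
    refine ⟨S', F', hI', hsat', hcount', fun h R hR hc => ?_⟩
    by_cases hhp : h ≤ Z p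
    · have hall : ∀ i ∈ insert p T, h ≤ Z i := by
        intro i hi
        rcases Finset.mem_insert.1 hi with rfl | hi
        · exact hhp
        · exact hhp.trans (hmin i hi)
      have heq : (ptsIn (insert p T) fun i => h ≤ Z i ∧ R i) = ptsIn (insert p T) R := by
        ext i
        simp only [mem_ptsIn]
        have := hall i
        grind
      rw [heq] at hc
      have hnm : ¬ Mono (insert p T) F' R := fun hm => by
        have := (hcount' R hR hm).le (hI'.card_maxIn_le hsat' hX hR hm)
        omega
      unfold Mono at hnm
      push Not at hnm
      obtain ⟨i, hi, j, hj, hRi, hRj, ho⟩ := hnm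
      exact ⟨i, hi, j, hj, ⟨hall i hi, hRi⟩, ⟨hall j hj, hRj⟩, ho⟩
    · have heq : (ptsIn (insert p T) fun i => h ≤ Z i ∧ R i) = ptsIn T fun i => h ≤ Z i ∧ R i := by
        ext i
        simp only [mem_ptsIn, Finset.mem_insert]
        grind
      rw [heq] at hc
      obtain ⟨i, hi, j, hj, hRi, hRj, ho⟩ := hF h R hR hc
      exact ⟨i, Finset.mem_insert_of_mem hi, j, Finset.mem_insert_of_mem hj, hRi, hRj,
        ho.mono hsub⟩

end Counting
end OctantCover

/-- Octants are cover-decomposable: any 12-fold covering of any subset of ℝ³ with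
finitely many translates of the octant `W = {(x,y,z) : x ≤ 0, y ≤ 0, z ≤ 0}` can be
decomposed into two coverings. -/
theorem octant_cover_decomposable
    (W : Set (Fin 3 → ℝ)) (hW : W = {p | p 0 ≤ 0 ∧ p 1 ≤ 0 ∧ p 2 ≤ 0})
    {ι : Type*} [Fintype ι] (S : Set (Fin 3 → ℝ)) (t : ι → (Fin 3 → ℝ))
    (hcov : ∀ p ∈ S, 12 ≤ {i : ι | p ∈ (t i + ·) '' W}.encard) :
    ∃ I₁ I₂ : Set ι, I₁ ∪ I₂ = Set.univ ∧ I₁ ∩ I₂ = ∅ ∧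
      (∀ p ∈ S, ∃ i ∈ I₁, p ∈ (t i + ·) '' W) ∧
      (∀ p ∈ S, ∃ j ∈ I₂, p ∈ (t j + ·) '' W) := by
  classical
  have hmem : ∀ p i, p ∈ (t i + ·) '' W ↔ p 0 ≤ t i 0 ∧ p 1 ≤ t i 1 ∧ p 2 ≤ t i 2 := by
    intro p i
    rw [Set.image_add_left, Set.mem_preimage, hW, Set.mem_ofPred_eq]
    simp
  let e := Fintype.equivFin ι
  let X : ι → ℝ ×ₗ Fin (Fintype.card ι) := fun i => toLex (t i 0, e i)
  let Y : ι → ℝ ×ₗ Fin (Fintype.card ι) := fun i => toLex (t i 1, e i)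
  have hX : X.Injective := fun i j h => e.injective (congrArg (fun z => (ofLex z).2) h)
  have hXt : ∀ {i j}, X i ≤ X j → t i 0 ≤ t j 0 := fun h => Prod.Lex.monotone_fst _ _ h
  have hYt : ∀ {i j}, Y i ≤ Y j → t i 1 ≤ t j 1 := fun h => Prod.Lex.monotone_fst _ _ h
  obtain ⟨f, hf⟩ := OctantCover.exists_coloring (Y := Y) hX (fun i => t i 2) Finset.univ
  have key : ∀ p ∈ S, ∀ c, ∃ i, f i = c ∧ p ∈ (t i + ·) '' W := by
    intro p hp c
    obtain ⟨i, -, j, -, hi, hj, hij⟩ := hf (p 2) (fun i => p 0 ≤ t i 0 ∧ p 1 ≤ t i 1)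
      (fun a b m ha hb hs => ⟨hs.1.elim (fun h => ha.1.trans (hXt h)) fun h => hb.1.trans (hXt h),
        hs.2.elim (fun h => ha.2.trans (hYt h)) fun h => hb.2.trans (hYt h)⟩) (by
        have := hcov p hp
        rw [← Set.coe_toFinset {i : ι | p ∈ (t i + ·) '' W},
          Set.encard_coe_eq_coe_finsetCard] at this
        refine le_trans (by exact_mod_cast this) (Finset.card_le_card fun i hi => ?_)
        rw [Set.mem_toFinset, Set.mem_ofPred_eq, hmem] at hi
        exact OctantCover.mem_ptsIn.2 ⟨Finset.mem_univ i, hi.2.2, hi.1, hi.2.1⟩)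
    have hi' := (hmem p i).2 ⟨hi.2.1, hi.2.2, hi.1⟩
    have hj' := (hmem p j).2 ⟨hj.2.1, hj.2.2, hj.1⟩
    by_cases hic : f i = c
    · exact ⟨i, hic, hi'⟩
    · refine ⟨j, ?_, hj'⟩
      revert hij hic
      cases f i <;> cases f j <;> cases c <;> simp
  refine ⟨{i | f i = true}, {i | f i = false}, ?_, ?_, fun p hp => key p hp true,
    fun p hp => key p hp false⟩
  · ext i
    cases h : f i <;> simp [h]
  · ext i
    cases h : f i <;> simp [h]
end

section
/- Let T be a nondegenerate triangle in ℝ² (the convex hull of three affinely independent points). For every subset S of ℝ², every finite index set I, and every family (T_i)_{i ∈ I} of positive homothetic copies of T (each T_i = c_i + λ_i · T with λ_i > 0) that forms a 12-fold covering of S, there is a partition of I into two sets I₁ and I₂ such that every point of S lies in some T_i with i ∈ I₁ and also in some T_j with j ∈ I₂. -/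
/-- Point `j` of the planar sequence `(x, y)` lies weakly below and to the left of point `i`. -/
def PlanarDom (x y : ℕ → ℝ) (j i : ℕ) : Prop := x j ≤ x i ∧ y j ≤ y i

/-- Point `i` is not dominated by any earlier point. -/
def PlanarFresh (x y : ℕ → ℝ) (i : ℕ) : Prop := ∀ j < i, ¬ PlanarDom x y j i

/-- At time `t`, the point `i` has arrived, was fresh on arrival, and has not been dominated by
another fresh point since. -/
def PlanarAlive (x y : ℕ → ℝ) (t i : ℕ) : Prop :=
  i < t ∧ PlanarFresh x y i ∧ ∀ j < t, PlanarFresh x y j → PlanarDom x y j i → j = i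

/-- Point `i` lies in the closed quadrant with upper right corner `(X, Y)`. -/
def InQuadrant (x y : ℕ → ℝ) (X Y : ℝ) (i : ℕ) : Prop := x i ≤ X ∧ y i ≤ Y

/-- At time `t`, the partial colouring `e` does not force the quadrant at `(X, Y)` to contain a
point of colour `!b`: all points in it are fresh, uncoloured ones are alive, and no point has
colour `!b`. -/
def QuadrantClean (x y : ℕ → ℝ) (e : ℕ → Option Bool) (t : ℕ) (X Y : ℝ) (b : Bool) : Prop :=
  ∀ i < t, InQuadrant x y X Y i →
    PlanarFresh x y i ∧ (e i = none → PlanarAlive x y t i) ∧ e i ≠ some (!b)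

open Classical in
/-- The points of the quadrant at `(X, Y)` which have state `o` at time `t`. -/
noncomputable def quadrantState (x y : ℕ → ℝ) (e : ℕ → Option Bool) (t : ℕ) (X Y : ℝ)
    (o : Option Bool) : Finset ℕ :=
  (Finset.range t).filter fun i => InQuadrant x y X Y i ∧ e i = o

open Classical in
/-- The elements of `A` whose `f`-value exceeds the `f`-value of some element of `U`. -/
noncomputable def hitSet (f : ℕ → ℝ) (U A : Finset ℕ) : Finset ℕ :=
  A.filter fun i => ∃ u ∈ U, f u < f i

lemma mem_quadrantState {x y : ℕ → ℝ} {e : ℕ → Option Bool} {t : ℕ} {X Y : ℝ}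
    {o : Option Bool} {i : ℕ} :
    i ∈ quadrantState x y e t X Y o ↔ i < t ∧ InQuadrant x y X Y i ∧ e i = o := by
  simp [quadrantState]

lemma mem_hitSet {f : ℕ → ℝ} {U A : Finset ℕ} {i : ℕ} :
    i ∈ hitSet f U A ↔ i ∈ A ∧ ∃ u ∈ U, f u < f i := by
  simp [hitSet]

lemma hitSet_subset (f : ℕ → ℝ) (U A : Finset ℕ) : hitSet f U A ⊆ A :=
  fun _ h => (mem_hitSet.1 h).1

lemma PlanarAlive.mono {x y : ℕ → ℝ} {s t i : ℕ} (hst : s ≤ t) (his : i < s)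
    (h : PlanarAlive x y t i) : PlanarAlive x y s i :=
  ⟨his, h.2.1, fun j hj => h.2.2 j (hj.trans_le hst)⟩

lemma QuadrantClean.mono {x y : ℕ → ℝ} {e : ℕ → Option Bool} {s t : ℕ} {X Y : ℝ} {b : Bool}
    (hst : s ≤ t) (h : QuadrantClean x y e t X Y b) : QuadrantClean x y e s X Y b :=
  fun i hi hQ =>
    have hc := h i (hi.trans_le hst) hQ
    ⟨hc.1, fun hn => (hc.2.1 hn).mono hst hi, hc.2.2⟩

/-- The finset `A` is a strictly decreasing chain for `(x, y)`. -/
def StrictAntichain (x y : ℕ → ℝ) (A : Finset ℕ) : Prop :=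
  ∀ i ∈ A, ∀ j ∈ A, i ≠ j → (x i < x j ∧ y j < y i) ∨ (x j < x i ∧ y i < y j)

lemma StrictAntichain.swap {x y : ℕ → ℝ} {A : Finset ℕ} (h : StrictAntichain x y A) :
    StrictAntichain y x A := fun i hi j hj hij =>
  (h i hi j hj hij).elim (fun h => .inr ⟨h.2, h.1⟩) fun h => .inl ⟨h.2, h.1⟩

lemma QuadrantClean.strictAntichain {x y : ℕ → ℝ} {e : ℕ → Option Bool} {t : ℕ} {X Y : ℝ}
    {b : Bool} (h : QuadrantClean x y e t X Y b) :
    StrictAntichain x y (quadrantState x y e t X Y none) := by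
  intro i hi j hj hij
  rw [mem_quadrantState] at hi hj
  have hi1 := (h i hi.1 hi.2.1).2.1 hi.2.2
  have hj1 := (h j hj.1 hj.2.1).2.1 hj.2.2
  have h1 : ¬ PlanarDom x y i j := fun hd => hij (hj1.2.2 i hi.1 hi1.2.1 hd)
  have h2 : ¬ PlanarDom x y j i := fun hd => hij (hi1.2.2 j hj.1 hj1.2.1 hd).symm
  unfold PlanarDom at h1 h2
  grind

/-- Colouring one point `w` of an antichain, with two further points above all of whose
`y`-coordinates the coloured points `U` lie, increases the number of hits. -/
lemma hitSet_card_insert {x y : ℕ → ℝ} {U A : Finset ℕ} {w g₁ g₂ t : ℕ}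
    (hA : StrictAntichain x y A) (hwA : w ∈ A) (hg₁A : g₁ ∈ A) (hg₂A : g₂ ∈ A)
    (hg : g₁ ≠ g₂) (hw₁ : y w < y g₁) (hw₂ : y w < y g₂)
    (hU₁ : ∀ u ∈ U, y g₁ < y u) (hU₂ : ∀ u ∈ U, y g₂ < y u)
    (hU0 : 1 ≤ U.card) (hA5 : A.card ≤ 5)
    (hhit : 2 ≤ U.card → U.card ≤ (hitSet x U A).card + (hitSet y U A).card)
    (hU7 : U.card ≤ 7)
    (ht : 2 ≤ U.card → A.card = 5 → t ∈ A ∧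
      U.card ≤ ((hitSet x U A).erase t).card + ((hitSet y U A).erase t).card) :
    U.card + 1 ≤ (hitSet x (insert w U) (A.erase w)).card +
      (hitSet y (insert w U) (A.erase w)).card ∧ U.card + 1 ≤ 7 := by
  have hx : ((hitSet x U A).erase w).card ≤ (hitSet x (insert w U) (A.erase w)).card := by
    apply Finset.card_le_card
    intro i hi
    simp only [Finset.mem_erase, mem_hitSet, Finset.mem_insert] at hi ⊢
    grind
  have hy : (hitSet y U A).card + 2 ≤ (hitSet y (insert w U) (A.erase w)).card := by
    have h1 : g₂ ∉ hitSet y U A := fun h => by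
      obtain ⟨-, u, hu, h⟩ := mem_hitSet.1 h
      exact lt_asymm h (hU₂ u hu)
    have h2 : g₁ ∉ insert g₂ (hitSet y U A) := fun h => by
      obtain h | h := Finset.mem_insert.1 h
      · exact hg h
      · obtain ⟨-, u, hu, h⟩ := mem_hitSet.1 h
        exact lt_asymm h (hU₁ u hu)
    rw [show (hitSet y U A).card + 2 = (insert g₁ (insert g₂ (hitSet y U A))).card by
      rw [Finset.card_insert_of_notMem h2, Finset.card_insert_of_notMem h1]]
    apply Finset.card_le_card
    intro i hi
    simp only [Finset.mem_erase, mem_hitSet, Finset.mem_insert] at hi ⊢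
    rcases hi with rfl | rfl | ⟨hi, u, hu, h⟩
    · exact ⟨⟨fun h => by simp [h] at hw₁, hg₁A⟩, w, .inl rfl, hw₁⟩
    · exact ⟨⟨fun h => by simp [h] at hw₂, hg₂A⟩, w, .inl rfl, hw₂⟩
    · refine ⟨⟨fun h' => ?_, hi⟩, u, .inr hu, h⟩
      have := hU₁ u hu
      subst h'
      linarith
  have hxc : (hitSet x U A).card ≤ ((hitSet x U A).erase w).card + 1 :=
    Nat.sub_le_iff_le_add.1 Finset.pred_card_le_card_erase
  have hAw : (A.erase w).card + 1 = A.card := Finset.card_erase_add_one hwA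
  have hxA := Finset.card_le_card (hitSet_subset x (insert w U) (A.erase w))
  have hyA := Finset.card_le_card (hitSet_subset y (insert w U) (A.erase w))
  refine ⟨by omega, ?_⟩
  by_contra hlt
  have hU : U.card = 7 := by omega
  have hA5' : A.card = 5 := by omega
  obtain ⟨htA, ht⟩ := ht (by omega) hA5'
  have hxe : ((hitSet x U A).erase t).card ≤ (hitSet x U A).card := Finset.card_erase_le
  have hye : ((hitSet y U A).erase t).card ≤ (hitSet y U A).card := Finset.card_erase_le
  by_cases htw : t = w
  · subst htw
    omega
  by_cases htx : t ∈ hitSet x U A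
  · have := Finset.card_erase_add_one htx
    omega
  by_cases hty : t ∈ hitSet y U A
  · have := Finset.card_erase_add_one hty
    omega
  have htA' : t ∈ A.erase w := Finset.mem_erase.2 ⟨htw, htA⟩
  have ex : hitSet x (insert w U) (A.erase w) = A.erase w :=
    Finset.eq_of_subset_of_card_le (hitSet_subset _ _ _) (by omega)
  have ey : hitSet y (insert w U) (A.erase w) = A.erase w :=
    Finset.eq_of_subset_of_card_le (hitSet_subset _ _ _) (by omega)
  have h1 := htA'
  have h2 := htA'
  rw [← ex] at h1
  rw [← ey] at h2
  have a1 : x w < x t := by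
    obtain ⟨-, u, hu, h⟩ := mem_hitSet.1 h1
    obtain rfl | hu := Finset.mem_insert.1 hu
    · exact h
    · exact absurd (mem_hitSet.2 ⟨htA, u, hu, h⟩) htx
  have a2 : y w < y t := by
    obtain ⟨-, u, hu, h⟩ := mem_hitSet.1 h2
    obtain rfl | hu := Finset.mem_insert.1 hu
    · exact h
    · exact absurd (mem_hitSet.2 ⟨htA, u, hu, h⟩) hty
  rcases hA w hwA t htA (Ne.symm htw) with h | h <;> linarith

/-- The invariant of the online colouring between two arrivals. -/
def OnlineInvariant (x y : ℕ → ℝ) (e : ℕ → Option Bool) (t : ℕ) : Prop :=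
  ∀ X Y b, QuadrantClean x y e t X Y b →
    ∀ U A, U = quadrantState x y e t X Y (some b) → A = quadrantState x y e t X Y none →
      (U.card = 0 → A.card ≤ 5) ∧ (1 ≤ U.card → A.card ≤ 4) ∧
      (2 ≤ U.card → U.card ≤ (hitSet x U A).card + (hitSet y U A).card) ∧ U.card ≤ 7

/-- The invariant of the online colouring while the arrival of point `t` is processed. -/
def ArrivalInvariant (x y : ℕ → ℝ) (e : ℕ → Option Bool) (t : ℕ) : Prop :=
  ∀ X Y b, QuadrantClean x y e (t + 1) X Y b →
    ∀ U A, U = quadrantState x y e (t + 1) X Y (some b) →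
      A = quadrantState x y e (t + 1) X Y none →
      (U.card = 0 → A.card ≤ 6) ∧ (1 ≤ U.card → A.card ≤ 5) ∧
      (2 ≤ U.card → U.card ≤ (hitSet x U A).card + (hitSet y U A).card) ∧ U.card ≤ 7 ∧
      (2 ≤ U.card → A.card = 5 → t ∈ A ∧
        U.card ≤ ((hitSet x U A).erase t).card + ((hitSet y U A).erase t).card)

lemma OnlineInvariant.arrival {x y : ℕ → ℝ} {e : ℕ → Option Bool} {t : ℕ}
    (h : OnlineInvariant x y e t) (het : e t = none) : ArrivalInvariant x y e t := by
  intro X Y b hc U A hU hA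
  have hU' : U = quadrantState x y e t X Y (some b) := by
    ext i
    rw [hU, mem_quadrantState, mem_quadrantState]
    grind
  by_cases htQ : InQuadrant x y X Y t
  · have key := h X Y b (hc.mono t.le_succ) U _ hU' rfl
    set A₀ := quadrantState x y e t X Y none with hA₀
    have htA : t ∉ A₀ := by simp [hA₀, mem_quadrantState]
    have hAi : A = insert t A₀ := by
      ext i
      rw [hA, hA₀, Finset.mem_insert, mem_quadrantState, mem_quadrantState]
      grind
    have hcard : A.card = A₀.card + 1 := by rw [hAi, Finset.card_insert_of_notMem htA]
    have hsub : ∀ f : ℕ → ℝ, hitSet f U A₀ ⊆ (hitSet f U A).erase t := by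
      intro f i hi
      rw [mem_hitSet] at hi
      rw [Finset.mem_erase, mem_hitSet, hAi]
      exact ⟨fun hit => htA (hit ▸ hi.1), Finset.mem_insert_of_mem hi.1, hi.2⟩
    have hx := Finset.card_le_card (hsub x)
    have hy := Finset.card_le_card (hsub y)
    have hx' : ((hitSet x U A).erase t).card ≤ (hitSet x U A).card := Finset.card_erase_le
    have hy' : ((hitSet y U A).erase t).card ≤ (hitSet y U A).card := Finset.card_erase_le
    have htA' : t ∈ A := hAi ▸ Finset.mem_insert_self _ _
    refine ⟨by omega, by omega, by omega, by omega, fun _ _ => ⟨htA', by omega⟩⟩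
  · have hA' : A = quadrantState x y e t X Y none := by
      ext i
      rw [hA, mem_quadrantState, mem_quadrantState]
      grind
    have key := h X Y b (hc.mono t.le_succ) U A hU' hA'
    refine ⟨by omega, by omega, by omega, by omega, by omega⟩

/-- An admissible colouring step turning `e` into `e'` at time `s`: every newly coloured point is
an alive uncoloured point of a quadrant without points of its new colour `b`, but with a
point of colour `!b`, and with two uncoloured points on each side of it. -/
def ColouringStep (x y : ℕ → ℝ) (e e' : ℕ → Option Bool) (s : ℕ) : Prop :=
  (∀ i, e' i ≠ e i → e i = none ∧ PlanarAlive x y s i ∧ ∃ b X Y, e' i = some b ∧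
    InQuadrant x y X Y i ∧ (∀ j < s, InQuadrant x y X Y j → e j ≠ some b) ∧
    (∃ v < s, InQuadrant x y X Y v ∧ e' v = some (!b)) ∧
    (∃ g₁ g₂, g₁ ≠ g₂ ∧ ∀ g, g = g₁ ∨ g = g₂ → g < s ∧ InQuadrant x y X Y g ∧ e' g = none ∧
      x g < x i ∧ y i < y g) ∧
    (∃ g₁ g₂, g₁ ≠ g₂ ∧ ∀ g, g = g₁ ∨ g = g₂ → g < s ∧ InQuadrant x y X Y g ∧ e' g = none ∧
      x i < x g ∧ y g < y i)) ∧
  ∀ i j, e' i ≠ e i → e' j ≠ e j → e' i = e' j → i = j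

/-- `e'` extends the partial colouring `e` on points alive and uncoloured at time `s`. -/
def ColouringExtends (x y : ℕ → ℝ) (e e' : ℕ → Option Bool) (s : ℕ) : Prop :=
  ∀ i, e' i ≠ e i → e i = none ∧ PlanarAlive x y s i

lemma ColouringStep.colouringExtends {x y : ℕ → ℝ} {e e' : ℕ → Option Bool} {s : ℕ}
    (h : ColouringStep x y e e' s) : ColouringExtends x y e e' s :=
  fun i hi => ⟨(h.1 i hi).1, (h.1 i hi).2.1⟩

lemma ColouringExtends.trans {x y : ℕ → ℝ} {e e' e'' : ℕ → Option Bool} {s : ℕ}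
    (h : ColouringExtends x y e e' s) (h' : ColouringExtends x y e' e'' s) :
    ColouringExtends x y e e'' s := by
  intro i hi
  by_cases h1 : e' i = e i
  · rw [← h1]
    exact h' i (h1 ▸ hi)
  · exact h i h1

lemma QuadrantClean.of_extends {x y : ℕ → ℝ} {e e' : ℕ → Option Bool} {s t : ℕ} {X Y : ℝ}
    {b : Bool} (h : ColouringExtends x y e e' s) (hts : t ≤ s)
    (hc : QuadrantClean x y e' t X Y b) : QuadrantClean x y e t X Y b := by
  intro i hi hQ
  obtain ⟨h1, h2, h3⟩ := hc i hi hQ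
  by_cases hch : e' i = e i
  · exact ⟨h1, hch ▸ h2, hch ▸ h3⟩
  · obtain ⟨h4, h5⟩ := h i hch
    exact ⟨h1, fun _ => h5.mono hts hi, by simp [h4]⟩

lemma ArrivalInvariant.step {x y : ℕ → ℝ} {e e' : ℕ → Option Bool} {t : ℕ}
    (h : ArrivalInvariant x y e t) (hs : ColouringStep x y e e' (t + 1)) :
    ArrivalInvariant x y e' t := by
  intro X Y b hc' U' A' hU' hA'
  have hc := hc'.of_extends hs.colouringExtends le_rfl
  by_cases hch : ∃ w < t + 1, InQuadrant x y X Y w ∧ e' w ≠ e w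
  swap
  · push Not at hch
    refine h X Y b hc U' A' ?_ ?_
    · ext i
      rw [hU', mem_quadrantState, mem_quadrantState]
      grind
    · ext i
      rw [hA', mem_quadrantState, mem_quadrantState]
      grind
  obtain ⟨w, hwt, hwQ, hw⟩ := hch
  obtain ⟨hwn, hwal, b', X0, Y0, hwb, hwQ0, hnb, ⟨v, hvt, hvQ, hvb⟩, ⟨g₁, g₂, hg, hgp⟩,
    g₃, g₄, hg', hgp'⟩ := hs.1 w hw
  obtain rfl : b' = b := by
    have := (hc' w hwt hwQ).2.2
    rw [hwb] at this
    cases b <;> cases b' <;> simp_all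
  set U := quadrantState x y e (t + 1) X Y (some b') with hU
  set A := quadrantState x y e (t + 1) X Y none with hA
  have huniq : ∀ i < t + 1, InQuadrant x y X Y i → e' i ≠ e i → i = w := by
    intro i hi hiQ hie
    refine hs.2 i w hie hw ?_
    have h1 := (hs.1 i hie).1
    have := (hc' i hi hiQ).2.2
    rw [hwb]
    cases h2 : e' i with
    | none => rw [h1, h2] at hie; exact absurd rfl hie
    | some c => cases c <;> cases b' <;> simp_all
  have hwU : w ∉ U := by simp [hU, mem_quadrantState, hwn]
  have hwA : w ∈ A := by rw [hA, mem_quadrantState]; exact ⟨hwt, hwQ, hwn⟩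
  have hUi : U' = insert w U := by
    ext i
    rw [hU', Finset.mem_insert, hU, mem_quadrantState, mem_quadrantState]
    grind
  have hAe : A' = A.erase w := by
    ext i
    rw [hA', Finset.mem_erase, hA, mem_quadrantState, mem_quadrantState]
    grind
  have hUc : U'.card = U.card + 1 := by rw [hUi, Finset.card_insert_of_notMem hwU]
  have hAc : A'.card + 1 = A.card := by rw [hAe, Finset.card_erase_add_one hwA]
  obtain ⟨k1, k2, k3, k4, k5⟩ := h X Y b' hc U A hU hA
  rcases Nat.eq_zero_or_pos U.card with h0 | hpos
  · refine ⟨by omega, by omega, by omega, by omega, by omega⟩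
  suffices hgoal : U.card + 1 ≤ (hitSet x U' A').card + (hitSet y U' A').card ∧
      U.card + 1 ≤ 7 by
    refine ⟨by omega, by omega, by omega, by omega, by omega⟩
  have hanti : StrictAntichain x y A := hc.strictAntichain
  have hfree : ∀ g, e' g = none → e g = none := by
    intro g hgn
    by_contra hne
    exact hne (hs.1 g (by rw [hgn]; exact Ne.symm hne)).1
  have hUQ : ∀ u ∈ U, (x u ≤ X ∧ y u ≤ Y) ∧ (X0 < x u ∨ Y0 < y u) := by
    intro u hu
    rw [hU, mem_quadrantState] at hu
    refine ⟨hu.2.1, ?_⟩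
    by_contra hcon
    push Not at hcon
    exact hnb u hu.1 hcon hu.2.2
  have hv : X < x v ∨ Y < y v := by
    by_contra hcon
    push Not at hcon
    exact (hc' v hvt hcon).2.2 hvb
  obtain ⟨u₁, hu₁⟩ := Finset.card_pos.1 hpos
  have hu := hUQ u₁ hu₁
  have hcase : (Y0 < Y ∧ X < X0) ∨ (X0 < X ∧ Y < Y0) := by
    obtain ⟨hv1, hv2⟩ := hvQ
    rcases hv with hv | hv <;> rcases hu.2 with h' | h'
    · linarith [hu.1.1]
    · left; constructor <;> linarith [hu.1.2]
    · right; constructor <;> linarith [hu.1.1]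
    · linarith [hu.1.2]
  rw [hUi, hAe]
  rcases hcase with ⟨hY, hX⟩ | ⟨hX, hY⟩
  · have hgA : ∀ g, g = g₁ ∨ g = g₂ → g ∈ A ∧ y w < y g ∧ ∀ u ∈ U, y g < y u := by
      intro g hgg
      obtain ⟨p1, p2, p3, p4, p5⟩ := hgp g hgg
      refine ⟨?_, p5, fun u hu => ?_⟩
      · rw [hA, mem_quadrantState]
        exact ⟨p1, ⟨by linarith [hwQ.1], by linarith [p2.2]⟩, hfree g p3⟩
      · have := hUQ u hu
        rcases this.2 with h' | h' <;> linarith [p2.2, this.1.1]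
    exact hitSet_card_insert hanti hwA (hgA _ (.inl rfl)).1 (hgA _ (.inr rfl)).1 hg
      (hgA _ (.inl rfl)).2.1 (hgA _ (.inr rfl)).2.1 (hgA _ (.inl rfl)).2.2
      (hgA _ (.inr rfl)).2.2 hpos (k2 hpos) k3 k4 k5
  · have hgA : ∀ g, g = g₃ ∨ g = g₄ → g ∈ A ∧ x w < x g ∧ ∀ u ∈ U, x g < x u := by
      intro g hgg
      obtain ⟨p1, p2, p3, p4, p5⟩ := hgp' g hgg
      refine ⟨?_, p4, fun u hu => ?_⟩
      · rw [hA, mem_quadrantState]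
        exact ⟨p1, ⟨by linarith [p2.1], by linarith [hwQ.2]⟩, hfree g p3⟩
      · have := hUQ u hu
        rcases this.2 with h' | h' <;> linarith [p2.1, this.1.2]
    rw [add_comm (hitSet x _ _).card]
    exact hitSet_card_insert hanti.swap hwA (hgA _ (.inl rfl)).1 (hgA _ (.inr rfl)).1 hg'
      (hgA _ (.inl rfl)).2.1 (hgA _ (.inr rfl)).2.1 (hgA _ (.inl rfl)).2.2
      (hgA _ (.inr rfl)).2.2 hpos (k2 hpos) (fun h2 => by have := k3 h2; omega) k4
      (fun h2 h3 => ⟨(k5 h2 h3).1, by have := (k5 h2 h3).2; omega⟩)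

lemma StrictAntichain.exists_sorted {x y : ℕ → ℝ} {A : Finset ℕ} (hA : StrictAntichain x y A)
    {k : ℕ} (hk : k ≤ A.card) :
    ∃ f : Fin k → ℕ, (∀ i, f i ∈ A) ∧ ∀ i j, i < j → x (f i) < x (f j) ∧ y (f j) < y (f i) := by
  have hinj : Set.InjOn x A := by
    intro i hi j hj hij
    by_contra hne
    rcases hA i hi j hj hne with h | h <;> linarith
  have hk' : k ≤ (A.image x).card := by rwa [Finset.card_image_of_injOn hinj]
  have hmem : ∀ i : Fin k, ∃ a ∈ A, x a = (A.image x).orderEmbOfCardLe hk' i := fun i =>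
    Finset.mem_image.1 (Finset.orderEmbOfCardLe_mem _ hk' i)
  choose f hf hfx using hmem
  refine ⟨f, hf, fun i j hij => ?_⟩
  have hlt : x (f i) < x (f j) := by
    rw [hfx, hfx]
    exact (Finset.orderEmbOfCardLe _ hk').strictMono hij
  refine ⟨hlt, ?_⟩
  rcases hA _ (hf i) _ (hf j) (fun h => by simp [h] at hlt) with h | h
  · exact h.2
  · linarith [h.1]

lemma QuadrantClean.exists_step {x y : ℕ → ℝ} {e : ℕ → Option Bool} {s : ℕ} {X Y : ℝ} {b : Bool}
    (hc : QuadrantClean x y e s X Y b)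
    (h : 6 ≤ (quadrantState x y e s X Y none).card ∧
        (quadrantState x y e s X Y (some b)).card = 0 ∨
      5 ≤ (quadrantState x y e s X Y none).card ∧
        1 ≤ (quadrantState x y e s X Y (some b)).card) :
    ∃ e', ColouringStep x y e e' s ∧ ∃ i, e' i ≠ e i := by
  have hal : ∀ i ∈ quadrantState x y e s X Y none,
      (i < s ∧ InQuadrant x y X Y i ∧ e i = none) ∧ PlanarAlive x y s i := by
    intro i hi
    rw [mem_quadrantState] at hi
    exact ⟨hi, (hc i hi.1 hi.2.1).2.1 hi.2.2⟩
  rcases h with ⟨h6, h0⟩ | ⟨h5, h1⟩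
  · obtain ⟨f, hf, hlt⟩ := hc.strictAntichain.exists_sorted h6
    have hne : ∀ i j, i < j → f i ≠ f j := fun i j hij h => by
      have := (hlt i j hij).1
      simp [h] at this
    have hnone : ∀ c, ∀ j < s, InQuadrant x y X Y j → e j ≠ some c := by
      intro c j hj hjQ hjc
      have h2 := (hc j hj hjQ).2.2
      have h3 : j ∉ quadrantState x y e s X Y (some b) := by
        rw [Finset.card_eq_zero.1 h0]; simp
      rw [mem_quadrantState] at h3
      cases b <;> cases c <;> simp_all
    set e' : ℕ → Option Bool :=
      Function.update (Function.update e (f 2) (some true)) (f 3) (some false) with he'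
    have v2 : e' (f 2) = some true := by
      rw [he', Function.update_of_ne (hne 2 3 (by decide)), Function.update_self]
    have v3 : e' (f 3) = some false := by rw [he', Function.update_self]
    have vo : ∀ i, i ≠ f 2 → i ≠ f 3 → e' i = e i := fun i h2 h3 => by
      rw [he', Function.update_of_ne h3, Function.update_of_ne h2]
    have hF : ∀ k, f k < s ∧ InQuadrant x y X Y (f k) ∧ e (f k) = none := fun k =>
      (hal _ (hf k)).1
    have w : ∀ k, k ≠ 2 → k ≠ 3 → e' (f k) = none := by
      intro k k2 k3
      rw [vo, (hF k).2.2]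
      · rcases lt_or_gt_of_ne k2 with h | h
        exacts [hne _ _ h, (hne _ _ h).symm]
      · rcases lt_or_gt_of_ne k3 with h | h
        exacts [hne _ _ h, (hne _ _ h).symm]
    have hsides : ∀ k : Fin 6, k = 2 ∨ k = 3 →
        (∃ g₁ g₂, g₁ ≠ g₂ ∧ ∀ g, g = g₁ ∨ g = g₂ → g < s ∧ InQuadrant x y X Y g ∧
          e' g = none ∧ x g < x (f k) ∧ y (f k) < y g) ∧
        (∃ g₁ g₂, g₁ ≠ g₂ ∧ ∀ g, g = g₁ ∨ g = g₂ → g < s ∧ InQuadrant x y X Y g ∧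
          e' g = none ∧ x (f k) < x g ∧ y g < y (f k)) := by
      intro k hk
      refine ⟨⟨f 0, f 1, hne 0 1 (by decide), ?_⟩, f 4, f 5, hne 4 5 (by decide), ?_⟩
      · rintro g (rfl | rfl)
        · exact ⟨(hF _).1, (hF _).2.1, w _ (by decide) (by decide), hlt _ _ (by grind)⟩
        · exact ⟨(hF _).1, (hF _).2.1, w _ (by decide) (by decide), hlt _ _ (by grind)⟩
      · rintro g (rfl | rfl)
        · exact ⟨(hF _).1, (hF _).2.1, w _ (by decide) (by decide), hlt _ _ (by grind)⟩
        · exact ⟨(hF _).1, (hF _).2.1, w _ (by decide) (by decide), hlt _ _ (by grind)⟩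
    have hch : ∀ i, e' i ≠ e i → i = f 2 ∨ i = f 3 := fun i hi => by
      by_contra hcon
      push Not at hcon
      exact hi (vo i hcon.1 hcon.2)
    refine ⟨e', ⟨fun i hi => ?_, fun i j hi hj hij => ?_⟩, f 2, by simp [v2, (hF 2).2.2]⟩
    · rcases hch i hi with rfl | rfl
      · exact ⟨(hF _).2.2, (hal _ (hf _)).2, true, X, Y, v2, (hF _).2.1, hnone _,
          ⟨f 3, (hF _).1, (hF _).2.1, v3⟩, hsides 2 (.inl rfl)⟩
      · exact ⟨(hF _).2.2, (hal _ (hf _)).2, false, X, Y, v3, (hF _).2.1, hnone _,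
          ⟨f 2, (hF _).1, (hF _).2.1, v2⟩, hsides 3 (.inr rfl)⟩
    · rcases hch i hi with rfl | rfl <;> rcases hch j hj with rfl | rfl <;> simp_all
  · obtain ⟨f, hf, hlt⟩ := hc.strictAntichain.exists_sorted h5
    obtain ⟨v, hv⟩ := Finset.card_pos.1 h1
    rw [mem_quadrantState] at hv
    have hne : ∀ i j, i < j → f i ≠ f j := fun i j hij h => by
      have := (hlt i j hij).1
      simp [h] at this
    set e' : ℕ → Option Bool := Function.update e (f 2) (some (!b)) with he'
    have v2 : e' (f 2) = some (!b) := by rw [he', Function.update_self]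
    have vo : ∀ i, i ≠ f 2 → e' i = e i := fun i h2 => by rw [he', Function.update_of_ne h2]
    have hF : ∀ k, f k < s ∧ InQuadrant x y X Y (f k) ∧ e (f k) = none := fun k =>
      (hal _ (hf k)).1
    have w : ∀ k, k ≠ 2 → e' (f k) = none := by
      intro k k2
      rw [vo, (hF k).2.2]
      rcases lt_or_gt_of_ne k2 with h | h
      exacts [hne _ _ h, (hne _ _ h).symm]
    have hch : ∀ i, e' i ≠ e i → i = f 2 := fun i hi => by
      by_contra hcon
      exact hi (vo i hcon)
    refine ⟨e', ⟨fun i hi => ?_, fun i j hi hj _ => (hch i hi).trans (hch j hj).symm⟩, f 2,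
      by simp [v2, (hF 2).2.2]⟩
    obtain rfl := hch i hi
    refine ⟨(hF _).2.2, (hal _ (hf _)).2, !b, X, Y, v2, (hF _).2.1,
      fun j hj hjQ => (hc j hj hjQ).2.2, ⟨v, hv.1, hv.2.1, ?_⟩,
      ⟨f 0, f 1, hne 0 1 (by decide), ?_⟩, f 3, f 4, hne 3 4 (by decide), ?_⟩
    · rw [vo v (fun h => by simp [h, (hF 2).2.2] at hv), hv.2.2, Bool.not_not]
    · rintro g (rfl | rfl)
      · exact ⟨(hF _).1, (hF _).2.1, w _ (by decide), hlt _ _ (by decide)⟩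
      · exact ⟨(hF _).1, (hF _).2.1, w _ (by decide), hlt _ _ (by decide)⟩
    · rintro g (rfl | rfl)
      · exact ⟨(hF _).1, (hF _).2.1, w _ (by decide), hlt _ _ (by decide)⟩
      · exact ⟨(hF _).1, (hF _).2.1, w _ (by decide), hlt _ _ (by decide)⟩

lemma ArrivalInvariant.exists_online {x y : ℕ → ℝ} {t : ℕ} (m : ℕ) {e : ℕ → Option Bool}
    (hm : ((Finset.range (t + 1)).filter fun i => e i = none).card ≤ m)
    (h : ArrivalInvariant x y e t) :
    ∃ e', ColouringExtends x y e e' (t + 1) ∧ OnlineInvariant x y e' (t + 1) := by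
  induction m generalizing e with
  | zero =>
    refine ⟨e, fun i hi => absurd rfl hi, fun X Y b hc U A hU hA => ?_⟩
    have hA0 : A.card = 0 := by
      refine Nat.le_zero.1 (le_trans (Finset.card_le_card fun i hi => ?_) hm)
      rw [hA, mem_quadrantState] at hi
      simp [hi.1, hi.2.2]
    have key := h X Y b hc U A hU hA
    refine ⟨by omega, by omega, by omega, by omega⟩
  | succ m ih =>
    by_cases hcrowded : ∃ X Y b, QuadrantClean x y e (t + 1) X Y b ∧
        (6 ≤ (quadrantState x y e (t + 1) X Y none).card ∧
          (quadrantState x y e (t + 1) X Y (some b)).card = 0 ∨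
        5 ≤ (quadrantState x y e (t + 1) X Y none).card ∧
          1 ≤ (quadrantState x y e (t + 1) X Y (some b)).card)
    · obtain ⟨X, Y, b, hc, hcard⟩ := hcrowded
      obtain ⟨e', hs, i, hi⟩ := hc.exists_step hcard
      have hlt : ((Finset.range (t + 1)).filter fun i => e' i = none).card <
          ((Finset.range (t + 1)).filter fun i => e i = none).card := by
        apply Finset.card_lt_card
        rw [Finset.ssubset_iff_of_subset]
        · refine ⟨i, ?_, ?_⟩
          · simp [(hs.1 i hi).1, (hs.1 i hi).2.1.1]
          · obtain ⟨-, -, b', -, -, hb', -⟩ := hs.1 i hi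
            simp [hb']
        · intro j hj
          rw [Finset.mem_filter] at hj ⊢
          refine ⟨hj.1, ?_⟩
          by_contra hne
          exact hne (hs.1 j (by rw [hj.2]; exact Ne.symm hne)).1
      obtain ⟨e'', he'', hJ⟩ := ih (by omega) (h.step hs)
      exact ⟨e'', hs.colouringExtends.trans he'', hJ⟩
    · push Not at hcrowded
      refine ⟨e, fun i hi => absurd rfl hi, fun X Y b hc U A hU hA => ?_⟩
      have key := h X Y b hc U A hU hA
      have hst := hcrowded X Y b hc
      rw [← hU, ← hA] at hst
      refine ⟨fun h0 => ?_, fun h1 => ?_, by omega, by omega⟩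
      · by_contra hlt
        exact hst.1 (by omega) h0
      · by_contra hlt
        have := hst.2 (by omega)
        omega

lemma OnlineInvariant.card_le {x y : ℕ → ℝ} {e : ℕ → Option Bool} {t : ℕ}
    (h : OnlineInvariant x y e t) {X Y : ℝ} {b : Bool} (hc : QuadrantClean x y e t X Y b)
    {Q : Finset ℕ} (hQ : ∀ i ∈ Q, i < t ∧ InQuadrant x y X Y i) : Q.card ≤ 11 := by
  obtain ⟨h1, h2, -, h3⟩ := h X Y b hc _ _ rfl rfl
  have hsub : Q ⊆ quadrantState x y e t X Y (some b) ∪ quadrantState x y e t X Y none := by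
    intro i hi
    obtain ⟨hit, hiQ⟩ := hQ i hi
    rw [Finset.mem_union, mem_quadrantState, mem_quadrantState]
    have := (hc i hit hiQ).2.2
    cases hei : e i with
    | none => simp [hit, hiQ]
    | some c => cases b <;> cases c <;> simp_all
  have := (Finset.card_le_card hsub).trans (Finset.card_union_le _ _)
  omega

lemma exists_partial_colouring (x y : ℕ → ℝ) (t : ℕ) :
    ∃ e : ℕ → Option Bool, (∀ i, e i ≠ none → i < t) ∧ OnlineInvariant x y e t ∧
      ∀ τ ≤ t, ∀ X Y b, QuadrantClean x y e τ X Y b →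
        ∀ Q : Finset ℕ, (∀ i ∈ Q, i < τ ∧ InQuadrant x y X Y i) → Q.card ≤ 11 := by
  induction t with
  | zero =>
    have hJ : OnlineInvariant x y (fun _ => none) 0 := by
      rintro X Y b - U A rfl rfl
      simp [quadrantState]
    refine ⟨fun _ => none, by simp, hJ, ?_⟩
    rintro τ hτ X Y b hc Q hQ
    obtain rfl := Nat.le_zero.1 hτ
    exact hJ.card_le hc hQ
  | succ t ih =>
    obtain ⟨e, hdom, hJ, hgood⟩ := ih
    have het : e t = none := by
      by_contra hne
      exact lt_irrefl _ (hdom t hne)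
    obtain ⟨e', hext, hJ'⟩ := (hJ.arrival het).exists_online _ le_rfl
    refine ⟨e', fun i hi => ?_, hJ', fun τ hτ X Y b hc Q hQ => ?_⟩
    · by_cases hch : e' i = e i
      · exact (hdom i (hch ▸ hi)).trans t.lt_succ_self
      · exact (hext i hch).2.1
    · rcases hτ.lt_or_eq with hlt | rfl
      · exact hgood τ (Nat.lt_succ_iff.1 hlt) X Y b (hc.of_extends hext hτ) Q hQ
      · exact hJ'.card_le hc hQ

/-- The total colouring of fresh points completing a partial one: an uncoloured point gets the
colour opposite to that of its successor under `link`. -/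
def resolveColour (e : ℕ → Option Bool) (link : ℕ → ℕ) (n i : ℕ) : Bool :=
  match e i with
  | some b => b
  | none => if i < link i ∧ link i < n then !resolveColour e link n (link i) else true
termination_by n - i

theorem exists_prefix_quadrant_colouring (x y : ℕ → ℝ) (n : ℕ) :
    ∃ c : ℕ → Bool, ∀ τ ≤ n, ∀ X Y, ∀ Q : Finset ℕ,
      (∀ i, i ∈ Q ↔ i < τ ∧ x i ≤ X ∧ y i ≤ Y) → 12 ≤ Q.card → ∀ b, ∃ i ∈ Q, c i = b := by
  classical
  obtain ⟨e, -, -, he⟩ := exists_partial_colouring x y n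
  set link : ℕ → ℕ := fun i => sInf {j | i < j ∧ PlanarFresh x y j ∧ PlanarDom x y j i}
    with hlink
  set firstDom : ℕ → ℕ := fun i => sInf {j | PlanarDom x y j i} with hfirstDom
  set c₀ := resolveColour e link n with hc₀
  refine ⟨fun i => if PlanarFresh x y i then c₀ i else !c₀ (firstDom i), ?_⟩
  intro τ hτ X Y Q hQ hcard b
  by_contra hcon
  push Not at hcon
  refine absurd (he τ hτ X Y (!b) (fun i hi hiQ => ?_) Q (fun i hi => (hQ i).1 hi)) (by omega)
  have hin : ∀ j < τ, PlanarDom x y j i → j ∈ Q := fun j hj hd =>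
    (hQ j).2 ⟨hj, hd.1.trans hiQ.1, hd.2.trans hiQ.2⟩
  have hci := hcon i ((hQ i).2 ⟨hi, hiQ⟩)
  have hfresh : PlanarFresh x y i := by
    by_contra hnf
    have hd : PlanarDom x y (firstDom i) i := Nat.sInf_mem (s := {j | PlanarDom x y j i})
      ⟨i, le_rfl, le_rfl⟩
    have hmin : ∀ j, PlanarDom x y j i → firstDom i ≤ j := fun j hj => Nat.sInf_le hj
    have hlt : firstDom i < i := by
      unfold PlanarFresh at hnf
      push Not at hnf
      obtain ⟨j, hji, hj⟩ := hnf
      exact (hmin j hj).trans_lt hji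
    have hff : PlanarFresh x y (firstDom i) := fun j hj hd' =>
      absurd (hmin j ⟨hd'.1.trans hd.1, hd'.2.trans hd.2⟩) (by omega)
    have h2 := hcon _ (hin _ (hlt.trans hi) hd)
    simp only [hnf, hff, if_true, if_false] at hci h2
    cases b <;> simp_all
  simp only [hfresh, if_true] at hci
  refine ⟨hfresh, fun hnone => ⟨hi, hfresh, fun j hj hjf hjd => ?_⟩, fun hsome => ?_⟩
  · by_contra hne
    have hij : i < j := lt_of_le_of_ne (not_lt.1 fun hlt => hfresh j hlt hjd) (Ne.symm hne)
    have hl : i < link i ∧ PlanarFresh x y (link i) ∧ PlanarDom x y (link i) i :=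
      Nat.sInf_mem (s := {j | i < j ∧ PlanarFresh x y j ∧ PlanarDom x y j i}) ⟨j, hij, hjf, hjd⟩
    have hlτ : link i < τ := lt_of_le_of_lt (Nat.sInf_le ⟨hij, hjf, hjd⟩) hj
    have h2 := hcon _ (hin _ hlτ hl.2.2)
    simp only [hl.2.1, if_true] at h2
    have h3 : c₀ i = !c₀ (link i) := by
      rw [hc₀, resolveColour, hnone]
      simp [hl.1, hlτ.trans_le hτ]
    rw [h3] at hci
    cases b <;> simp_all
  · rw [hc₀, resolveColour, hsome] at hci
    simp at hci

theorem exists_octant_colouring {ι : Type*} [Fintype ι] (a : Fin 3 → ι → ℝ) :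
    ∃ c : ι → Bool, ∀ X : Fin 3 → ℝ, 12 ≤ {i | ∀ k, a k i ≤ X k}.encard →
      ∀ b, ∃ i, (∀ k, a k i ≤ X k) ∧ c i = b := by
  classical
  set n := Fintype.card ι with hn
  let e₀ : ι ≃ Fin n := Fintype.equivFin ι
  let σ : Equiv.Perm (Fin n) := Tuple.sort (a 2 ∘ e₀.symm)
  have hmono : Monotone ((a 2 ∘ e₀.symm) ∘ σ) := Tuple.monotone_sort _
  let f : Fin n ≃ ι := σ.trans e₀.symm
  have hf : ∀ i j, i ≤ j → a 2 (f i) ≤ a 2 (f j) := fun i j hij => hmono hij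
  let x : ℕ → ℝ := fun i => if h : i < n then a 0 (f ⟨i, h⟩) else 0
  let y : ℕ → ℝ := fun i => if h : i < n then a 1 (f ⟨i, h⟩) else 0
  have hx : ∀ i : Fin n, x i = a 0 (f i) := fun i => by simp [x]
  have hy : ∀ i : Fin n, y i = a 1 (f i) := fun i => by simp [y]
  obtain ⟨c, hc⟩ := exists_prefix_quadrant_colouring x y n
  refine ⟨fun i => c (f.symm i), fun X hX b => ?_⟩
  have hex : ∃ m : ℕ, ∀ k : Fin n, a 2 (f k) ≤ X 2 → (k : ℕ) < m := ⟨n, fun k _ => k.2⟩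
  have hτ : Nat.find hex ≤ n := Nat.find_min' hex fun k _ => k.2
  have hτ' : ∀ k : Fin n, (k : ℕ) < Nat.find hex ↔ a 2 (f k) ≤ X 2 := by
    refine fun k => ⟨fun hk => ?_, Nat.find_spec hex k⟩
    have := Nat.find_min hex hk
    push Not at this
    obtain ⟨j, hj, hkj⟩ := this
    exact (hf k j hkj).trans hj
  let P : Finset ι := Finset.univ.filter fun i => ∀ k, a k i ≤ X k
  let g : ι ↪ ℕ := f.symm.toEmbedding.trans Fin.valEmbedding
  have hg : ∀ k : Fin n, g (f k) = k := fun k => by simp [g]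
  have hP : ∀ i, i ∈ P.map g ↔ i < Nat.find hex ∧ x i ≤ X 0 ∧ y i ≤ X 1 := by
    intro i
    constructor
    · intro hi
      obtain ⟨j, hj, rfl⟩ := Finset.mem_map.1 hi
      obtain ⟨k, rfl⟩ := f.surjective j
      have hj : ∀ l, a l (f k) ≤ X l := (Finset.mem_filter.1 hj).2
      rw [hg, hx, hy, hτ']
      exact ⟨hj 2, hj 0, hj 1⟩
    · rintro ⟨h1, h2, h3⟩
      have hin := h1.trans_le hτ
      refine Finset.mem_map.2 ⟨f ⟨i, hin⟩, ?_, hg _⟩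
      rw [hx ⟨i, hin⟩] at h2
      rw [hy ⟨i, hin⟩] at h3
      have h1 := (hτ' ⟨i, hin⟩).1 h1
      simp only [P, Finset.mem_filter, Finset.mem_univ, true_and, Fin.forall_fin_succ]
      exact ⟨h2, h3, h1, fun k => k.elim0⟩
  have hcard : 12 ≤ (P.map g).card := by
    have hset : {i | ∀ k, a k i ≤ X k} = (P : Set ι) := by ext; simp [P]
    rw [hset, Set.encard_coe_eq_coe_finsetCard] at hX
    rw [Finset.card_map]
    exact_mod_cast hX
  obtain ⟨i, hi, hib⟩ := hc _ hτ _ _ _ hP hcard b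
  obtain ⟨j, hj, rfl⟩ := Finset.mem_map.1 hi
  exact ⟨j, (Finset.mem_filter.1 hj).2, hib⟩

lemma exists_homothet_mem_iff (A B C : Fin 2 → ℝ) (hABC : AffineIndependent ℝ ![A, B, C]) :
    ∃ (L : Fin 3 → (Fin 2 → ℝ) → ℝ) (d : Fin 3 → ℝ), ∀ (c : Fin 2 → ℝ) (r : ℝ), 0 < r → ∀ p,
      p ∈ (fun x => c + r • x) '' convexHull ℝ {A, B, C} ↔ ∀ k, L k c - r * d k ≤ L k p := by
  let b : AffineBasis (Fin 3) ℝ (Fin 2 → ℝ) :=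
    ⟨![A, B, C], hABC, hABC.affineSpan_eq_top_iff_card_eq_finrank_add_one.2 (by simp)⟩
  have hb : convexHull ℝ {A, B, C} = {x | ∀ k, 0 ≤ b.coord k x} := by
    rw [← b.convexHull_eq_nonneg_coord]
    congr 1
    change _ = Set.range ![A, B, C]
    ext
    simp only [Set.mem_insert_iff, Set.mem_singleton_iff, Matrix.range_cons, Matrix.range_empty,
      Set.union_empty, Set.singleton_union]
  have hlin : ∀ k z, b.coord k z = (b.coord k).linear z + b.coord k 0 := fun k z => by
    have := (b.coord k).map_vadd 0 z
    simpa using this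
  refine ⟨fun k z => (b.coord k).linear z, fun k => b.coord k 0, fun c r hr p => ?_⟩
  have hmem : p ∈ (fun x => c + r • x) '' convexHull ℝ {A, B, C} ↔
      r⁻¹ • (p - c) ∈ convexHull ℝ {A, B, C} := by
    constructor
    · rintro ⟨z, hz, rfl⟩
      simpa [smul_smul, hr.ne'] using hz
    · intro h
      exact ⟨_, h, by simp [smul_smul, hr.ne']⟩
  rw [hmem, hb]
  refine forall_congr' fun k => ?_
  rw [hlin, map_smul, map_sub, smul_eq_mul]
  have : r⁻¹ * ((b.coord k).linear p - (b.coord k).linear c) + b.coord k 0 =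
      r⁻¹ * ((b.coord k).linear p - ((b.coord k).linear c - r * b.coord k 0)) := by
    field_simp
    ring
  rw [this, mul_nonneg_iff_of_pos_left (inv_pos.2 hr), sub_nonneg]

/-- Any 12-fold covering of any subset of the plane with finitely many positive
homothetic copies of a given nondegenerate triangle can be decomposed into two
coverings. -/
theorem triangle_homothets_cover_decomposable
    (A B C : Fin 2 → ℝ) (hABC : AffineIndependent ℝ ![A, B, C])
    (T : Set (Fin 2 → ℝ)) (hT : T = convexHull ℝ {A, B, C})
    {ι : Type*} [Fintype ι] (S : Set (Fin 2 → ℝ))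
    (c : ι → (Fin 2 → ℝ)) (lam : ι → ℝ) (hlam : ∀ i, 0 < lam i)
    (hcov : ∀ p ∈ S, 12 ≤ {i : ι | p ∈ (fun x => c i + lam i • x) '' T}.encard) :
    ∃ I₁ I₂ : Set ι, I₁ ∪ I₂ = Set.univ ∧ I₁ ∩ I₂ = ∅ ∧
      (∀ p ∈ S, ∃ i ∈ I₁, p ∈ (fun x => c i + lam i • x) '' T) ∧
      (∀ p ∈ S, ∃ j ∈ I₂, p ∈ (fun x => c j + lam j • x) '' T) := by
  subst hT
  obtain ⟨L, d, hL⟩ := exists_homothet_mem_iff A B C hABC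
  obtain ⟨col, hcol⟩ := exists_octant_colouring fun k i => L k (c i) - lam i * d k
  have key : ∀ b, ∀ p ∈ S, ∃ i ∈ {i | col i = b},
      p ∈ (fun x => c i + lam i • x) '' convexHull ℝ {A, B, C} := by
    intro b p hp
    have h12 := hcov p hp
    simp only [hL _ _ (hlam _)] at h12
    obtain ⟨i, hi, hib⟩ := hcol (fun k => L k p) h12 b
    exact ⟨i, hib, (hL _ _ (hlam i) p).2 hi⟩
  refine ⟨{i | col i = true}, {i | col i = false}, ?_, ?_, key true, key false⟩
  · ext i
    cases h : col i <;> simp [h]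
  · ext i
    cases h : col i <;> simp [h]
end

section
/- Let T be a nondegenerate triangle in ℝ². Let (T_i)_{i ∈ I} be a family of positive homothetic copies of T that is a 12-fold covering of the whole plane ℝ² and is locally finite, meaning that every compact subset of ℝ² intersects only finitely many of the sets T_i. Then the index set I can be partitioned into two parts I₁ and I₂ such that each of the subfamilies (T_i)_{i ∈ I₁} and (T_i)_{i ∈ I₂} covers the whole plane. -/
section Staircase

variable {ι α β : Type*} [LinearOrder α] [LinearOrder β]

/-- The indices whose coordinates lie in given lower sets. -/
def quadrant (x : ι → α) (y : ι → β) (U : LowerSet α) (V : LowerSet β) : Set ι :=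
  {i | x i ∈ U ∧ y i ∈ V}

/-- A set of indices containing both ends of some edge of `E`. -/
def ContainsEdge (E : ι → ι → Prop) (W : Set ι) : Prop :=
  ∃ u v, E u v ∧ u ∈ W ∧ v ∈ W

/-- A graph `E` on the planar points `P`, together with a staircase `S` and a set `B` of points
below it.  The colours of the points of `B` can be prescribed arbitrarily in a proper two-colouring
of `E`, and the quadrants containing no edge have few points in `S` and in `B`. -/
structure IsStaircase (x : ι → α) (y : ι → β) (P : Finset ι) (E : ι → ι → Prop)
    (S B : Finset ι) : Prop where
  edge_mem : ∀ u v, E u v → u ∈ P ∧ v ∈ P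
  extend : ∀ g : ι → Bool, ∃ f : ι → Bool, (∀ b ∈ B, f b = g b) ∧ ∀ u v, E u v → f u ≠ f v
  subset_S : S ⊆ P
  subset_B : B ⊆ P
  good : ∀ p ∈ P, p ∉ S → p ∉ B → ContainsEdge E {i | x i ≤ x p ∧ y i ≤ y p}
  anti : ∀ b ∈ B, ∀ b' ∈ B, x b' ≤ x b → y b' ≤ y b → b' = b
  below : ∀ b ∈ B, ∀ s ∈ S, x s ≤ x b → ¬ y s ≤ y b
  three : ∀ U V, ∀ a ∈ S, ∀ b ∈ S, ∀ c ∈ S, a ≠ b → a ≠ c → b ≠ c →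
    a ∈ quadrant x y U V → b ∈ quadrant x y U V → c ∈ quadrant x y U V →
    ContainsEdge E (quadrant x y U V)

/-- Every quadrant without staircase points and without edges has at most three points of `B`. -/
def IsSparse (x : ι → α) (y : ι → β) (E : ι → ι → Prop) (S B : Finset ι) : Prop :=
  ∀ U V, (∀ s ∈ S, s ∉ quadrant x y U V) → ∀ t ⊆ B, (∀ b ∈ t, b ∈ quadrant x y U V) →
    4 ≤ t.card → ContainsEdge E (quadrant x y U V)

variable {x : ι → α} {y : ι → β} {P : Finset ι} {E : ι → ι → Prop} {S B : Finset ι}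

theorem ContainsEdge.mono {E' : ι → ι → Prop} {W W' : Set ι} (h : ContainsEdge E W)
    (hE : ∀ u v, E u v → E' u v) (hW : W ⊆ W') : ContainsEdge E' W' := by
  obtain ⟨u, v, huv, hu, hv⟩ := h
  exact ⟨u, v, hE u v huv, hW hu, hW hv⟩

theorem principal_subset_quadrant {U : LowerSet α} {V : LowerSet β} {p : ι}
    (hp : p ∈ quadrant x y U V) : {i | x i ≤ x p ∧ y i ≤ y p} ⊆ quadrant x y U V :=
  fun _ hi => ⟨U.lower hi.1 hp.1, V.lower hi.2 hp.2⟩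

theorem IsSparse.card_le_three (hs : IsSparse x y E S B) {U U' : LowerSet α} {V V' : LowerSet β}
    (hU : U' ≤ U) (hV : V' ≤ V) (hW : ¬ ContainsEdge E (quadrant x y U V))
    (hS : ∀ s ∈ S, s ∈ quadrant x y U V → s ∉ quadrant x y U' V')
    [DecidablePred (· ∈ quadrant x y U' V')] :
    (B.filter (· ∈ quadrant x y U' V')).card ≤ 3 := by
  have hsub : quadrant x y U' V' ⊆ quadrant x y U V := fun i hi => ⟨hU hi.1, hV hi.2⟩
  by_contra! h
  exact hW ((hs U' V' (fun s h h' => hS s h (hsub h') h') _ (Finset.filter_subset _ _)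
    (fun b hb => (Finset.mem_filter.1 hb).2) h).mono (fun _ _ h => h) hsub)

theorem Finset.exists_pair_le_of_card_le_two [DecidableEq ι] (x : ι → α) {s : Finset ι}
    (hne : s.Nonempty) (hs : s.card ≤ 2) :
    ∃ p ∈ s, ∃ r ∈ s, x p ≤ x r ∧ ∀ i ∈ s, i = p ∨ i = r := by
  obtain ⟨p, hp, hpmin⟩ := s.exists_min_image x hne
  obtain ⟨r, hr, hrp⟩ : ∃ r ∈ s, ∀ i ∈ s, i = p ∨ i = r := by
    by_cases h : ∃ r ∈ s, r ≠ p
    · obtain ⟨r, hr, hrp⟩ := h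
      refine ⟨r, hr, fun i hi => ?_⟩
      by_contra! hn
      have : ({i, p, r} : Finset ι).card ≤ s.card :=
        Finset.card_le_card (by simp [Finset.insert_subset_iff, hi, hp, hr])
      rw [Finset.card_eq_three.2 ⟨i, p, r, hn.1, hn.2, hrp.symm, rfl⟩] at this
      omega
    · push Not at h
      exact ⟨p, hp, fun i hi => Or.inl (h i hi)⟩
  exact ⟨p, hp, r, hr, hpmin r hr, hrp⟩

/-- A quadrant with at least twelve points contains an edge. -/
theorem IsStaircase.containsEdge (h : IsStaircase x y P E S B) (hs : IsSparse x y E S B)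
    (U : LowerSet α) (V : LowerSet β) {t : Finset ι} (htP : t ⊆ P)
    (ht : ∀ i ∈ t, i ∈ quadrant x y U V) (hcard : 12 ≤ t.card) :
    ContainsEdge E (quadrant x y U V) := by
  classical
  by_contra hW
  have hSB : t ⊆ S.filter (· ∈ quadrant x y U V) ∪ B.filter (· ∈ quadrant x y U V) := by
    intro p hp
    by_contra hn
    simp only [Finset.mem_union, Finset.mem_filter, ht p hp, and_true, not_or] at hn
    exact hW ((h.good p (htP hp) hn.1 hn.2).mono (fun _ _ h => h)
      (principal_subset_quadrant (ht p hp)))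
  have hS2 : (S.filter (· ∈ quadrant x y U V)).card ≤ 2 := by
    by_contra! h3
    obtain ⟨a, ha, b, hb, c, hc, hab, hac, hbc⟩ := Finset.two_lt_card.1 h3
    rw [Finset.mem_filter] at ha hb hc
    exact hW (h.three U V a ha.1 b hb.1 c hc.1 hab hac hbc ha.2 hb.2 hc.2)
  have hB9 : (B.filter (· ∈ quadrant x y U V)).card ≤ 9 := by
    rcases (S.filter (· ∈ quadrant x y U V)).eq_empty_or_nonempty with he | hne
    · refine (hs.card_le_three le_rfl le_rfl hW fun s hS hsW => ?_).trans (by norm_num)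
      exact fun _ => Finset.notMem_empty s (he ▸ Finset.mem_filter.2 ⟨hS, hsW⟩)
    obtain ⟨p, hp, r, hr, hpr, hall⟩ := Finset.exists_pair_le_of_card_le_two x hne hS2
    rw [Finset.mem_filter] at hp hr
    have hall' : ∀ s ∈ S, s ∈ quadrant x y U V → s = p ∨ s = r :=
      fun s hS hsW => hall s (Finset.mem_filter.2 ⟨hS, hsW⟩)
    have h1 := hs.card_le_three (U' := U ⊓ LowerSet.Iio (x p)) (V' := V) inf_le_left le_rfl hW (by
      rintro s hS hsW ⟨h1, -⟩
      have h1 : x s < x p := h1.2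
      rcases hall' s hS hsW with rfl | rfl
      · exact h1.false
      · exact h1.not_ge hpr)
    have h2 := hs.card_le_three (U' := U ⊓ LowerSet.Iio (x r)) (V' := V ⊓ LowerSet.Iio (y p))
      inf_le_left inf_le_left hW (by
      rintro s hS hsW ⟨h1, h2⟩
      have h1 : x s < x r := h1.2
      have h2 : y s < y p := h2.2
      rcases hall' s hS hsW with rfl | rfl
      · exact h2.false
      · exact h1.false)
    have h3 := hs.card_le_three (U' := U) (V' := V ⊓ LowerSet.Iio (y p) ⊓ LowerSet.Iio (y r))
      le_rfl (inf_le_left.trans inf_le_left) hW (by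
      rintro s hS hsW ⟨-, h2⟩
      have h1 : y s < y p := h2.1.2
      have h2 : y s < y r := h2.2
      rcases hall' s hS hsW with rfl | rfl
      · exact h1.false
      · exact h2.false)
    refine (Finset.card_le_card (fun b hb => ?_)).trans ((Finset.card_union_le _ _).trans
      (Nat.add_le_add ((Finset.card_union_le _ _).trans (Nat.add_le_add h1 h2)) h3))
    rw [Finset.mem_filter] at hb
    obtain ⟨hb, hbU, hbV⟩ := hb
    simp only [Finset.mem_union, Finset.mem_filter]
    have hbp := h.below b hb p hp.1
    have hbr := h.below b hb r hr.1
    rcases lt_or_ge (x b) (x p) with h4 | h4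
    · exact Or.inl (Or.inl ⟨hb, ⟨hbU, h4⟩, hbV⟩)
    have h5 := not_le.1 (hbp h4)
    rcases lt_or_ge (x b) (x r) with h6 | h6
    · exact Or.inl (Or.inr ⟨hb, ⟨hbU, h6⟩, hbV, h5⟩)
    · exact Or.inr ⟨hb, hbU, ⟨hbV, h5⟩, not_le.1 (hbr h6)⟩
  have := (Finset.card_le_card hSB).trans (Finset.card_union_le _ _)
  omega

theorem Finset.exists_four_lt_of_injOn (x : ι → α) {t : Finset ι} (hx : Set.InjOn x t)
    (ht : 4 ≤ t.card) :
    ∃ a ∈ t, ∃ b ∈ t, ∃ c ∈ t, ∃ d ∈ t, x a < x b ∧ x b < x c ∧ x c < x d := by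
  classical
  have hc : (t.image x).card = t.card := Finset.card_image_of_injOn hx
  have hmem : ∀ k : Fin t.card, ∃ i ∈ t, x i = (t.image x).orderEmbOfFin hc k := fun k =>
    Finset.mem_image.1 (Finset.orderEmbOfFin_mem _ hc k)
  choose i hi hxi using hmem
  have hlt : ∀ j k : Fin t.card, j < k → x (i j) < x (i k) := fun j k hjk => by
    rw [hxi, hxi]
    exact ((t.image x).orderEmbOfFin hc).strictMono hjk
  exact ⟨_, hi ⟨0, by omega⟩, _, hi ⟨1, by omega⟩, _, hi ⟨2, by omega⟩, _, hi ⟨3, by omega⟩,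
    hlt _ _ (by simp), hlt _ _ (by simp), hlt _ _ (by simp)⟩

/-- Four points of `B` in a quadrant without staircase points and edges: join the outer pairs and
move the middle two points to the staircase. -/
theorem IsStaircase.exists_card_lt (h : IsStaircase x y P E S B) {U : LowerSet α} {V : LowerSet β}
    (hS : ∀ s ∈ S, s ∉ quadrant x y U V) {b₁ b₂ b₃ b₄ : ι}
    (h₁ : b₁ ∈ B) (h₂ : b₂ ∈ B) (h₃ : b₃ ∈ B) (h₄ : b₄ ∈ B)
    (hV : y b₁ ∈ V) (hU : x b₄ ∈ U)
    (h₁₂ : x b₁ < x b₂) (h₂₃ : x b₂ < x b₃) (h₃₄ : x b₃ < x b₄) :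
    ∃ E' S' B', (∀ u v, E u v → E' u v) ∧ IsStaircase x y P E' S' B' ∧ B'.card < B.card := by
  classical
  have desc : ∀ b ∈ B, ∀ b' ∈ B, x b < x b' → y b' < y b := fun b hb b' hb' hlt => by
    by_contra! hle
    exact hlt.ne (congrArg x (h.anti b' hb' b hb hlt.le hle))
  have k₁₂ := desc b₁ h₁ b₂ h₂ h₁₂
  have k₂₃ := desc b₂ h₂ b₃ h₃ h₂₃
  have k₃₄ := desc b₃ h₃ b₄ h₄ h₃₄
  set E' : ι → ι → Prop := fun u v => E u v ∨ (u = b₁ ∧ v = b₂) ∨ (u = b₃ ∧ v = b₄)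
  have hE : ∀ u v, E u v → E' u v := fun u v => Or.inl
  have e₁₂ : E' b₁ b₂ := Or.inr (Or.inl ⟨rfl, rfl⟩)
  have e₃₄ : E' b₃ b₄ := Or.inr (Or.inr ⟨rfl, rfl⟩)
  have key : ∀ U' V', ∀ s ∈ S, s ∈ quadrant x y U' V' → ∀ b, b = b₂ ∨ b = b₃ →
      b ∈ quadrant x y U' V' → ContainsEdge E' (quadrant x y U' V') := by
    rintro U' V' s hs ⟨hsU, hsV⟩ b hb ⟨hbU, hbV⟩
    have hxb : x b₂ ≤ x b := by rcases hb with rfl | rfl <;> order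
    have hyb : y b₃ ≤ y b := by rcases hb with rfl | rfl <;> order
    by_cases hys : y s ∈ V
    · have hxs : x b₄ < x s := lt_of_not_ge fun hle => hS s hs ⟨U.lower hle hU, hys⟩
      exact ⟨b₃, b₄, e₃₄, ⟨U'.lower (by order) hsU, V'.lower (by order) hbV⟩,
        U'.lower (by order) hsU, V'.lower (by order) hbV⟩
    · have hys : y b₁ < y s := lt_of_not_ge fun hle => hys (V.lower hle hV)
      exact ⟨b₁, b₂, e₁₂, ⟨U'.lower (by order) hbU, V'.lower (by order) hsV⟩,
        U'.lower (by order) hbU, V'.lower (by order) hsV⟩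
  set S' : Finset ι := insert b₂ (insert b₃ (S.filter fun s =>
    ¬ (x b₂ ≤ x s ∧ y b₂ ≤ y s) ∧ ¬ (x b₃ ≤ x s ∧ y b₃ ≤ y s)))
  have hS' : ∀ s, s ∈ S' ↔ s = b₂ ∨ s = b₃ ∨ s ∈ S ∧
    ¬ (x b₂ ≤ x s ∧ y b₂ ≤ y s) ∧ ¬ (x b₃ ≤ x s ∧ y b₃ ≤ y s) := by
    simp [S']
  set B' : Finset ι := (B.erase b₂).erase b₃
  have hB' : ∀ b, b ∈ B' ↔ b ≠ b₃ ∧ b ≠ b₂ ∧ b ∈ B := by simp [B']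
  have hBB : ∀ b ∈ B', b ∈ B := fun b hb => ((hB' b).1 hb).2.2
  refine ⟨E', S', B', hE, ⟨?_, ?_, ?_, ?_, ?_, ?_, ?_, ?_⟩, ?_⟩
  · rintro u v (huv | ⟨rfl, rfl⟩ | ⟨rfl, rfl⟩)
    · exact h.edge_mem u v huv
    · exact ⟨h.subset_B h₁, h.subset_B h₂⟩
    · exact ⟨h.subset_B h₃, h.subset_B h₄⟩
  · intro g
    obtain ⟨f, hf, hfE⟩ := h.extend
      (fun b => if b = b₂ then !g b₁ else if b = b₃ then !g b₄ else g b)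
    have n₁₂ : b₁ ≠ b₂ := fun e => h₁₂.ne (congrArg x e)
    have n₁₃ : b₁ ≠ b₃ := fun e => (h₁₂.trans h₂₃).ne (congrArg x e)
    have n₂₃ : b₃ ≠ b₂ := fun e => h₂₃.ne' (congrArg x e)
    have n₃₄ : b₄ ≠ b₃ := fun e => h₃₄.ne' (congrArg x e)
    have n₂₄ : b₄ ≠ b₂ := fun e => (h₂₃.trans h₃₄).ne' (congrArg x e)
    refine ⟨f, fun b hb => ?_, ?_⟩
    · obtain ⟨hb3, hb2, hb⟩ := (hB' b).1 hb
      simp [hf b hb, hb3, hb2]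
    · rintro u v (huv | ⟨rfl, rfl⟩ | ⟨rfl, rfl⟩)
      · exact hfE u v huv
      · simp [hf _ h₁, hf _ h₂, n₁₂, n₁₃]
      · simp [hf _ h₃, hf _ h₄, n₂₃, n₃₄, n₂₄]
  · intro s hs
    rcases (hS' s).1 hs with rfl | rfl | hs
    exacts [h.subset_B h₂, h.subset_B h₃, h.subset_S hs.1]
  · exact fun b hb => h.subset_B (hBB b hb)
  · intro p hp hpS hpB
    rw [hS'] at hpS
    rw [hB'] at hpB
    push Not at hpS hpB
    have hpB : p ∉ B := fun hp => hpB hpS.2.1 hpS.1 hp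
    by_cases hpS₀ : p ∈ S
    · have hle : (x b₂ ≤ x p ∧ y b₂ ≤ y p) ∨ (x b₃ ≤ x p ∧ y b₃ ≤ y p) := by
        by_contra! hn
        have := hpS.2.2 hpS₀ hn.1
        exact this.2.not_gt (hn.2 this.1)
      have hp' := key (LowerSet.Iic (x p)) (LowerSet.Iic (y p)) p hpS₀ ⟨le_rfl, le_rfl⟩
      rcases hle with hle | hle
      · exact hp' b₂ (Or.inl rfl) hle
      · exact hp' b₃ (Or.inr rfl) hle
    · exact (h.good p hp hpS₀ hpB).mono hE le_rfl
  · exact fun b hb b' hb' => h.anti b (hBB b hb) b' (hBB b' hb')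
  · intro b hb s hs hx hy
    obtain ⟨hb3, hb2, hbB⟩ := (hB' b).1 hb
    rcases (hS' s).1 hs with rfl | rfl | hs
    · exact hb2 (h.anti b hbB s h₂ hx hy).symm
    · exact hb3 (h.anti b hbB s h₃ hx hy).symm
    · exact h.below b hbB s hs.1 hx hy
  · intro U' V' a ha b hb c hc hab hac hbc haW hbW hcW
    have hcl : ∀ s ∈ S', s ∈ S ∨ s = b₂ ∨ s = b₃ := fun s hs => by
      rcases (hS' s).1 hs with h | h | h
      exacts [Or.inr (Or.inl h), Or.inr (Or.inr h), Or.inl h.1]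
    rcases hcl a ha with ha | ha <;> rcases hcl b hb with hb | hb <;> rcases hcl c hc with hc | hc
    · exact (h.three U' V' a ha b hb c hc hab hac hbc haW hbW hcW).mono hE le_rfl
    · exact key U' V' a ha haW c hc hcW
    · exact key U' V' a ha haW b hb hbW
    · exact key U' V' a ha haW b hb hbW
    · exact key U' V' b hb hbW a ha haW
    · exact key U' V' b hb hbW a ha haW
    · exact key U' V' c hc hcW a ha haW
    · rcases ha with rfl | rfl <;> rcases hb with rfl | rfl <;> rcases hc with rfl | rfl <;>
        contradiction
  · exact (Finset.card_le_card (Finset.erase_subset _ _)).trans_lt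
      (Finset.card_erase_lt_of_mem h₂)

theorem IsStaircase.exists_isSparse (h : IsStaircase x y P E S B) :
    ∃ E' S' B', (∀ u v, E u v → E' u v) ∧ IsStaircase x y P E' S' B' ∧ IsSparse x y E' S' B' := by
  induction hn : B.card using Nat.strong_induction_on generalizing E S B with
  | _ n ih =>
    by_cases hs : IsSparse x y E S B
    · exact ⟨E, S, B, fun _ _ h => h, h, hs⟩
    unfold IsSparse at hs
    push Not at hs
    obtain ⟨U, V, hS, t, htB, htW, ht, -⟩ := hs
    have hinj : Set.InjOn x t := fun b hb b' hb' hx => by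
      rcases le_total (y b) (y b') with hy | hy
      · exact h.anti b' (htB hb') b (htB hb) hx.le hy
      · exact (h.anti b (htB hb) b' (htB hb') hx.ge hy).symm
    obtain ⟨b₁, h₁, b₂, h₂, b₃, h₃, b₄, h₄, h₁₂, h₂₃, h₃₄⟩ :=
      Finset.exists_four_lt_of_injOn x hinj ht
    obtain ⟨E', S', B', hE, h', hlt⟩ := h.exists_card_lt hS (htB h₁) (htB h₂) (htB h₃) (htB h₄)
      (htW _ h₁).2 (htW _ h₄).1 h₁₂ h₂₃ h₃₄
    obtain ⟨E'', S'', B'', hE', h''⟩ := ih _ (hn ▸ hlt) h' rfl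
    exact ⟨E'', S'', B'', fun u v huv => hE' u v (hE u v huv), h''⟩

/-- Inserting a point that lies above an old one. -/
theorem IsStaircase.insert_of_le [DecidableEq ι] (h : IsStaircase x y P E S B)
    (hs : IsSparse x y E S B) {a p : ι} (ha : a ∉ P) (hp : p ∈ P) (hx : x p ≤ x a)
    (hy : y p ≤ y a) :
    ∃ E', (∀ u v, E u v → E' u v) ∧ IsStaircase x y (insert a P) E' S B ∧ IsSparse x y E' S B := by
  have hE : ∀ u v, E u v → E u v ∨ (u = a ∧ v = p) := fun u v => Or.inl
  refine ⟨fun u v => E u v ∨ (u = a ∧ v = p), hE, ⟨?_, ?_, ?_, ?_, ?_, h.anti, h.below, ?_⟩, ?_⟩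
  · rintro u v (huv | ⟨rfl, rfl⟩)
    · exact (h.edge_mem u v huv).imp (Finset.mem_insert_of_mem) (Finset.mem_insert_of_mem)
    · exact ⟨Finset.mem_insert_self _ _, Finset.mem_insert_of_mem hp⟩
  · intro g
    obtain ⟨f, hf, hfE⟩ := h.extend g
    refine ⟨Function.update f a (!f p), fun b hb => ?_, ?_⟩
    · rw [Function.update_of_ne (ne_of_mem_of_not_mem (h.subset_B hb) ha), hf b hb]
    · rintro u v (huv | ⟨rfl, rfl⟩)
      · have huv' := h.edge_mem u v huv
        rw [Function.update_of_ne (ne_of_mem_of_not_mem huv'.1 ha),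
          Function.update_of_ne (ne_of_mem_of_not_mem huv'.2 ha)]
        exact hfE u v huv
      · rw [Function.update_self, Function.update_of_ne (ne_of_mem_of_not_mem hp ha)]
        simp
  · exact h.subset_S.trans (Finset.subset_insert _ _)
  · exact h.subset_B.trans (Finset.subset_insert _ _)
  · intro q hq hqS hqB
    rcases Finset.mem_insert.1 hq with rfl | hq
    · exact ⟨q, p, Or.inr ⟨rfl, rfl⟩, ⟨le_rfl, le_rfl⟩, hx, hy⟩
    · exact (h.good q hq hqS hqB).mono hE le_rfl
  · intro U V b hb c hc d hd hbc hbd hcd hbW hcW hdW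
    exact (h.three U V b hb c hc d hd hbc hbd hcd hbW hcW hdW).mono hE le_rfl
  · exact fun U V hS t ht htW hc => (hs U V hS t ht htW hc).mono hE le_rfl

/-- Inserting a point that lies above no old one. -/
theorem IsStaircase.insert_of_not_le [DecidableEq ι] (h : IsStaircase x y P E S B)
    {a : ι} (ha : a ∉ P) (hmin : ∀ p ∈ P, x p ≤ x a → ¬ y p ≤ y a) :
    ∃ E' B', (∀ u v, E u v → E' u v) ∧ IsStaircase x y (insert a P) E' S B' := by
  classical
  set B' := insert a (B.filter fun b => ¬ (x a ≤ x b ∧ y a ≤ y b))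
  have hB' : ∀ b, b ∈ B' ↔ b = a ∨ b ∈ B ∧ ¬ (x a ≤ x b ∧ y a ≤ y b) := by simp [B']
  set E' : ι → ι → Prop := fun u v => E u v ∨ (u = a ∧ v ∈ B ∧ x a ≤ x v ∧ y a ≤ y v)
  have hE : ∀ u v, E u v → E' u v := fun u v => Or.inl
  refine ⟨E', B', hE, ⟨?_, ?_, ?_, ?_, ?_, ?_, ?_, ?_⟩⟩
  · rintro u v (huv | ⟨rfl, hv, -⟩)
    · exact (h.edge_mem u v huv).imp (Finset.mem_insert_of_mem) (Finset.mem_insert_of_mem)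
    · exact ⟨Finset.mem_insert_self _ _, Finset.mem_insert_of_mem (h.subset_B hv)⟩
  · intro g
    obtain ⟨f, hf, hfE⟩ := h.extend (fun b => if x a ≤ x b ∧ y a ≤ y b then !g a else g b)
    refine ⟨Function.update f a (g a), fun b hb => ?_, ?_⟩
    · rcases (hB' b).1 hb with rfl | ⟨hb, hn⟩
      · simp
      · rw [Function.update_of_ne (ne_of_mem_of_not_mem (h.subset_B hb) ha), hf b hb, if_neg hn]
    · rintro u v (huv | ⟨rfl, hv, hle⟩)
      · have huv' := h.edge_mem u v huv
        rw [Function.update_of_ne (ne_of_mem_of_not_mem huv'.1 ha),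
          Function.update_of_ne (ne_of_mem_of_not_mem huv'.2 ha)]
        exact hfE u v huv
      · rw [Function.update_self, Function.update_of_ne (ne_of_mem_of_not_mem (h.subset_B hv) ha),
          hf v hv, if_pos hle]
        simp
  · exact h.subset_S.trans (Finset.subset_insert _ _)
  · intro b hb
    rcases (hB' b).1 hb with rfl | hb
    · exact Finset.mem_insert_self _ _
    · exact Finset.mem_insert_of_mem (h.subset_B hb.1)
  · intro q hq hqS hqB
    rw [hB', not_or] at hqB
    have hq := (Finset.mem_insert.1 hq).resolve_left hqB.1
    by_cases hqB₀ : q ∈ B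
    · have hle : x a ≤ x q ∧ y a ≤ y q := by
        by_contra hn
        exact hqB.2 ⟨hqB₀, hn⟩
      exact ⟨a, q, Or.inr ⟨rfl, hqB₀, hle⟩, hle, le_rfl, le_rfl⟩
    · exact (h.good q hq hqS hqB₀).mono hE le_rfl
  · intro b hb b' hb' hx hy
    rcases (hB' b).1 hb with rfl | hb <;> rcases (hB' b').1 hb' with rfl | hb'
    · rfl
    · exact absurd hy (hmin b' (h.subset_B hb'.1) hx)
    · exact absurd ⟨hx, hy⟩ hb.2
    · exact h.anti b hb.1 b' hb'.1 hx hy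
  · intro b hb s hs
    rcases (hB' b).1 hb with rfl | hb
    · exact hmin s (h.subset_S hs)
    · exact h.below b hb.1 s hs
  · intro U V b hb c hc d hd hbc hbd hcd hbW hcW hdW
    exact (h.three U V b hb c hc d hd hbc hbd hcd hbW hcW hdW).mono hE le_rfl

theorem IsStaircase.exists_insert [DecidableEq ι] (h : IsStaircase x y P E S B)
    (hs : IsSparse x y E S B) {a : ι} (ha : a ∉ P) :
    ∃ E' S' B', (∀ u v, E u v → E' u v) ∧ IsStaircase x y (insert a P) E' S' B' ∧
      IsSparse x y E' S' B' := by
  by_cases hp : ∃ p ∈ P, x p ≤ x a ∧ y p ≤ y a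
  · obtain ⟨p, hp, hx, hy⟩ := hp
    obtain ⟨E', hE, h'⟩ := h.insert_of_le hs ha hp hx hy
    exact ⟨E', S, B, hE, h'⟩
  · push Not at hp
    obtain ⟨E', B', hE, h'⟩ := h.insert_of_not_le ha fun p hpP hx => (hp p hpP hx).not_ge
    obtain ⟨E'', S', B'', hE', h''⟩ := h'.exists_isSparse
    exact ⟨E'', S', B'', fun u v huv => hE' u v (hE u v huv), h''⟩

theorem isStaircase_empty : IsStaircase x y ∅ (fun _ _ => False) ∅ ∅ := by
  constructor <;> simp

theorem exists_isStaircase_octants {γ : Type*} [LinearOrder γ] (z : ι → γ) (P : Finset ι) :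
    ∃ E S B, IsStaircase x y P E S B ∧ IsSparse x y E S B ∧ ∀ X Y Z, ∀ t ⊆ P, 12 ≤ t.card →
      (∀ i ∈ t, x i ≤ X ∧ y i ≤ Y ∧ z i ≤ Z) →
      ContainsEdge E {i | i ∈ P ∧ x i ≤ X ∧ y i ≤ Y ∧ z i ≤ Z} := by
  classical
  induction P using Finset.induction_on_max_value z with
  | empty =>
    refine ⟨fun _ _ => False, ∅, ∅, isStaircase_empty, fun U V _ t ht _ hc => ?_,
      fun X Y Z t ht hc => ?_⟩ <;> simp [Finset.subset_empty.1 ht] at hc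
  | insert a P ha hmax ih =>
    obtain ⟨E, S, B, h, hs, hoct⟩ := ih
    obtain ⟨E', S', B', hE, h', hs'⟩ := h.exists_insert hs ha
    refine ⟨E', S', B', h', hs', fun X Y Z t ht hc htW => ?_⟩
    by_cases hZ : z a ≤ Z
    · obtain ⟨u, v, huv, hu, hv⟩ := h'.containsEdge hs' (LowerSet.Iic X) (LowerSet.Iic Y) ht
        (fun i hi => ⟨(htW i hi).1, (htW i hi).2.1⟩) hc
      have hle : ∀ i ∈ insert a P, z i ≤ Z := fun i hi => by
        rcases Finset.mem_insert.1 hi with rfl | hi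
        exacts [hZ, (hmax i hi).trans hZ]
      have hm := h'.edge_mem u v huv
      exact ⟨u, v, huv, ⟨hm.1, hu.1, hu.2, hle u hm.1⟩, hm.2, hv.1, hv.2, hle v hm.2⟩
    · have htP : t ⊆ P := fun i hi => (Finset.mem_insert.1 (ht hi)).resolve_left
        fun e => hZ (e ▸ (htW i hi).2.2)
      exact (hoct X Y Z t htP hc htW).mono hE fun i hi => ⟨Finset.mem_insert_of_mem hi.1, hi.2⟩

/-- Finitely many points in space can be two-coloured so that every octant with at least twelve of
the points contains points of both colours. -/
theorem exists_coloring_octants {γ : Type*} [LinearOrder γ] (x : ι → α) (y : ι → β) (z : ι → γ)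
    (P : Finset ι) :
    ∃ f : ι → Bool, ∀ X Y Z, ∀ t ⊆ P, 12 ≤ t.card →
      (∀ i, i ∈ t ↔ i ∈ P ∧ x i ≤ X ∧ y i ≤ Y ∧ z i ≤ Z) → ∀ k, ∃ i ∈ t, f i = k := by
  obtain ⟨E, S, B, h, -, hoct⟩ := exists_isStaircase_octants (x := x) (y := y) z P
  obtain ⟨f, -, hf⟩ := h.extend fun _ => true
  refine ⟨f, fun X Y Z t ht hc htW k => ?_⟩
  obtain ⟨u, v, huv, hu, hv⟩ := hoct X Y Z t ht hc fun i hi => ((htW i).1 hi).2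
  have hne := hf u v huv
  by_cases hk : f u = k
  · exact ⟨u, (htW u).2 hu, hk⟩
  · exact ⟨v, (htW v).2 hv, by revert hne hk; cases f u <;> cases f v <;> cases k <;> simp⟩

end Staircase

/-- A family of finite sets has a two-colouring with both colours in every set if every finite
subfamily has one. -/
theorem exists_coloring_of_finite {ι κ : Type*} (F : κ → Finset ι)
    (h : ∀ s : Finset κ, ∃ f : ι → Bool, ∀ p ∈ s, ∀ k, ∃ i ∈ F p, f i = k) :
    ∃ f : ι → Bool, ∀ p k, ∃ i ∈ F p, f i = k := by
  have hclosed : ∀ p, IsClosed {f : ι → Bool | ∀ k, ∃ i ∈ F p, f i = k} := fun p => by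
    have he : {f : ι → Bool | ∀ k, ∃ i ∈ F p, f i = k} = ⋂ k, ⋃ i ∈ F p, {f | f i = k} := by
      ext
      simp
    rw [he]
    exact isClosed_iInter fun k => Set.Finite.isClosed_biUnion (Finset.finite_toSet _) fun i _ =>
      isClosed_eq (continuous_apply i) continuous_const
  obtain ⟨f, -, hf⟩ := isCompact_univ.inter_iInter_nonempty _ hclosed fun s => by
    obtain ⟨f, hf⟩ := h s
    exact ⟨f, trivial, Set.mem_iInter₂.2 hf⟩
  exact ⟨f, fun p => Set.mem_iInter.1 hf p⟩

theorem exists_coordinates_homothets {A B C : Fin 2 → ℝ} (hABC : AffineIndependent ℝ ![A, B, C]) :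
    ∃ (ℓ : Fin 3 → (Fin 2 → ℝ) →ₗ[ℝ] ℝ) (d : Fin 3 → ℝ), ∀ (c : Fin 2 → ℝ) (r : ℝ), 0 < r → ∀ p,
      p ∈ (fun x => c + r • x) '' convexHull ℝ {A, B, C} ↔ ∀ k, ℓ k c - r * d k ≤ ℓ k p := by
  have htop : affineSpan ℝ (Set.range ![A, B, C]) = ⊤ :=
    hABC.affineSpan_eq_top_iff_card_eq_finrank_add_one.2 (by simp)
  let b : AffineBasis (Fin 3) ℝ (Fin 2 → ℝ) := ⟨![A, B, C], hABC, htop⟩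
  have hb : (Set.range b : Set (Fin 2 → ℝ)) = {A, B, C} := by
    change Set.range ![A, B, C] = _
    rw [Matrix.range_cons, Matrix.range_cons_cons_empty, Set.singleton_union]
  refine ⟨fun k => (b.coord k).linear, fun k => b.coord k 0, fun c r hr p => ?_⟩
  have hmem : p ∈ (fun x => c + r • x) '' convexHull ℝ {A, B, C} ↔
      r⁻¹ • (p - c) ∈ convexHull ℝ {A, B, C} := by
    constructor
    · rintro ⟨q, hq, rfl⟩
      simpa [smul_smul, hr.ne'] using hq
    · exact fun hq => ⟨_, hq, by simp [smul_smul, hr.ne']⟩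
  rw [hmem, ← hb, b.convexHull_eq_nonneg_coord]
  refine forall_congr' fun k => ?_
  have hk : b.coord k (r⁻¹ • (p - c)) =
      r⁻¹ * ((b.coord k).linear p - (b.coord k).linear c) + b.coord k 0 := by
    rw [← map_sub, ← smul_eq_mul r⁻¹, ← map_smul]
    exact congrFun (b.coord k).decomp _
  have hmul : r * (r⁻¹ * ((b.coord k).linear p - (b.coord k).linear c) + b.coord k 0) =
      (b.coord k).linear p - ((b.coord k).linear c - r * b.coord k 0) := by
    field_simp
    ring
  rw [hk, ← mul_nonneg_iff_of_pos_left hr, hmul, sub_nonneg]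

/-- Any locally finite 12-fold covering of the whole plane with positive homothetic
copies of a nondegenerate triangle is decomposable into two coverings. -/
theorem triangle_homothets_locally_finite_plane_cover_decomposable
    (A B C : Fin 2 → ℝ) (hABC : AffineIndependent ℝ ![A, B, C])
    (T : Set (Fin 2 → ℝ)) (hT : T = convexHull ℝ {A, B, C})
    {ι : Type*} (c : ι → (Fin 2 → ℝ)) (lam : ι → ℝ) (hlam : ∀ i, 0 < lam i)
    (hlocfin : ∀ K : Set (Fin 2 → ℝ), IsCompact K →
      {i : ι | ((fun x => c i + lam i • x) '' T ∩ K).Nonempty}.Finite)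
    (hcov : ∀ p : Fin 2 → ℝ, 12 ≤ {i : ι | p ∈ (fun x => c i + lam i • x) '' T}.encard) :
    ∃ I₁ I₂ : Set ι, I₁ ∪ I₂ = Set.univ ∧ I₁ ∩ I₂ = ∅ ∧
      (∀ p : Fin 2 → ℝ, ∃ i ∈ I₁, p ∈ (fun x => c i + lam i • x) '' T) ∧
      (∀ p : Fin 2 → ℝ, ∃ j ∈ I₂, p ∈ (fun x => c j + lam j • x) '' T) := by
  classical
  subst hT
  obtain ⟨ℓ, d, hℓ⟩ := exists_coordinates_homothets hABC
  have hfin : ∀ p : Fin 2 → ℝ,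
      {i : ι | p ∈ (fun x => c i + lam i • x) '' convexHull ℝ {A, B, C}}.Finite := fun p =>
    (hlocfin {p} isCompact_singleton).subset fun i hi => ⟨p, hi, rfl⟩
  have hF : ∀ p i, i ∈ (hfin p).toFinset ↔
      p ∈ (fun x => c i + lam i • x) '' convexHull ℝ {A, B, C} := fun p i => by
    rw [Set.Finite.mem_toFinset, Set.mem_ofPred_eq]
  have hF12 : ∀ p, 12 ≤ (hfin p).toFinset.card := fun p => by
    have := hcov p
    rw [(hfin p).encard_eq_coe_toFinset_card] at this
    exact_mod_cast this
  obtain ⟨f, hf⟩ := exists_coloring_of_finite (fun p => (hfin p).toFinset) fun s => by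
    obtain ⟨f, hf⟩ := exists_coloring_octants (fun i => ℓ 0 (c i) - lam i * d 0)
      (fun i => ℓ 1 (c i) - lam i * d 1) (fun i => ℓ 2 (c i) - lam i * d 2)
      (s.biUnion fun p => (hfin p).toFinset)
    refine ⟨f, fun p hp => hf (ℓ 0 p) (ℓ 1 p) (ℓ 2 p) _
      (Finset.subset_biUnion_of_mem (fun p => (hfin p).toFinset) hp) (hF12 p) fun i => ?_⟩
    have hi := (hF p i).trans (hℓ (c i) (lam i) (hlam i) p)
    simp only [Fin.forall_fin_succ, Fin.isValue, Fin.succ_zero_eq_one, Fin.succ_one_eq_two,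
      IsEmpty.forall_iff, and_true] at hi
    exact ⟨fun h => ⟨Finset.mem_biUnion.2 ⟨p, hp, h⟩, hi.1 h⟩, fun h => hi.2 h.2⟩
  refine ⟨{i | f i = true}, {i | f i = false}, ?_, ?_, fun p => ?_, fun p => ?_⟩
  · ext i
    cases h : f i <;> simp [h]
  · ext i
    cases h : f i <;> simp [h]
  · obtain ⟨i, hi, hk⟩ := hf p true
    exact ⟨i, hk, (hF p i).1 hi⟩
  · obtain ⟨i, hi, hk⟩ := hf p false
    exact ⟨i, hk, (hF p i).1 hi⟩
end

section
/- Let T be the interior of a nondegenerate triangle in ℝ² (an open triangle). Let (t_i + T)_{i ∈ I} be a family of translates of T that forms a 12-fold covering of the whole plane ℝ². Then the index set I can be partitioned into two parts I₁ and I₂ such that each of the subfamilies (t_i + T)_{i ∈ I₁} and (t_i + T)_{i ∈ I₂} covers the whole plane. -/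
section OctantColoring

variable {ι : Type*}

/-- The elements of `S` lying in the open quadrant with apex `(a, b)`. -/
noncomputable def wedge (x y : ι → ℝ) (S : Finset ι) (a b : ℝ) : Finset ι :=
  S.filter fun i => x i < a ∧ y i < b

theorem mem_wedge {x y : ι → ℝ} {S : Finset ι} {a b : ℝ} {i : ι} :
    i ∈ wedge x y S a b ↔ i ∈ S ∧ x i < a ∧ y i < b := by
  simp [wedge]

theorem wedge_swap (x y : ι → ℝ) (S : Finset ι) (a b : ℝ) :
    wedge y x S b a = wedge x y S a b := by
  ext i; simp only [mem_wedge]; tauto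

theorem wedge_mono (x y : ι → ℝ) {S S' : Finset ι} (h : S ⊆ S') (a b : ℝ) :
    wedge x y S a b ⊆ wedge x y S' a b :=
  Finset.filter_subset_filter _ h

/-- A set meeting both colour classes of `χ`. -/
def Bichromatic (χ : ι → Bool) (S : Finset ι) : Prop :=
  ∃ i ∈ S, ∃ j ∈ S, χ i ≠ χ j

theorem Bichromatic.mono {χ : ι → Bool} {S S' : Finset ι} (h : Bichromatic χ S) (hS : S ⊆ S') :
    Bichromatic χ S' := by
  obtain ⟨i, hi, j, hj, hij⟩ := h
  exact ⟨i, hS hi, j, hS hj, hij⟩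

variable [DecidableEq ι]

/-- A quadrant is unresolved if all its points are free (in `F`) or decided (in `D`), and its
decided points all have the same colour. -/
def Unresolved (x y : ι → ℝ) (P F D : Finset ι) (c : ι → Bool) (a b : ℝ) : Prop :=
  (∀ i ∈ wedge x y P a b, i ∈ F ∨ i ∈ D) ∧
    ∀ i ∈ wedge x y D a b, ∀ j ∈ wedge x y D a b, c i = c j

/-- The bookkeeping that bounds the number of decided points `d` in an unresolved quadrant whose
free points are `f`: apart from at most one, the decided points split into two classes,
each of size at most two, and each point of a class is charged to three guards
which are free or belong to the other class. -/
def Guarded (x y : ι → ℝ) (f d : Finset ι) : Prop :=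
  ∃ D₀ DL DR HL HR : Finset ι, d ⊆ D₀ ∪ DL ∪ DR ∧ D₀.card ≤ 1 ∧ DL.card ≤ 2 ∧ DR.card ≤ 2 ∧
    HL ⊆ f ∪ DR ∧ HR ⊆ f ∪ DL ∧ 3 * DL.card ≤ HL.card ∧ 3 * DR.card ≤ HR.card ∧
    (∀ g ∈ HL, ∃ l ∈ d, y l < y g) ∧ ∀ g ∈ HR, ∃ l ∈ d, x l < x g

theorem Guarded.swap {x y : ι → ℝ} {f d : Finset ι} (h : Guarded x y f d) : Guarded y x f d := by
  obtain ⟨D₀, DL, DR, HL, HR, h1, h2, h3, h4, h5, h6, h7, h8, h9, h10⟩ := h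
  refine ⟨D₀, DR, DL, HR, HL, ?_, h2, h4, h3, h6, h5, h8, h7, h10, h9⟩
  rwa [Finset.union_right_comm]

theorem Guarded.card_le {x y : ι → ℝ} {f d : Finset ι} (h : Guarded x y f d) : d.card ≤ 5 := by
  obtain ⟨D₀, DL, DR, HL, HR, h1, h2, h3, h4, -⟩ := h
  have := Finset.card_le_card h1
  have := Finset.card_union_le (D₀ ∪ DL) DR
  have := Finset.card_union_le D₀ DL
  omega

theorem Guarded.empty (x y : ι → ℝ) (f : Finset ι) : Guarded x y f ∅ :=
  ⟨∅, ∅, ∅, ∅, ∅, by simp⟩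

theorem Guarded.singleton (x y : ι → ℝ) (f : Finset ι) (z : ι) : Guarded x y f {z} :=
  ⟨{z}, ∅, ∅, ∅, ∅, by simp⟩

theorem Guarded.mono {x y : ι → ℝ} {f f' d : Finset ι} (h : Guarded x y f d) (hf : f ⊆ f') :
    Guarded x y f' d := by
  obtain ⟨D₀, DL, DR, HL, HR, h1, h2, h3, h4, h5, h6, h7⟩ := h
  exact ⟨D₀, DL, DR, HL, HR, h1, h2, h3, h4,
    h5.trans (Finset.union_subset_union_left hf), h6.trans (Finset.union_subset_union_left hf), h7⟩

/-- The guards that let `z` be decided: three free points above `z`, all of them (and `z`) below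
every decided point. -/
def GuardedBelow (y : ι → ℝ) (f d : Finset ι) (z : ι) : Prop :=
  ∃ G ⊆ f, G.card = 3 ∧ (∀ g ∈ G, y z < y g) ∧ ∀ g ∈ insert z G, ∀ e ∈ d, y g < y e

theorem Guarded.insert_decided {x y : ι → ℝ} {f d : Finset ι} {z : ι} (h : Guarded x y f d)
    (hz : z ∈ f) (hf : f.card ≤ 7) (hG : GuardedBelow y f d z) :
    Guarded x y (f.erase z) (insert z d) := by
  obtain ⟨D₀, DL, DR, HL, HR, h1, h2, h3, h4, h5, h6, h7, h8, h9, h10⟩ := h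
  obtain ⟨G, hGf, hG3, hzG, hGd⟩ := hG
  have hzG' : z ∉ G := fun hh => lt_irrefl _ (hzG z hh)
  have hdis : Disjoint HL (insert z G) := by
    rw [Finset.disjoint_left]
    intro g hg hg'
    obtain ⟨l, hl, hlt⟩ := h9 g hg
    exact lt_asymm hlt (hGd g hg' l hl)
  have hzHL : z ∉ HL := fun hh =>
    Finset.disjoint_left.1 hdis hh (Finset.mem_insert_self _ _)
  have hcard : HL.card ≤ 5 := by
    have e1 : HL ∪ insert z G ⊆ f ∪ DR :=
      Finset.union_subset h5 (Finset.insert_subset (Finset.mem_union_left _ hz)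
        (hGf.trans Finset.subset_union_left))
    have e2 := Finset.card_le_card e1
    rw [Finset.card_union_of_disjoint hdis, Finset.card_insert_of_notMem hzG'] at e2
    have := Finset.card_union_le f DR
    omega
  have hDL' := Finset.card_insert_le z DL
  refine ⟨D₀, insert z DL, DR, HL ∪ G, HR, ?_, h2, by omega, h4, ?_, ?_, ?_, h8, ?_, ?_⟩
  · intro i hi
    have := @h1 i
    simp only [Finset.mem_insert, Finset.mem_union] at *
    tauto
  · intro i hi
    have a1 := @h5 i
    have a2 := @hGf i
    simp only [Finset.mem_erase, Finset.mem_union] at *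
    rcases hi with hi | hi
    · have : i ≠ z := fun hh => hzHL (hh ▸ hi)
      tauto
    · have : i ≠ z := fun hh => hzG' (hh ▸ hi)
      tauto
  · intro i hi
    have a1 := @h6 i hi
    simp only [Finset.mem_erase, Finset.mem_union, Finset.mem_insert] at *
    tauto
  · rw [Finset.card_union_of_disjoint
      (hdis.mono_right (Finset.subset_insert _ _))]
    omega
  · intro g hg
    rcases Finset.mem_union.1 hg with hg | hg
    · obtain ⟨l, hl, hlt⟩ := h9 g hg
      exact ⟨l, Finset.mem_insert_of_mem hl, hlt⟩
    · exact ⟨z, Finset.mem_insert_self _ _, hzG g hg⟩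
  · intro g hg
    obtain ⟨l, hl, hlt⟩ := h10 g hg
    exact ⟨l, Finset.mem_insert_of_mem hl, hlt⟩

/-- A partial colouring of `P`: the points of `D` have the colours prescribed by `c`, the points
of `F` may still be coloured arbitrarily, and the remaining points then get colours that make every
quadrant through them, as well as every member of `𝒮`, bichromatic. -/
structure PartialColoring (x y : ι → ℝ) (P F D : Finset ι) (c : ι → Bool)
    (𝒮 : Set (Finset ι)) : Prop where
  free_subset : F ⊆ P
  decided_subset : D ⊆ P
  disjoint : Disjoint F D
  antichain : ∀ f ∈ F, ∀ g ∈ F, x f ≤ x g → y f ≤ y g → f = g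
  extend : ∀ g : ι → Bool, ∃ χ : ι → Bool, (∀ i ∈ F, χ i = g i) ∧ (∀ i ∈ D, χ i = c i) ∧
    (∀ a b, ∀ q ∈ wedge x y P a b, q ∉ F → q ∉ D → Bichromatic χ (wedge x y P a b)) ∧
    ∀ S ∈ 𝒮, Bichromatic χ S
  card_free : ∀ a b, Unresolved x y P F D c a b → (wedge x y F a b).card ≤ 8
  card_free' : ∀ a b, Unresolved x y P F D c a b → (wedge x y D a b).Nonempty →
    (wedge x y F a b).card ≤ 7
  guarded : ∀ a b, Unresolved x y P F D c a b →
    Guarded x y (wedge x y F a b) (wedge x y D a b)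

/-- No unresolved quadrant has too many free points. -/
def Stable (x y : ι → ℝ) (P F D : Finset ι) (c : ι → Bool) : Prop :=
  ∀ a b, Unresolved x y P F D c a b → (wedge x y F a b).card ≤ 7 ∧
    ((wedge x y D a b).Nonempty → (wedge x y F a b).card ≤ 6)

theorem PartialColoring.decide {x y : ι → ℝ} {P F D : Finset ι} {c : ι → Bool}
    {𝒮 : Set (Finset ι)} (h : PartialColoring x y P F D c 𝒮) {N : Finset ι} (hN : N ⊆ F)
    {c' : ι → Bool} (hc : ∀ i ∈ D, c' i = c i)
    (hstep : ∀ a b, Unresolved x y P F D c a b → ∀ z ∈ wedge x y N a b,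
      (∀ i ∈ wedge x y (D ∪ N) a b, c' i = c' z) →
      wedge x y N a b = {z} ∧ (wedge x y D a b = ∅ ∨
        GuardedBelow y (wedge x y F a b) (wedge x y D a b) z ∨
        GuardedBelow x (wedge x y F a b) (wedge x y D a b) z)) :
    PartialColoring x y P (F \ N) (D ∪ N) c' 𝒮 := by
  have hDN : ∀ i ∈ D, i ∉ N := fun i hi hi' => Finset.disjoint_left.1 h.disjoint (hN hi') hi
  have hold : ∀ a b, Unresolved x y P (F \ N) (D ∪ N) c' a b → Unresolved x y P F D c a b := by
    intro a b hu
    refine ⟨fun i hi => ?_, fun i hi j hj => ?_⟩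
    · have := hu.1 i hi
      have := @hN i
      simp only [Finset.mem_sdiff, Finset.mem_union] at *
      tauto
    · rw [mem_wedge] at hi hj
      rw [← hc i hi.1, ← hc j hj.1]
      exact hu.2 i (mem_wedge.2 ⟨Finset.mem_union_left _ hi.1, hi.2⟩) j
        (mem_wedge.2 ⟨Finset.mem_union_left _ hj.1, hj.2⟩)
  have key : ∀ a b, Unresolved x y P (F \ N) (D ∪ N) c' a b →
      (wedge x y (F \ N) a b = wedge x y F a b ∧ wedge x y (D ∪ N) a b = wedge x y D a b) ∨
      ∃ z ∈ wedge x y F a b, wedge x y (F \ N) a b = (wedge x y F a b).erase z ∧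
        wedge x y (D ∪ N) a b = insert z (wedge x y D a b) ∧ (wedge x y D a b = ∅ ∨
        GuardedBelow y (wedge x y F a b) (wedge x y D a b) z ∨
        GuardedBelow x (wedge x y F a b) (wedge x y D a b) z) := by
    intro a b hu
    rcases (wedge x y N a b).eq_empty_or_nonempty with he | ⟨z, hz⟩
    · left
      have he' : ∀ i, ¬ (i ∈ N ∧ x i < a ∧ y i < b) := fun i hi => by
        have : i ∈ wedge x y N a b := mem_wedge.2 hi
        simp [he] at this
      constructor <;> ext i <;> have := he' i <;>
        simp only [mem_wedge, Finset.mem_sdiff, Finset.mem_union] at * <;> tauto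
    · right
      have hz' := mem_wedge.1 hz
      obtain ⟨e1, e2⟩ := hstep a b (hold a b hu) z hz fun i hi =>
        hu.2 i hi z (mem_wedge.2 ⟨Finset.mem_union_right _ hz'.1, hz'.2⟩)
      have he' : ∀ i, (i ∈ N ∧ x i < a ∧ y i < b) ↔ i = z := fun i => by
        rw [← mem_wedge, e1, Finset.mem_singleton]
      refine ⟨z, mem_wedge.2 ⟨hN hz'.1, hz'.2⟩, ?_, ?_, e2⟩
      · ext i
        have := he' i
        simp only [mem_wedge, Finset.mem_sdiff, Finset.mem_erase]
        tauto
      · ext i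
        have := he' i
        simp only [mem_wedge, Finset.mem_union, Finset.mem_insert]
        tauto
  refine ⟨Finset.sdiff_subset.trans h.free_subset,
    Finset.union_subset h.decided_subset (hN.trans h.free_subset), ?_, ?_, ?_, ?_, ?_, ?_⟩
  · rw [Finset.disjoint_left]
    intro i hi hi'
    have : i ∈ F → i ∉ D := fun hh => Finset.disjoint_left.1 h.disjoint hh
    simp only [Finset.mem_sdiff, Finset.mem_union] at *
    tauto
  · exact fun f hf g hg => h.antichain f (Finset.sdiff_subset hf) g (Finset.sdiff_subset hg)
  · intro g
    obtain ⟨χ, h1, h2, h3, h4⟩ := h.extend fun i => if i ∈ N then c' i else g i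
    refine ⟨χ, fun i hi => ?_, fun i hi => ?_, fun a b q hq hqF hqD => h3 a b q hq ?_ ?_, h4⟩
    · rw [Finset.mem_sdiff] at hi
      rw [h1 i hi.1, if_neg hi.2]
    · rcases Finset.mem_union.1 hi with hi | hi
      · rw [h2 i hi, hc i hi]
      · rw [h1 i (hN hi), if_pos hi]
    · simp only [Finset.mem_sdiff, Finset.mem_union] at *; tauto
    · simp only [Finset.mem_union] at *; tauto
  · intro a b hu
    have := h.card_free a b (hold a b hu)
    refine le_trans (Finset.card_le_card ?_) this
    intro i
    simp only [mem_wedge, Finset.mem_sdiff]; tauto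
  · intro a b hu hne
    rcases key a b hu with ⟨e1, e2⟩ | ⟨z, hz, e1, e2, -⟩
    · rw [e1]; exact h.card_free' a b (hold a b hu) (e2 ▸ hne)
    · have := h.card_free a b (hold a b hu)
      rw [e1, Finset.card_erase_of_mem hz]
      omega
  · intro a b hu
    have hg := h.guarded a b (hold a b hu)
    rcases key a b hu with ⟨e1, e2⟩ | ⟨z, hz, e1, e2, e3⟩
    · rwa [e1, e2]
    · rw [e1, e2]
      rcases (wedge x y D a b).eq_empty_or_nonempty with hD | hD
      · rw [hD]; exact Guarded.singleton x y _ z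
      have h7 := h.card_free' a b (hold a b hu) hD
      rcases e3 with e3 | e3 | e3
      · exact absurd e3 hD.ne_empty
      · exact hg.insert_decided hz h7 e3
      · exact (hg.swap.insert_decided hz h7 e3).swap

/-- The `n` elements with smallest `x`-coordinate. -/
theorem exists_initial_subset (x : ι → ℝ) (A : Finset ι) (hx : Set.InjOn x A) (n : ℕ)
    (hn : n ≤ A.card) : ∃ G ⊆ A, G.card = n ∧ ∀ g ∈ G, ∀ i ∈ A \ G, x g < x i := by
  induction n with
  | zero => exact ⟨∅, by simp⟩
  | succ n ih =>
    obtain ⟨G, hG, hc, hlt⟩ := ih (by omega)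
    have hne : (A \ G).Nonempty := by
      rw [← Finset.card_pos, Finset.card_sdiff_of_subset hG]; omega
    obtain ⟨m, hm, hmin⟩ := Finset.exists_min_image (A \ G) x hne
    have hm' := Finset.mem_sdiff.1 hm
    refine ⟨insert m G, Finset.insert_subset hm'.1 hG,
      by rw [Finset.card_insert_of_notMem hm'.2, hc], ?_⟩
    intro g hg i hi
    simp only [Finset.mem_sdiff, Finset.mem_insert, not_or] at hi
    have hi' : i ∈ A \ G := Finset.mem_sdiff.2 ⟨hi.1, hi.2.2⟩
    rcases Finset.mem_insert.1 hg with rfl | hg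
    · exact lt_of_le_of_ne (hmin i hi') fun e => hi.2.1 (hx hi.1 hm'.1 e.symm)
    · exact hlt g hg i hi'

/-- The three free points to the left of `z` guard it in quadrants with apex to the left of the
apex of the original one. -/
theorem guardedBelow_of_le {x y : ι → ℝ} {F D G : Finset ι} {a b a' b' : ℝ} {z : ι}
    (hG : G ⊆ wedge x y F a' b') (hG3 : G.card = 3) (hz : z ∈ wedge x y F a' b')
    (hyG : ∀ g ∈ G, x g < x z ∧ y z < y g) (hza : x z < a) (ha : a ≤ a')
    (hD : ∀ e ∈ wedge x y D a b, e ∉ wedge x y D a' b') :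
    wedge x y D a b = ∅ ∨ GuardedBelow y (wedge x y F a b) (wedge x y D a b) z := by
  have hD' : ∀ e ∈ wedge x y D a b, b' ≤ y e := by
    intro e he
    by_contra! hlt
    have he' := mem_wedge.1 he
    exact hD e he (mem_wedge.2 ⟨he'.1, he'.2.1.trans_le ha, hlt⟩)
  by_cases hb : ∀ g ∈ G, y g < b
  · right
    refine ⟨G, fun g hg => mem_wedge.2 ⟨(mem_wedge.1 (hG hg)).1, (hyG g hg).1.trans hza, hb g hg⟩,
      hG3, fun g hg => (hyG g hg).2, fun g hg e he => lt_of_lt_of_le ?_ (hD' e he)⟩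
    rcases Finset.mem_insert.1 hg with rfl | hg
    · exact (mem_wedge.1 hz).2.2
    · exact (mem_wedge.1 (hG hg)).2.2
  · left
    push Not at hb
    obtain ⟨g, hg, hbg⟩ := hb
    have hgb := (mem_wedge.1 (hG hg)).2.2
    refine Finset.eq_empty_of_forall_notMem fun e he => ?_
    have := hD' e he
    have := (mem_wedge.1 he).2.2
    linarith

theorem PartialColoring.lt_of_lt {x y : ι → ℝ} {P F D : Finset ι} {c : ι → Bool}
    {𝒮 : Set (Finset ι)} (h : PartialColoring x y P F D c 𝒮) {f g : ι} (hf : f ∈ F) (hg : g ∈ F)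
    (hlt : x f < x g) : y g < y f := by
  by_contra! hle
  exact hlt.ne (congrArg x (h.antichain f hf g hg hlt.le hle))

theorem PartialColoring.injOn {x y : ι → ℝ} {P F D : Finset ι} {c : ι → Bool}
    {𝒮 : Set (Finset ι)} (h : PartialColoring x y P F D c 𝒮) : Set.InjOn x F := by
  intro f hf g hg e
  rcases le_total (y f) (y g) with hle | hle
  · exact h.antichain f hf g hg e.le hle
  · exact (h.antichain g hg f hf e.ge hle).symm

/-- An unresolved quadrant with decided points and seven free points allows its fourth free point
to be decided. -/
theorem PartialColoring.exists_decide_one {x y : ι → ℝ} {P F D : Finset ι} {c : ι → Bool}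
    {𝒮 : Set (Finset ι)} (h : PartialColoring x y P F D c 𝒮) {a' b' : ℝ}
    (hu : Unresolved x y P F D c a' b') (hD : (wedge x y D a' b').Nonempty)
    (h7 : 7 ≤ (wedge x y F a' b').card) :
    ∃ N ⊆ F, N.Nonempty ∧ ∃ c', PartialColoring x y P (F \ N) (D ∪ N) c' 𝒮 := by
  obtain ⟨w, hw⟩ := hD
  have hAF : wedge x y F a' b' ⊆ F := fun i hi => (mem_wedge.1 hi).1
  have hinj := h.injOn
  obtain ⟨G, hG, hG3, hGlt⟩ := exists_initial_subset x _ (hinj.mono hAF) 3 (by omega)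
  obtain ⟨G', hG', hG1, hGlt'⟩ := exists_initial_subset x (wedge x y F a' b' \ G)
    (hinj.mono (Finset.sdiff_subset.trans hAF)) 1
    (by rw [Finset.card_sdiff_of_subset hG]; omega)
  obtain ⟨z, rfl⟩ := Finset.card_eq_one.1 hG1
  have hzA := hG' (Finset.mem_singleton_self z)
  have hz : z ∈ wedge x y F a' b' := (Finset.mem_sdiff.1 hzA).1
  obtain ⟨H, hH, hH3⟩ := Finset.exists_subset_card_eq
    (s := (wedge x y F a' b' \ G) \ {z}) (n := 3)
    (by rw [Finset.card_sdiff_of_subset hG', Finset.card_sdiff_of_subset hG]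
        simp; omega)
  have hHA : H ⊆ wedge x y F a' b' := hH.trans (Finset.sdiff_subset.trans Finset.sdiff_subset)
  have hGz : ∀ g ∈ G, x g < x z ∧ y z < y g := fun g hg =>
    ⟨hGlt g hg z hzA, h.lt_of_lt (hAF (hG hg)) (hAF hz) (hGlt g hg z hzA)⟩
  have hHz : ∀ g ∈ H, y g < y z ∧ x z < x g := fun g hg => by
    have := hGlt' z (Finset.mem_singleton_self z) g (hH hg)
    exact ⟨h.lt_of_lt (hAF hz) (hAF (hHA hg)) this, this⟩
  have hzD : z ∉ D := fun hh => Finset.disjoint_left.1 h.disjoint (hAF hz) hh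
  refine ⟨{z}, by simpa using hAF hz, by simp, Function.update c z (!c w),
    h.decide (by simpa using hAF hz) ?_ ?_⟩
  · intro i hi
    exact Function.update_of_ne (fun e : i = z => hzD (e ▸ hi)) _ _
  · intro a b _ v hv hmono
    have hv' := mem_wedge.1 hv
    obtain rfl := Finset.mem_singleton.1 hv'.1
    have hcD : ∀ e ∈ wedge x y D a b, c e = !c w := by
      intro e he
      have he' := mem_wedge.1 he
      have := hmono e (mem_wedge.2 ⟨Finset.mem_union_left _ he'.1, he'.2⟩)
      rwa [Function.update_self,
        Function.update_of_ne (fun e1 : e = v => hzD (e1 ▸ he'.1))] at this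
    have hout : ∀ e ∈ wedge x y D a b, e ∉ wedge x y D a' b' := by
      intro e he he'
      have h1 := hcD e he
      rw [hu.2 e he' w hw] at h1
      simp at h1
    have hw' := mem_wedge.1 hw
    have hwW : ¬ (x w < a ∧ y w < b) := fun hh => hout w (mem_wedge.2 ⟨hw'.1, hh⟩) hw
    refine ⟨?_, ?_⟩
    · ext i
      simp only [mem_wedge, Finset.mem_singleton]
      exact ⟨fun hh => hh.1, by rintro rfl; exact ⟨rfl, hv'.2⟩⟩
    · by_cases ha : a ≤ a'
      · exact (guardedBelow_of_le hG hG3 hz hGz hv'.2.1 ha hout).imp_right Or.inl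
      · have hb : b ≤ b' := by
          by_contra! hb
          exact hwW ⟨hw'.2.1.trans (not_le.1 ha), hw'.2.2.trans hb⟩
        simp only [← wedge_swap x y] at hHA hz hout ⊢
        exact (guardedBelow_of_le hHA hH3 hz hHz hv'.2.2 hb hout).imp_right Or.inr

/-- An unresolved quadrant without decided points and with eight free points allows its fourth and
fifth free points to be decided, with different colours. -/
theorem PartialColoring.exists_decide_two {x y : ι → ℝ} {P F D : Finset ι} {c : ι → Bool}
    {𝒮 : Set (Finset ι)} (h : PartialColoring x y P F D c 𝒮) {a' b' : ℝ}
    (hD : wedge x y D a' b' = ∅) (h8 : 8 ≤ (wedge x y F a' b').card) :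
    ∃ N ⊆ F, N.Nonempty ∧ ∃ c', PartialColoring x y P (F \ N) (D ∪ N) c' 𝒮 := by
  have hAF : wedge x y F a' b' ⊆ F := fun i hi => (mem_wedge.1 hi).1
  have hinj := h.injOn
  obtain ⟨G, hG, hG3, hGlt⟩ := exists_initial_subset x _ (hinj.mono hAF) 3 (by omega)
  have hinj' : Set.InjOn x (wedge x y F a' b' \ G : Finset ι) :=
    hinj.mono (Finset.sdiff_subset.trans hAF)
  have hcG := Finset.card_sdiff_of_subset hG
  obtain ⟨G', hG', hG1, hGlt'⟩ := exists_initial_subset x _ hinj' 1 (by omega)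
  obtain ⟨z, rfl⟩ := Finset.card_eq_one.1 hG1
  have hcG' := Finset.card_sdiff_of_subset hG'
  rw [Finset.card_singleton] at hcG'
  obtain ⟨G'', hG'', hG2, hGlt''⟩ := exists_initial_subset x ((wedge x y F a' b' \ G) \ {z})
    (hinj'.mono (Finset.coe_subset.2 Finset.sdiff_subset)) 1 (by omega)
  obtain ⟨z', rfl⟩ := Finset.card_eq_one.1 hG2
  have hcG'' := Finset.card_sdiff_of_subset hG''
  rw [Finset.card_singleton] at hcG''
  obtain ⟨H, hH, hH3⟩ := Finset.exists_subset_card_eq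
    (s := ((wedge x y F a' b' \ G) \ {z}) \ {z'}) (n := 3) (by omega)
  have hHA : H ⊆ wedge x y F a' b' :=
    hH.trans (Finset.sdiff_subset.trans (Finset.sdiff_subset.trans Finset.sdiff_subset))
  have hzA := hG' (Finset.mem_singleton_self z)
  have hz : z ∈ wedge x y F a' b' := (Finset.mem_sdiff.1 hzA).1
  have hzA' := hG'' (Finset.mem_singleton_self z')
  have hz' : z' ∈ wedge x y F a' b' := (Finset.mem_sdiff.1 (Finset.mem_sdiff.1 hzA').1).1
  have hzz : x z < x z' := hGlt' z (Finset.mem_singleton_self z) z' hzA'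
  have hyzz : y z' < y z := h.lt_of_lt (hAF hz) (hAF hz') hzz
  have hne : z' ≠ z := fun e => hzz.ne (congrArg x e.symm)
  have hGz : ∀ g ∈ G, x g < x z ∧ y z < y g := fun g hg =>
    ⟨hGlt g hg z hzA, h.lt_of_lt (hAF (hG hg)) (hAF hz) (hGlt g hg z hzA)⟩
  have hHz : ∀ g ∈ H, y g < y z' ∧ x z' < x g := fun g hg => by
    have := hGlt'' z' (Finset.mem_singleton_self z') g (hH hg)
    exact ⟨h.lt_of_lt (hAF hz') (hAF (hHA hg)) this, this⟩
  have hNF : {z, z'} ⊆ F :=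
    Finset.insert_subset (hAF hz) (Finset.singleton_subset_iff.2 (hAF hz'))
  have hND : ∀ i ∈ D, i ≠ z ∧ i ≠ z' := fun i hi =>
    ⟨fun e => Finset.disjoint_left.1 h.disjoint (hAF hz) (e ▸ hi),
      fun e => Finset.disjoint_left.1 h.disjoint (hAF hz') (e ▸ hi)⟩
  refine ⟨{z, z'}, hNF, by simp, Function.update (Function.update c z true) z' false,
    h.decide hNF ?_ ?_⟩
  · intro i hi
    rw [Function.update_of_ne (hND i hi).2, Function.update_of_ne (hND i hi).1]
  · intro a b _ v hv hmono
    have hout : ∀ e ∈ wedge x y D a b, e ∉ wedge x y D a' b' := fun e _ => by simp [hD]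
    have hcz : Function.update (Function.update c z true) z' false z = true := by
      rw [Function.update_of_ne hne.symm, Function.update_self]
    have hcz' : Function.update (Function.update c z true) z' false z' = false :=
      Function.update_self ..
    have hv' := mem_wedge.1 hv
    rcases Finset.mem_insert.1 hv'.1 with rfl | hvz
    · have hW : ¬ (x z' < a ∧ y z' < b) := fun hh => by
        have := hmono z' (mem_wedge.2 ⟨by simp, hh⟩)
        rw [hcz, hcz'] at this
        exact absurd this (by decide)
      have ha : a ≤ a' := by
        by_contra! ha
        exact hW ⟨(mem_wedge.1 hz').2.1.trans ha, hyzz.trans hv'.2.2⟩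
      refine ⟨?_, (guardedBelow_of_le hG hG3 hz hGz hv'.2.1 ha hout).imp_right Or.inl⟩
      ext i
      simp only [mem_wedge, Finset.mem_insert, Finset.mem_singleton]
      refine ⟨?_, by rintro rfl; exact ⟨Or.inl rfl, hv'.2⟩⟩
      rintro ⟨rfl | rfl, hh⟩
      exacts [rfl, absurd hh hW]
    · obtain rfl := Finset.mem_singleton.1 hvz
      have hW : ¬ (x z < a ∧ y z < b) := fun hh => by
        have := hmono z (mem_wedge.2 ⟨by simp, hh⟩)
        rw [hcz, hcz'] at this
        exact absurd this (by decide)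
      have hb : b ≤ b' := by
        by_contra! hb
        exact hW ⟨hzz.trans hv'.2.1, (mem_wedge.1 hz).2.2.trans hb⟩
      refine ⟨?_, ?_⟩
      · ext i
        simp only [mem_wedge, Finset.mem_insert, Finset.mem_singleton]
        refine ⟨?_, by rintro rfl; exact ⟨Or.inr rfl, hv'.2⟩⟩
        rintro ⟨rfl | rfl, hh⟩
        exacts [absurd hh hW, rfl]
      · simp only [← wedge_swap x y] at hHA hz' hout ⊢
        exact (guardedBelow_of_le hHA hH3 hz' hHz hv'.2.2 hb hout).imp_right Or.inr

theorem PartialColoring.exists_stable {x y : ι → ℝ} {P F D : Finset ι} {c : ι → Bool}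
    {𝒮 : Set (Finset ι)} (h : PartialColoring x y P F D c 𝒮) :
    ∃ F' D' c', PartialColoring x y P F' D' c' 𝒮 ∧ Stable x y P F' D' c' := by
  induction hn : F.card using Nat.strong_induction_on generalizing F D c with
  | _ n ih =>
    subst hn
    by_cases hs : Stable x y P F D c
    · exact ⟨F, D, c, h, hs⟩
    have : ∃ N ⊆ F, N.Nonempty ∧ ∃ c', PartialColoring x y P (F \ N) (D ∪ N) c' 𝒮 := by
      unfold Stable at hs
      push Not at hs
      obtain ⟨a, b, hu, hs⟩ := hs
      rcases (wedge x y D a b).eq_empty_or_nonempty with hD | hD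
      · refine h.exists_decide_two hD ?_
        by_contra! hlt
        exact absurd (hs (by omega)).1 (by simp [hD])
      · refine h.exists_decide_one hu hD ?_
        by_contra! hlt
        have := (hs (by omega)).2
        omega
    obtain ⟨N, hN, hNe, c', hc'⟩ := this
    refine ih _ ?_ hc' rfl
    rw [Finset.card_sdiff_of_subset hN]
    have := hNe.card_pos
    have := Finset.card_le_card hN
    omega

theorem PartialColoring.empty (x y : ι → ℝ) : PartialColoring x y ∅ ∅ ∅ (fun _ => true) ∅ where
  free_subset := subset_rfl
  decided_subset := subset_rfl
  disjoint := Finset.disjoint_empty_left _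
  antichain := by simp
  extend g := ⟨g, by simp [mem_wedge]⟩
  card_free := by simp [wedge]
  card_free' := by simp [wedge]
  guarded _ _ _ := by simpa [wedge] using Guarded.empty x y ∅

theorem bichromatic_of_le_card {x y : ι → ℝ} {P F D : Finset ι} {c : ι → Bool}
    {𝒮 : Set (Finset ι)} (h : PartialColoring x y P F D c 𝒮) (hs : Stable x y P F D c)
    {χ : ι → Bool} (hχD : ∀ i ∈ D, χ i = c i)
    (hχ : ∀ a b, ∀ q ∈ wedge x y P a b, q ∉ F → q ∉ D → Bichromatic χ (wedge x y P a b))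
    {a b : ℝ} (hab : 12 ≤ (wedge x y P a b).card) : Bichromatic χ (wedge x y P a b) := by
  by_contra hb
  have hu : Unresolved x y P F D c a b := by
    refine ⟨fun i hi => ?_, fun i hi j hj => ?_⟩
    · by_contra! hcon
      exact hb (hχ a b i hi hcon.1 hcon.2)
    · by_contra hij
      rw [← hχD i (mem_wedge.1 hi).1, ← hχD j (mem_wedge.1 hj).1] at hij
      exact hb ⟨i, wedge_mono x y h.decided_subset a b hi, j,
        wedge_mono x y h.decided_subset a b hj, hij⟩
  have h1 : wedge x y P a b ⊆ wedge x y F a b ∪ wedge x y D a b := by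
    intro i hi
    have := hu.1 i hi
    simp only [Finset.mem_union, mem_wedge] at *
    tauto
  have h2 := (Finset.card_le_card h1).trans (Finset.card_union_le _ _)
  have h3 := hs a b hu
  have h4 := (h.guarded a b hu).card_le
  rcases (wedge x y D a b).eq_empty_or_nonempty with hD | hD
  · rw [hD, Finset.card_empty] at h2
    omega
  · have := h3.2 hD
    omega

theorem PartialColoring.exists_insert {x y : ι → ℝ} {P F D : Finset ι} {c : ι → Bool}
    {𝒮 : Set (Finset ι)} (h : PartialColoring x y P F D c 𝒮) (hs : Stable x y P F D c) {p : ι}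
    (hp : p ∉ P) (h𝒮 : ∀ S ∈ 𝒮, S ⊆ P) :
    ∃ F' D' c', PartialColoring x y (insert p P) F' D' c' 𝒮 := by
  have hpF : p ∉ F := fun hh => hp (h.free_subset hh)
  have hpD : p ∉ D := fun hh => hp (h.decided_subset hh)
  have hmono : ∀ {χ χ' : ι → Bool}, (∀ i ∈ P, χ i = χ' i) → ∀ S ⊆ P, Bichromatic χ S →
      Bichromatic χ' S := by
    rintro χ χ' he S hS ⟨i, hi, j, hj, hij⟩
    exact ⟨i, hi, j, hj, by rwa [← he i (hS hi), ← he j (hS hj)]⟩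
  have hsub : ∀ {S : Finset ι}, S ⊆ P → ∀ a b, wedge x y S a b ⊆ P := fun hS a b i hi =>
    hS (mem_wedge.1 hi).1
  have hneP : ∀ i ∈ P, i ≠ p := fun i hi e => hp (e ▸ hi)
  by_cases hf : ∃ f ∈ F, x f ≤ x p ∧ y f ≤ y p
  · obtain ⟨f, hf, hfx, hfy⟩ := hf
    have hold : ∀ a b, Unresolved x y (insert p P) F D c a b → Unresolved x y P F D c a b :=
      fun a b hu => ⟨fun i hi => hu.1 i (wedge_mono x y (Finset.subset_insert p P) a b hi), hu.2⟩
    refine ⟨F, D, c, h.free_subset.trans (Finset.subset_insert p P),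
      h.decided_subset.trans (Finset.subset_insert p P), h.disjoint, h.antichain, fun g => ?_,
      fun a b hu => h.card_free a b (hold a b hu), fun a b hu => h.card_free' a b (hold a b hu),
      fun a b hu => h.guarded a b (hold a b hu)⟩
    obtain ⟨χ, h1, h2, h3, h4⟩ := h.extend g
    have he : ∀ i ∈ P, χ i = Function.update χ p (!χ f) i := fun i hi =>
      (Function.update_of_ne (hneP i hi) _ _).symm
    refine ⟨Function.update χ p (!χ f), fun i hi => ?_, fun i hi => ?_, fun a b q hq hqF hqD => ?_,
      fun S hS => hmono he S (h𝒮 S hS) (h4 S hS)⟩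
    · rw [← he i (h.free_subset hi), h1 i hi]
    · rw [← he i (h.decided_subset hi), h2 i hi]
    · have hq' := mem_wedge.1 hq
      rcases Finset.mem_insert.1 hq'.1 with rfl | hqP
      · refine ⟨q, hq, f, mem_wedge.2 ⟨Finset.mem_insert_of_mem (h.free_subset hf),
          hfx.trans_lt hq'.2.1, hfy.trans_lt hq'.2.2⟩, ?_⟩
        rw [← he f (h.free_subset hf), Function.update_self]
        simp
      · exact (hmono he _ (hsub subset_rfl a b) (h3 a b q (mem_wedge.2 ⟨hqP, hq'.2⟩) hqF hqD)).mono
          (wedge_mono x y (Finset.subset_insert p P) a b)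
  · push Not at hf
    set K := F.filter fun q => x p ≤ x q ∧ y p ≤ y q with hK
    have hmK : ∀ i, i ∈ K ↔ i ∈ F ∧ x p ≤ x i ∧ y p ≤ y i := fun i => by simp [hK]
    have hold : ∀ a b, Unresolved x y (insert p P) (insert p (F \ K)) D c a b →
        Unresolved x y P F D c a b := by
      refine fun a b hu => ⟨fun i hi => ?_, hu.2⟩
      have h1 := hu.1 i (wedge_mono x y (Finset.subset_insert p P) a b hi)
      have h2 := hneP i (mem_wedge.1 hi).1
      simp only [Finset.mem_insert, Finset.mem_sdiff] at h1
      tauto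
    have hcard : ∀ a b, (wedge x y (insert p (F \ K)) a b).card ≤ (wedge x y F a b).card + 1 := by
      intro a b
      refine (Finset.card_le_card (?_ : _ ⊆ insert p (wedge x y F a b))).trans
        (Finset.card_insert_le _ _)
      intro i
      simp only [mem_wedge, Finset.mem_insert, Finset.mem_sdiff]
      tauto
    refine ⟨insert p (F \ K), D, c, Finset.insert_subset_insert p
      (Finset.sdiff_subset.trans h.free_subset),
      h.decided_subset.trans (Finset.subset_insert p P), ?_, ?_, fun g => ?_, fun a b hu => ?_,
      fun a b hu hne => ?_, fun a b hu => ?_⟩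
    · rw [Finset.disjoint_insert_left]
      exact ⟨hpD, h.disjoint.mono_left Finset.sdiff_subset⟩
    · intro f hfm g hgm hx hy
      rcases Finset.mem_insert.1 hfm with rfl | hfm <;> rcases Finset.mem_insert.1 hgm with rfl | hgm
      · rfl
      · rw [Finset.mem_sdiff, hmK] at hgm
        exact absurd ⟨hgm.1, hx, hy⟩ hgm.2
      · exact absurd hy (hf f (Finset.mem_sdiff.1 hfm).1 hx).not_ge
      · exact h.antichain f (Finset.mem_sdiff.1 hfm).1 g (Finset.mem_sdiff.1 hgm).1 hx hy
    · obtain ⟨χ, h1, h2, h3, h4⟩ := h.extend fun i => if i ∈ K then !(g p) else g i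
      have he : ∀ i ∈ P, χ i = Function.update χ p (g p) i := fun i hi =>
        (Function.update_of_ne (hneP i hi) _ _).symm
      refine ⟨Function.update χ p (g p), fun i hi => ?_, fun i hi => ?_, fun a b q hq hqF hqD => ?_,
        fun S hS => hmono he S (h𝒮 S hS) (h4 S hS)⟩
      · rcases Finset.mem_insert.1 hi with rfl | hi
        · rw [Function.update_self]
        · rw [Finset.mem_sdiff] at hi
          rw [← he i (h.free_subset hi.1), h1 i hi.1, if_neg hi.2]
      · rw [← he i (h.decided_subset hi), h2 i hi]
      · have hq' := mem_wedge.1 hq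
        have hqp : q ≠ p := fun e => hqF (e ▸ Finset.mem_insert_self _ _)
        have hqP : q ∈ P := Finset.mem_of_mem_insert_of_ne hq'.1 hqp
        by_cases hqK : q ∈ K
        · have hqK' := (hmK q).1 hqK
          refine ⟨q, hq, p, mem_wedge.2 ⟨Finset.mem_insert_self _ _,
            hqK'.2.1.trans_lt hq'.2.1, hqK'.2.2.trans_lt hq'.2.2⟩, ?_⟩
          rw [← he q hqP, Function.update_self, h1 q hqK'.1, if_pos hqK]
          simp
        · have hqF' : q ∉ F := fun hh =>
            hqF (Finset.mem_insert_of_mem (Finset.mem_sdiff.2 ⟨hh, hqK⟩))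
          exact (hmono he _ (hsub subset_rfl a b)
            (h3 a b q (mem_wedge.2 ⟨hqP, hq'.2⟩) hqF' hqD)).mono
            (wedge_mono x y (Finset.subset_insert p P) a b)
    · have := (hs a b (hold a b hu)).1
      have := hcard a b
      omega
    · have := (hs a b (hold a b hu)).2 hne
      have := hcard a b
      omega
    · refine (h.guarded a b (hold a b hu)).mono fun i hi => ?_
      have hi' := mem_wedge.1 hi
      have h1 := hu.1 i (wedge_mono x y (h.free_subset.trans (Finset.subset_insert p P)) a b hi)
      have h2 : i ∉ D := fun hh => Finset.disjoint_left.1 h.disjoint hi'.1 hh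
      exact mem_wedge.2 ⟨h1.resolve_right h2, hi'.2⟩

/-- The sets of at least twelve points of `P` in an open octant. -/
def octants (x y z : ι → ℝ) (P : Finset ι) : Set (Finset ι) :=
  {S | ∃ a b k, S = P.filter (fun i => x i < a ∧ y i < b ∧ z i < k) ∧ 12 ≤ S.card}

theorem exists_stable_octants (x y z : ι → ℝ) (P : Finset ι) :
    ∃ F D c, PartialColoring x y P F D c (octants x y z P) ∧ Stable x y P F D c := by
  induction P using Finset.induction_on_max_value z with
  | empty =>
    have : octants x y z (∅ : Finset ι) = ∅ := by
      ext S
      simp only [octants, Set.mem_ofPred_eq, Finset.filter_empty, Set.mem_empty_iff_false, iff_false]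
      rintro ⟨-, -, -, rfl, h⟩
      simp at h
    rw [this]
    exact (PartialColoring.empty x y).exists_stable
  | insert p P hp hz ih =>
    obtain ⟨F, D, c, h, hs⟩ := ih
    obtain ⟨F₁, D₁, c₁, h₁⟩ := h.exists_insert hs hp
      (by rintro S ⟨a, b, k, rfl, -⟩; exact Finset.filter_subset _ _)
    obtain ⟨F₂, D₂, c₂, h₂, hs₂⟩ := h₁.exists_stable
    refine ⟨F₂, D₂, c₂, { h₂ with extend := fun g => ?_ }, hs₂⟩
    obtain ⟨χ, e1, e2, e3, e4⟩ := h₂.extend g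
    refine ⟨χ, e1, e2, e3, ?_⟩
    rintro S ⟨a, b, k, rfl, hS⟩
    by_cases hk : z p < k
    · have : (insert p P).filter (fun i => x i < a ∧ y i < b ∧ z i < k)
          = wedge x y (insert p P) a b := by
        refine Finset.filter_congr fun i hi => ?_
        have : z i < k := by
          rcases Finset.mem_insert.1 hi with rfl | hi
          exacts [hk, (hz i hi).trans_lt hk]
        tauto
      rw [this] at hS ⊢
      exact bichromatic_of_le_card h₂ hs₂ e2 e3 hS
    · refine e4 _ ⟨a, b, k, ?_, hS⟩
      rw [Finset.filter_insert, if_neg (fun hh => hk hh.2.2)]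

/-- Finitely many points in space can be two-coloured so that every open octant containing at least
twelve of them contains both colours. -/
theorem exists_bichromatic_octants (x y z : ι → ℝ) (P : Finset ι) :
    ∃ χ : ι → Bool, ∀ a b k, 12 ≤ (P.filter fun i => x i < a ∧ y i < b ∧ z i < k).card →
      Bichromatic χ (P.filter fun i => x i < a ∧ y i < b ∧ z i < k) := by
  obtain ⟨F, D, c, h, -⟩ := exists_stable_octants x y z P
  obtain ⟨χ, -, -, -, hχ⟩ := h.extend c
  exact ⟨χ, fun a b k hk => hχ _ ⟨a, b, k, rfl, hk⟩⟩

end OctantColoring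

/-- A point-finite system of open octants, each containing at least twelve of the given points,
admits a two-colouring of the points for which all octants are bichromatic. -/
theorem exists_coloring_of_finite_octants {ι α : Type*} (x y z : ι → ℝ) (J : Set ι)
    (a b k : α → ℝ)
    (hfin : ∀ q, {i ∈ J | x i < a q ∧ y i < b q ∧ z i < k q}.Finite)
    (hcard : ∀ q, 12 ≤ {i ∈ J | x i < a q ∧ y i < b q ∧ z i < k q}.encard) :
    ∃ χ : ι → Bool, ∀ q, ∃ i ∈ {i ∈ J | x i < a q ∧ y i < b q ∧ z i < k q},
      ∃ j ∈ {i ∈ J | x i < a q ∧ y i < b q ∧ z i < k q}, χ i ≠ χ j := by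
  classical
  set S : α → Set ι := fun q => {i ∈ J | x i < a q ∧ y i < b q ∧ z i < k q}
  have hclosed : ∀ q, IsClosed {χ : ι → Bool | ∃ i ∈ S q, ∃ j ∈ S q, χ i ≠ χ j} := by
    intro q
    have : {χ : ι → Bool | ∃ i ∈ S q, ∃ j ∈ S q, χ i ≠ χ j}
        = ⋃ i ∈ S q, ⋃ j ∈ S q, {χ : ι → Bool | χ i ≠ χ j} := by
      ext χ; simp
    rw [this]
    refine (hfin q).isClosed_biUnion fun i _ => (hfin q).isClosed_biUnion fun j _ => ?_
    exact (isClosed_discrete {p : Bool × Bool | p.1 ≠ p.2}).preimage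
      (f := fun χ : ι → Bool => (χ i, χ j)) (by fun_prop)
  obtain ⟨χ, hχ⟩ := CompactSpace.iInter_nonempty hclosed fun Q => by
    set P : Finset ι := Q.biUnion fun q => (hfin q).toFinset with hP
    obtain ⟨χ, hχ⟩ := exists_bichromatic_octants x y z P
    refine ⟨χ, Set.mem_iInter₂.2 fun q hq => ?_⟩
    have hPq : P.filter (fun i => x i < a q ∧ y i < b q ∧ z i < k q) = (hfin q).toFinset := by
      ext i
      simp only [hP, Finset.mem_filter, Finset.mem_biUnion, Set.Finite.mem_toFinset]
      exact ⟨fun ⟨⟨r, _, hr⟩, hi⟩ => ⟨hr.1, hi⟩, fun hi => ⟨⟨q, hq, hi⟩, hi.2⟩⟩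
    obtain ⟨i, hi, j, hj, hij⟩ := hχ (a q) (b q) (k q) (by
      have := hcard q
      rw [(hfin q).encard_eq_coe_toFinset_card] at this
      rw [hPq]
      exact_mod_cast this)
    rw [hPq, Set.Finite.mem_toFinset] at hi hj
    exact ⟨i, hi, j, hj, hij⟩
  exact ⟨χ, fun q => Set.mem_iInter.1 hχ q⟩

theorem IsCompact.exists_finset_fold_cover {ι E : Type*} [TopologicalSpace E] {K : Set E}
    (hK : IsCompact K) {V : ι → Set E} (hV : ∀ i, IsOpen (V i)) {m : ℕ}
    (hm : ∀ p ∈ K, (m : ℕ∞) ≤ {i | p ∈ V i}.encard) :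
    ∃ F : Finset ι, (∀ i ∈ F, (V i ∩ K).Nonempty) ∧
      ∀ p ∈ K, (m : ℕ∞) ≤ {i | i ∈ F ∧ p ∈ V i}.encard := by
  classical
  have hs : ∀ p ∈ K, ∃ s : Finset ι, (∀ i ∈ s, p ∈ V i) ∧ s.card = m := by
    intro p hp
    obtain ⟨s, hs, hsm⟩ := Set.exists_subset_encard_eq (hm p hp)
    have hf : s.Finite := Set.finite_of_encard_eq_coe hsm
    refine ⟨hf.toFinset, fun i hi => hs (hf.mem_toFinset.1 hi), ?_⟩
    rw [hf.encard_eq_coe_toFinset_card] at hsm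
    exact_mod_cast hsm
  choose! s hs hsm using hs
  obtain ⟨Q, hQ, hKQ⟩ := hK.elim_nhds_subcover (fun p => ⋂ i ∈ s p, V i) fun p hp =>
    (Filter.biInter_finset_mem _).2 fun i hi => (hV i).mem_nhds (hs p hp i hi)
  refine ⟨(Q.biUnion s).filter fun i => (V i ∩ K).Nonempty,
    fun i hi => (Finset.mem_filter.1 hi).2, fun p hp => ?_⟩
  obtain ⟨q, hq, hpq⟩ := Set.mem_iUnion₂.1 (hKQ hp)
  rw [← hsm q (hQ q hq), ← Set.encard_coe_eq_coe_finsetCard]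
  refine Set.encard_le_encard fun i hi => ?_
  have hpi : p ∈ V i := Set.mem_iInter₂.1 hpq i hi
  exact ⟨Finset.mem_filter.2 ⟨Finset.mem_biUnion.2 ⟨q, hq, hi⟩, p, hpi, hp⟩, hpi⟩

/-- A multiple covering by open sets of bounded diameter contains a point-finite one of the same
multiplicity. -/
theorem exists_point_finite_fold_cover {ι E : Type*} [NormedAddCommGroup E] [ProperSpace E]
    {V : ι → Set E} (hV : ∀ i, IsOpen (V i)) {R : ℝ} (hR : ∀ i, ∀ p ∈ V i, ∀ q ∈ V i, dist p q ≤ R)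
    {m : ℕ} (hm : ∀ p, (m : ℕ∞) ≤ {i | p ∈ V i}.encard) :
    ∃ J : Set ι, ∀ p, {i ∈ J | p ∈ V i}.Finite ∧ (m : ℕ∞) ≤ {i ∈ J | p ∈ V i}.encard := by
  have hK : ∀ n : ℕ, IsCompact (Metric.closedBall (0 : E) (n + 1) \ Metric.ball 0 n) := fun n =>
    (isCompact_closedBall _ _).diff Metric.isOpen_ball
  choose F hF hFm using fun n => (hK n).exists_finset_fold_cover hV fun p _ => hm p
  refine ⟨{i | ∃ n, i ∈ F n}, fun p => ⟨?_, ?_⟩⟩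
  · obtain ⟨N, hN⟩ := exists_nat_ge (‖p‖ + R)
    refine ((Set.finite_Iic N).biUnion fun n _ => (F n).finite_toSet).subset ?_
    rintro i ⟨⟨n, hn⟩, hp⟩
    obtain ⟨q, hq, hqK⟩ := hF n i hn
    refine Set.mem_biUnion (x := n) ?_ hn
    have h1 : (n : ℝ) ≤ ‖q‖ := by simpa using hqK.2
    have h2 := hR i q hq p hp
    have h3 : ‖q‖ ≤ ‖p‖ + dist q p := by
      rw [dist_eq_norm]; exact norm_le_norm_add_norm_sub' q p
    exact_mod_cast (by linarith : (n : ℝ) ≤ N)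
  · have hp : p ∈ Metric.closedBall (0 : E) (⌊‖p‖⌋₊ + 1) \ Metric.ball 0 ⌊‖p‖⌋₊ := by
      refine ⟨?_, ?_⟩
      · simpa using (Nat.lt_floor_add_one ‖p‖).le
      · simpa using Nat.floor_le (norm_nonneg p)
    refine (hFm _ p hp).trans (Set.encard_le_encard ?_)
    exact fun i hi => ⟨⟨_, hi.1⟩, hi.2⟩

/-- Any 12-fold covering of the whole plane with translates of an open triangle
is decomposable into two coverings. -/
theorem open_triangle_translates_plane_cover_decomposable
    (A B C : Fin 2 → ℝ) (hABC : AffineIndependent ℝ ![A, B, C])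
    (T : Set (Fin 2 → ℝ)) (hT : T = interior (convexHull ℝ {A, B, C}))
    {ι : Type*} (t : ι → (Fin 2 → ℝ))
    (hcov : ∀ p : Fin 2 → ℝ, 12 ≤ {i : ι | p ∈ (t i + ·) '' T}.encard) :
    ∃ I₁ I₂ : Set ι, I₁ ∪ I₂ = Set.univ ∧ I₁ ∩ I₂ = ∅ ∧
      (∀ p : Fin 2 → ℝ, ∃ i ∈ I₁, p ∈ (t i + ·) '' T) ∧
      (∀ p : Fin 2 → ℝ, ∃ j ∈ I₂, p ∈ (t j + ·) '' T) := by
  obtain ⟨e, he⟩ : ∃ e : AffineBasis (Fin 3) ℝ (Fin 2 → ℝ), ⇑e = ![A, B, C] :=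
    ⟨⟨_, hABC, hABC.affineSpan_eq_top_iff_card_eq_finrank_add_one.2 (by simp)⟩, rfl⟩
  have hrange : Set.range e = {A, B, C} := by
    rw [he, Matrix.range_cons, Matrix.range_cons, Matrix.range_cons, Matrix.range_empty]
    ext
    simp only [Set.mem_union, Set.mem_singleton_iff, Set.mem_insert_iff, Set.mem_empty_iff_false]
    tauto
  have hmem : ∀ p i, p ∈ (t i + ·) '' T ↔ ∀ j, (e.coord j).linear (t i) < e.coord j p := by
    intro p i
    rw [hT, ← hrange, e.interior_convexHull]
    have hj : ∀ j, e.coord j (p - t i) = e.coord j p - (e.coord j).linear (t i) := fun j => by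
      have := (e.coord j).map_vadd (p - t i) (t i)
      simp only [vadd_eq_add, add_sub_cancel] at this
      rw [this]; ring
    constructor
    · rintro ⟨q, hq, rfl⟩ j
      have := hj j
      simp only [add_sub_cancel_left] at this
      have := hq j
      linarith
    · intro h
      refine ⟨p - t i, fun j => ?_, by simp⟩
      rw [hj j]
      exact sub_pos.2 (h j)
  have hopen : ∀ i, IsOpen ((t i + ·) '' T) := fun i => by
    rw [hT]; exact isOpenMap_add_left (t i) _ isOpen_interior
  have hbdd : Bornology.IsBounded T := by
    rw [hT]
    refine Bornology.IsBounded.subset ?_ interior_subset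
    exact isBounded_convexHull.2 (Set.toFinite _).isBounded
  obtain ⟨R, hR⟩ := Metric.isBounded_iff.1 hbdd
  obtain ⟨J, hJ⟩ := exists_point_finite_fold_cover (m := 12) hopen (R := R) (by
    rintro i _ ⟨p, hp, rfl⟩ _ ⟨q, hq, rfl⟩
    simpa using hR hp hq) hcov
  simp only [hmem, Fin.forall_fin_succ, IsEmpty.forall_iff, and_true] at hJ ⊢
  obtain ⟨χ, hχ⟩ := exists_coloring_of_finite_octants _ _ _ J _ _ _ (fun p => (hJ p).1)
    fun p => (hJ p).2
  refine ⟨{i | χ i = true}, {i | χ i = false}, ?_, ?_, fun p => ?_, fun p => ?_⟩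
  · ext i; cases h : χ i <;> simp [h]
  · ext i; cases h : χ i <;> simp [h]
  · obtain ⟨i, hi, j, hj, hij⟩ := hχ p
    cases h : χ i
    · exact ⟨j, by simpa [h] using hij, hj.2⟩
    · exact ⟨i, h, hi.2⟩
  · obtain ⟨i, hi, j, hj, hij⟩ := hχ p
    cases h : χ i
    · exact ⟨i, h, hi.2⟩
    · exact ⟨j, by simpa [h] using hij, hj.2⟩
end
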